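/- arXiv:2111.10141 — 2 statements merged into one kernel-verified Lean document; each statement's English description precedes it below -/
import Mathlib

section
/- (Sobolev–Poincaré inequality for p = 1 in s(·)-John domains) Let D ⊆ ℝ^n, n ≥ 2, be an s(·)-John domain, with s log-Hölder continuous and 1 ≤ s⁻ ≤ s⁺ < n/(n−1). Then there exists a constant c such that ‖u − u_B‖_{L^{q(·)}(D)} ≤ c ‖∇u‖_{L^1(D)} for all u ∈ L^1_1(D), where q(x) = n/(s(x)(n−1)) and B = B(x₀, dist(x₀, ∂D)). -/
open MeasureTheory Metric

/-- `D` is an `s(·)`-John domain with John constants `a ≤ b` and John center `x₀`: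
every point of `D` is joined to `x₀` by a rectifiable curve, parametrized by arc
length (hence `1`-Lipschitz), of length at most `b`, along which
`t^{s(x)} ≤ (b/a) dist(γ t, ∂D)`. -/
def IsJohnDomain {n : ℕ} (D : Set (EuclideanSpace ℝ (Fin n)))
    (s : EuclideanSpace ℝ (Fin n) → ℝ) (a b : ℝ)
    (x₀ : EuclideanSpace ℝ (Fin n)) : Prop :=
  IsOpen D ∧ IsConnected D ∧ Bornology.IsBounded D ∧ 0 < a ∧ a ≤ b ∧ x₀ ∈ D ∧
    ∀ x ∈ D, ∃ ℓ : ℝ, 0 ≤ ℓ ∧ ℓ ≤ b ∧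
      ∃ γ : ℝ → EuclideanSpace ℝ (Fin n),
        γ 0 = x ∧ γ ℓ = x₀ ∧ LipschitzOnWith 1 γ (Set.Icc 0 ℓ) ∧
        (∀ t ∈ Set.Icc 0 ℓ, γ t ∈ D) ∧
        (∀ t ∈ Set.Icc 0 ℓ, t ^ s x ≤ (b / a) * Metric.infDist (γ t) (frontier D))

/-- The Luxemburg norm on the variable exponent Lebesgue space `L^{p(·)}(Ω)`. -/
noncomputable def luxNorm {n : ℕ} (p : EuclideanSpace ℝ (Fin n) → ℝ)
    (Ω : Set (EuclideanSpace ℝ (Fin n))) (f : EuclideanSpace ℝ (Fin n) → ℝ) : ℝ :=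
  sInf {l : ℝ | 0 < l ∧ ∫⁻ x in Ω, ENNReal.ofReal ((|f x| / l) ^ p x) ≤ 1}
/-- `g` is log-Hölder continuous on `U` with constant `c`. -/
def LogHolderWith {n : ℕ} (c : ℝ) (g : EuclideanSpace ℝ (Fin n) → ℝ)
    (U : Set (EuclideanSpace ℝ (Fin n))) : Prop :=
  ∀ ⦃x⦄, x ∈ U → ∀ ⦃y⦄, y ∈ U → x ≠ y →
    |g x - g y| ≤ c / Real.log (Real.exp 1 + 1 / dist x y)

open MeasureTheory Metric Set
open scoped ENNReal

abbrev Eu (n : ℕ) := EuclideanSpace ℝ (Fin n)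

lemma mem_ball_affine {n : ℕ} (z : Eu n) {R : ℝ} (hR : 0 < R) (ξ : Eu n) :
    z + R • ξ ∈ ball z R ↔ ξ ∈ ball (0 : Eu n) 1 := by
  simp only [mem_ball, dist_eq_norm, add_sub_cancel_left, sub_zero, norm_smul, Real.norm_eq_abs,
    abs_of_pos hR]
  constructor
  · intro h; nlinarith
  · intro h; nlinarith

lemma lint_affine {n : ℕ} (F : Eu n → ℝ≥0∞) (z : Eu n) {R : ℝ} (hR : 0 < R) :
    ∫⁻ ξ in ball (0 : Eu n) 1, F (z + R • ξ) =
      ENNReal.ofReal ((R ^ n)⁻¹) * ∫⁻ y in ball z R, F y := by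
  have key : ∀ G : Eu n → ℝ≥0∞, ∫⁻ ξ, G (R • ξ) = ENNReal.ofReal ((R ^ n)⁻¹) * ∫⁻ y, G y := by
    intro G
    have h1 := Measure.map_addHaar_smul (volume : Measure (Eu n)) hR.ne'
    have h2 := lintegral_map_equiv (μ := (volume : Measure (Eu n))) G
      (Homeomorph.smul (isUnit_iff_ne_zero.2 hR.ne').unit).toMeasurableEquiv
    have h3 : (⇑(Homeomorph.smul (α := Eu n) (isUnit_iff_ne_zero.2 hR.ne').unit).toMeasurableEquiv)
      = fun x => R • x := rfl
    rw [h3] at h2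
    rw [← h2, h1, lintegral_smul_measure]
    simp only [finrank_euclideanSpace, Fintype.card_fin, smul_eq_mul]
    rw [abs_of_pos (by positivity)]
  rw [← lintegral_indicator measurableSet_ball, ← lintegral_indicator measurableSet_ball]
  have : ∀ ξ, (ball (0 : Eu n) 1).indicator (fun ξ => F (z + R • ξ)) ξ
      = (ball z R).indicator F (z + R • ξ) := by
    intro ξ
    by_cases h : ξ ∈ ball (0 : Eu n) 1
    · rw [indicator_of_mem h, indicator_of_mem ((mem_ball_affine z hR ξ).2 h)]
    · rw [indicator_of_notMem h, indicator_of_notMem (fun h' => h ((mem_ball_affine z hR ξ).1 h'))]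
  simp_rw [this]
  rw [key (fun y => (ball z R).indicator F (z + y)),
    lintegral_add_left_eq_self (fun y => (ball z R).indicator F y) z]

lemma int_affine {n : ℕ} (F : Eu n → ℝ) (z : Eu n) {R : ℝ} (hR : 0 < R) :
    ∫ ξ in ball (0 : Eu n) 1, F (z + R • ξ) =
      volume.real (ball (0 : Eu n) 1) * ⨍ y in ball z R, F y := by
  have hV : volume.real (ball z R) = R ^ n * volume.real (ball (0 : Eu n) 1) := by
    simp only [Measure.real]
    rw [Measure.addHaar_ball_of_pos _ _ hR]
    simp [ENNReal.toReal_mul, hR.le]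
  have hV0 : 0 < volume.real (ball (0 : Eu n) 1) :=
    ENNReal.toReal_pos (measure_ball_pos _ _ one_pos).ne' measure_ball_lt_top.ne
  rw [setAverage_eq, hV, ← integral_indicator measurableSet_ball,
    ← integral_indicator measurableSet_ball]
  have : ∀ ξ, (ball (0 : Eu n) 1).indicator (fun ξ => F (z + R • ξ)) ξ
      = (ball z R).indicator F (z + R • ξ) := by
    intro ξ
    by_cases h : ξ ∈ ball (0 : Eu n) 1
    · rw [indicator_of_mem h, indicator_of_mem ((mem_ball_affine z hR ξ).2 h)]
    · rw [indicator_of_notMem h, indicator_of_notMem (fun h' => h ((mem_ball_affine z hR ξ).1 h'))]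
  simp_rw [this]
  rw [Measure.integral_comp_smul volume (fun y => (ball z R).indicator F (z + y)) R,
    integral_add_left_eq_self (fun y => (ball z R).indicator F y) z]
  simp only [finrank_euclideanSpace, Fintype.card_fin, smul_eq_mul]
  rw [abs_of_pos (by positivity)]
  field_simp

/-- FTC along a segment, in `ENNReal` form. -/
lemma ftc_segment {n : ℕ} {D : Set (Eu n)} (hD : IsOpen D) {w : Eu n → ℝ}
    (hw : DifferentiableOn ℝ w D) (p q : Eu n)
    (hseg : ∀ τ ∈ Icc (0 : ℝ) 1, q + τ • (p - q) ∈ D) :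
    ‖w p - w q‖ₑ ≤ ∫⁻ τ in Icc (0 : ℝ) 1, ‖p - q‖ₑ * ‖fderiv ℝ w (q + τ • (p - q))‖ₑ := by
  by_cases hfin : ∫⁻ τ in Icc (0 : ℝ) 1, ‖p - q‖ₑ * ‖fderiv ℝ w (q + τ • (p - q))‖ₑ = ∞
  · rw [hfin]; exact le_top
  set f' : ℝ → ℝ := fun τ => fderiv ℝ w (q + τ • (p - q)) (p - q) with hf'
  have hline : Measurable fun τ : ℝ => q + τ • (p - q) := by fun_prop
  have hmeas : Measurable f' := by
    have := (measurable_fderiv ℝ w).comp hline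
    exact (ContinuousLinearMap.measurable_apply (p - q)).comp this
  have hle : ∀ τ, ‖f' τ‖ₑ ≤ ‖p - q‖ₑ * ‖fderiv ℝ w (q + τ • (p - q))‖ₑ := by
    intro τ
    rw [mul_comm]
    exact ContinuousLinearMap.le_opENorm _ _
  have hbd : ∫⁻ τ in Icc (0 : ℝ) 1, ‖f' τ‖ₑ ≤
      ∫⁻ τ in Icc (0 : ℝ) 1, ‖p - q‖ₑ * ‖fderiv ℝ w (q + τ • (p - q))‖ₑ :=
    lintegral_mono hle
  have hInteg : IntegrableOn f' (Icc 0 1) :=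
    ⟨hmeas.aestronglyMeasurable, lt_of_le_of_lt hbd (lt_top_iff_ne_top.2 hfin)⟩
  have hder : ∀ τ ∈ Icc (0 : ℝ) 1, HasDerivAt (fun τ : ℝ => w (q + τ • (p - q))) (f' τ) τ := by
    intro τ hτ
    have h1 : HasFDerivAt w (fderiv ℝ w (q + τ • (p - q))) (q + τ • (p - q)) :=
      ((hw _ (hseg τ hτ)).differentiableAt (hD.mem_nhds (hseg τ hτ))).hasFDerivAt
    have h2 : HasDerivAt (fun τ : ℝ => q + τ • (p - q)) (p - q) τ := by
      simpa using ((hasDerivAt_id τ).smul_const (p - q)).const_add q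
    exact h1.comp_hasDerivAt τ h2
  have hFTC := intervalIntegral.integral_eq_sub_of_hasDerivAt (a := 0) (b := 1)
    (f := fun τ : ℝ => w (q + τ • (p - q))) (f' := f')
    (by intro x hx; rw [uIcc_of_le zero_le_one] at hx; exact hder x hx)
    ((intervalIntegrable_iff_integrableOn_Icc_of_le zero_le_one).2 hInteg)
  simp only [one_smul, zero_smul, add_zero, add_sub_cancel] at hFTC
  rw [← hFTC, intervalIntegral.integral_of_le zero_le_one, ← integral_Icc_eq_integral_Ioc]
  exact (enorm_integral_le_lintegral_enorm _).trans hbd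

/-- Coupling estimate for averages over two balls lying in a convex set. -/
lemma coupling {n : ℕ} {D U : Set (Eu n)} (hD : IsOpen D) (hUc : Convex ℝ U) (hUD : U ⊆ D)
    {w : Eu n → ℝ}
    (hw : DifferentiableOn ℝ w D) (p q : Eu n) {P Q m L : ℝ} (hm : 0 < m) (hP : m ≤ P) (hQ : m ≤ Q)
    (hpU : ball p P ⊆ U) (hqU : ball q Q ⊆ U) (hL : dist p q + |P - Q| ≤ L) :
    ∫⁻ ξ in ball (0 : Eu n) 1, ‖w (p + P • ξ) - w (q + Q • ξ)‖ₑ ≤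
      ENNReal.ofReal (L * (m ^ n)⁻¹) * ∫⁻ y in U, ‖fderiv ℝ w y‖ₑ := by
  have hP0 : 0 < P := hm.trans_le hP
  have hQ0 : 0 < Q := hm.trans_le hQ
  have hL0 : 0 ≤ L := le_trans (by positivity) hL
  set F : Eu n → ℝ≥0∞ := fun y => ‖fderiv ℝ w y‖ₑ with hF
  have hFm : Measurable F := (measurable_fderiv ℝ w).enorm
  have h1 : ∀ ξ ∈ ball (0 : Eu n) 1, ‖w (p + P • ξ) - w (q + Q • ξ)‖ₑ ≤
      ∫⁻ τ in Icc (0 : ℝ) 1, ENNReal.ofReal L *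
        F ((q + τ • (p - q)) + (Q + τ * (P - Q)) • ξ) := by
    intro ξ hξ
    have e : ∀ τ : ℝ, (q + Q • ξ) + τ • ((p + P • ξ) - (q + Q • ξ)) =
        (q + τ • (p - q)) + (Q + τ * (P - Q)) • ξ := by intro τ; module
    have hpm := hpU ((mem_ball_affine p hP0 ξ).2 hξ)
    have hqm := hqU ((mem_ball_affine q hQ0 ξ).2 hξ)
    refine (ftc_segment hD hw _ _ ?_).trans ?_
    · intro τ hτ
      exact hUD (hUc.add_smul_sub_mem hqm hpm hτ)
    · refine lintegral_mono fun τ => ?_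
      simp only [e]
      gcongr
      rw [← ofReal_norm]
      apply ENNReal.ofReal_le_ofReal
      have hξ1 : ‖ξ‖ ≤ 1 := by simpa using (mem_ball_zero_iff.1 hξ).le
      calc ‖(p + P • ξ) - (q + Q • ξ)‖ = ‖(p - q) + (P - Q) • ξ‖ := by congr 1; module
        _ ≤ ‖p - q‖ + |P - Q| * ‖ξ‖ := by
          refine (norm_add_le _ _).trans ?_
          rw [norm_smul, Real.norm_eq_abs]
        _ ≤ dist p q + |P - Q| := by
          rw [dist_eq_norm]
          nlinarith [abs_nonneg (P - Q)]
        _ ≤ L := hL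
  calc ∫⁻ ξ in ball (0 : Eu n) 1, ‖w (p + P • ξ) - w (q + Q • ξ)‖ₑ
      ≤ ∫⁻ ξ in ball (0 : Eu n) 1, ∫⁻ τ in Icc (0 : ℝ) 1, ENNReal.ofReal L *
        F ((q + τ • (p - q)) + (Q + τ * (P - Q)) • ξ) := by
        apply setLIntegral_mono' measurableSet_ball h1
    _ = ∫⁻ τ in Icc (0 : ℝ) 1, ∫⁻ ξ in ball (0 : Eu n) 1, ENNReal.ofReal L *
        F ((q + τ • (p - q)) + (Q + τ * (P - Q)) • ξ) := by
        apply lintegral_lintegral_swap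
        apply Measurable.aemeasurable
        apply Measurable.const_mul
        apply hFm.comp
        fun_prop
    _ ≤ ∫⁻ τ in Icc (0 : ℝ) 1, ENNReal.ofReal (L * (m ^ n)⁻¹) * ∫⁻ y in U, F y := by
        apply setLIntegral_mono' measurableSet_Icc
        intro τ hτ
        have hmτ : m ≤ Q + τ * (P - Q) := by
          have h0 := hτ.1
          have h1 := hτ.2
          nlinarith
        have hpos : 0 < Q + τ * (P - Q) := hm.trans_le hmτ
        rw [lintegral_const_mul' _ _ ENNReal.ofReal_ne_top, lint_affine F _ hpos, ← mul_assoc,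
          ← ENNReal.ofReal_mul hL0]
        gcongr
        intro y hy
        set ξ : Eu n := (Q + τ * (P - Q))⁻¹ • (y - (q + τ • (p - q)))
        have hyξ : y = (q + τ • (p - q)) + (Q + τ * (P - Q)) • ξ := by
          simp only [ξ, smul_smul, mul_inv_cancel₀ hpos.ne']; module
        rw [hyξ] at hy ⊢
        have hξ := (mem_ball_affine _ hpos ξ).1 hy
        have e : (q + Q • ξ) + τ • ((p + P • ξ) - (q + Q • ξ)) =
          (q + τ • (p - q)) + (Q + τ * (P - Q)) • ξ := by module
        rw [← e]
        exact hUc.add_smul_sub_mem (hqU ((mem_ball_affine q hQ0 ξ).2 hξ))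
          (hpU ((mem_ball_affine p hP0 ξ).2 hξ)) hτ
    _ = _ := by simp

lemma integrable_affine {n : ℕ} {D : Set (Eu n)} {w : Eu n → ℝ} (hw : ContinuousOn w D)
    {y : Eu n} {r : ℝ} (hr : 0 ≤ r) (h : closedBall y r ⊆ D) :
    IntegrableOn (fun ξ => w (y + r • ξ)) (ball (0 : Eu n) 1) := by
  have hc : ContinuousOn (fun ξ => w (y + r • ξ)) (closedBall (0 : Eu n) 1) := by
    apply hw.comp (by fun_prop)
    intro ξ hξ
    apply h
    rw [mem_closedBall_zero_iff] at hξ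
    rw [mem_closedBall, dist_eq_norm, add_sub_cancel_left, norm_smul, Real.norm_eq_abs,
      abs_of_nonneg hr]
    nlinarith
  exact (hc.integrableOn_compact (isCompact_closedBall 0 1)).mono_set ball_subset_closedBall

lemma meas_D_indicator {n : ℕ} {D : Set (Eu n)} (hD : IsOpen D) {w : Eu n → ℝ}
    (hw : ContinuousOn w D) : Measurable (D.indicator w) := by
  classical
  have := hw.measurable_piecewise (g := fun _ => (0 : ℝ)) continuousOn_const hD.measurableSet
  have e : D.piecewise w (fun _ => (0 : ℝ)) = D.indicator w := Set.piecewise_eq_indicator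
  rwa [e] at this

section P0
variable {n : ℕ} {D : Set (Eu n)} {w : Eu n → ℝ} {R : Eu n → ℝ}

/-- un-normalised average -/
noncomputable def Gav (D : Set (Eu n)) (w : Eu n → ℝ) (R : Eu n → ℝ) (z : Eu n) : ℝ :=
  ∫ ξ in ball (0 : Eu n) 1, D.indicator w (z + R z • ξ)

noncomputable def Aosc (D : Set (Eu n)) (w : Eu n → ℝ) (R : Eu n → ℝ) (y : Eu n) : ℝ≥0∞ :=
  ENNReal.ofReal (R y * ((R y / 2) ^ n)⁻¹) *
    ∫⁻ η in D, ‖fderiv ℝ w η‖ₑ * (ball y (2 * R y)).indicator 1 η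

lemma Gav_eq {z : Eu n} (hR : 0 ≤ R z) (h : closedBall z (R z) ⊆ D) :
    Gav D w R z = ∫ ξ in ball (0 : Eu n) 1, w (z + R z • ξ) := by
  apply setIntegral_congr_fun measurableSet_ball
  intro ξ hξ
  apply indicator_of_mem
  apply h
  rw [mem_ball_zero_iff] at hξ
  rw [mem_closedBall, dist_eq_norm, add_sub_cancel_left, norm_smul, Real.norm_eq_abs,
      abs_of_nonneg hR]
  nlinarith

lemma osc_bound (hD : IsOpen D) (hw : DifferentiableOn ℝ w D)
    (hLip : ∀ y ∈ D, ∀ z ∈ D, |R y - R z| ≤ dist y z / 16)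
    {z y : Eu n} (hz : z ∈ D) (hRz : 0 < R z) (hzD : ball z (4 * R z) ⊆ D)
    (hy : y ∈ ball z (R z / 4)) :
    y ∈ D ∧ R y ≤ 2 * R z ∧ ‖Gav D w R z - Gav D w R y‖ₑ ≤ Aosc D w R y := by
  rw [mem_ball] at hy
  have hyD : y ∈ D := hzD (by rw [mem_ball]; linarith)
  have hl := abs_le.1 (hLip y hyD z hz)
  have hRy : 0 < R y := by linarith
  refine ⟨hyD, by linarith, ?_⟩
  have hcz : closedBall z (R z) ⊆ D :=
    (closedBall_subset_ball (by linarith)).trans hzD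
  have hUz : ball y (2 * R y) ⊆ D :=
    (ball_subset_ball' (by linarith)).trans hzD
  have hcy : closedBall y (R y) ⊆ D :=
    (closedBall_subset_ball (by linarith)).trans hUz
  rw [Gav_eq hRz.le hcz, Gav_eq hRy.le hcy,
    ← integral_sub (integrable_affine hw.continuousOn hRz.le hcz)
      (integrable_affine hw.continuousOn hRy.le hcy)]
  refine (enorm_integral_le_lintegral_enorm _).trans ?_
  have hdist : dist z y < R z / 4 := by rwa [dist_comm]
  refine (coupling hD (convex_ball y (2 * R y)) hUz hw z y (m := R y / 2) (L := R y)
    (by linarith) (by linarith) (by linarith) (ball_subset_ball' (by linarith))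
    (ball_subset_ball (by linarith)) ?_).trans ?_
  · have : |R z - R y| ≤ R z / 64 := by
      rw [abs_le]; constructor <;> linarith
    linarith
  · unfold Aosc
    refine mul_le_mul_right ?_ _
    rw [← lintegral_indicator measurableSet_ball, ← lintegral_indicator hD.measurableSet]
    apply lintegral_mono
    intro η
    by_cases h : η ∈ ball y (2 * R y)
    · simp [h, hUz h]
    · simp [h]

lemma Gav_meas (hD : IsOpen D) (hw : ContinuousOn w D) (hR : Continuous R) :
    Measurable (Gav D w R) := by
  unfold Gav
  have : StronglyMeasurable (Function.uncurry fun (z ξ : Eu n) => D.indicator w (z + R z • ξ)) := by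
    apply Measurable.stronglyMeasurable
    apply (meas_D_indicator hD hw).comp
    fun_prop
  exact (this.integral_prod_right (ν := volume.restrict (ball (0 : Eu n) 1))).measurable

lemma ind_meas (hR : Continuous R) :
    Measurable fun p : Eu n × Eu n => (ball p.1 (2 * R p.1)).indicator (1 : Eu n → ℝ≥0∞) p.2 := by
  have : (fun p : Eu n × Eu n => (ball p.1 (2 * R p.1)).indicator (1 : Eu n → ℝ≥0∞) p.2) =
      {p : Eu n × Eu n | dist p.2 p.1 < 2 * R p.1}.indicator 1 := by
    funext p
    by_cases h : dist p.2 p.1 < 2 * R p.1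
    · rw [indicator_of_mem (by rwa [mem_ball]), indicator_of_mem (by exact h)]; rfl
    · rw [indicator_of_notMem (by rwa [mem_ball]), indicator_of_notMem (by exact h)]
  rw [this]
  apply Measurable.indicator measurable_const
  exact (isOpen_lt (by fun_prop) (by fun_prop)).measurableSet

lemma Aosc_meas (hR : Continuous R) : Measurable (Aosc D w R) := by
  unfold Aosc
  apply Measurable.mul
  · apply ENNReal.measurable_ofReal.comp
    have := hR.measurable
    fun_prop
  · apply Measurable.lintegral_prod_right' (f := fun p : Eu n × Eu n => ‖fderiv ℝ w p.2‖ₑ *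
      (ball p.1 (2 * R p.1)).indicator 1 p.2)
    exact (((measurable_fderiv ℝ w).comp measurable_snd).enorm).mul (ind_meas hR)

lemma Gav_cont (hD : IsOpen D) (hw : ContinuousOn w D) (hR : Continuous R) (hR0 : ∀ z, 0 ≤ R z)
    {Γ : Set (Eu n)} (hΓ : IsCompact Γ) (hΓD : ∀ z ∈ Γ, closedBall z (R z) ⊆ D) :
    ContinuousOn (Gav D w R) Γ := by
  set m : Eu n × Eu n → Eu n := fun p => p.1 + R p.1 • p.2 with hm
  have hmc : Continuous m := by fun_prop
  have hmD : ∀ p ∈ Γ ×ˢ closedBall (0 : Eu n) 1, m p ∈ D := by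
    rintro ⟨z, ξ⟩ ⟨hz, hξ⟩
    apply hΓD z hz
    simp only [mem_closedBall_zero_iff] at hξ
    simp only [m]
    rw [mem_closedBall, dist_eq_norm, add_sub_cancel_left, norm_smul, Real.norm_eq_abs,
      abs_of_nonneg (hR0 z)]
    nlinarith [hR0 z]
  have hcont : ContinuousOn (fun p => w (m p)) (Γ ×ˢ closedBall (0 : Eu n) 1) :=
    hw.comp hmc.continuousOn hmD
  obtain ⟨M, hM⟩ := (hΓ.prod (isCompact_closedBall (0 : Eu n) 1)).exists_bound_of_continuousOn hcont
  unfold Gav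
  apply continuousOn_of_dominated (bound := fun _ => M)
  · intro z _
    apply Measurable.aestronglyMeasurable
    apply (meas_D_indicator hD hw).comp
    fun_prop
  · intro z hz
    filter_upwards [ae_restrict_mem measurableSet_ball] with ξ hξ
    have hp : (z, ξ) ∈ Γ ×ˢ closedBall (0 : Eu n) 1 := ⟨hz, ball_subset_closedBall hξ⟩
    have := hM _ hp
    rw [indicator_of_mem (hmD _ hp)]
    exact this
  · exact integrableOn_const measure_ball_lt_top.ne
  · filter_upwards [ae_restrict_mem measurableSet_ball] with ξ hξ
    have : ContinuousOn (fun z => w (m (z, ξ))) Γ :=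
      hcont.comp (f := fun z => (z, ξ)) (by fun_prop) (fun z hz => ⟨hz, ball_subset_closedBall hξ⟩)
    refine this.congr ?_
    intro z hz
    exact indicator_of_mem (hmD (z, ξ) ⟨hz, ball_subset_closedBall hξ⟩) w

/-- lower bound on the Fubini integral -/
lemma lower_bound (hD : IsOpen D) (hw : DifferentiableOn ℝ w D)
    (hLip : ∀ y ∈ D, ∀ z ∈ D, |R y - R z| ≤ dist y z / 16)
    {z : Eu n} (hz : z ∈ D) (hRz : 0 < R z) (hzD : ball z (4 * R z) ⊆ D) :
    ENNReal.ofReal ((8 ^ n)⁻¹) * volume (ball (0 : Eu n) 1) ≤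
      ∫⁻ y in D, ENNReal.ofReal ((R y ^ n)⁻¹) *
        (closedEBall (Gav D w R y) (Aosc D w R y)).indicator 1 (Gav D w R z) := by
  have hsub : ball z (R z / 4) ⊆ D := (ball_subset_ball (by linarith)).trans hzD
  calc ENNReal.ofReal ((8 ^ n)⁻¹) * volume (ball (0 : Eu n) 1)
      = ∫⁻ y in ball z (R z / 4), ENNReal.ofReal (((2 * R z) ^ n)⁻¹) := by
        rw [setLIntegral_const,
          Measure.addHaar_ball_of_pos volume z (r := R z / 4) (by linarith)]
        simp only [finrank_euclideanSpace, Fintype.card_fin]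
        rw [← mul_assoc, ← ENNReal.ofReal_mul (by positivity)]
        have e : ((2 * R z) ^ n)⁻¹ * (R z / 4) ^ n = ((8 : ℝ) ^ n)⁻¹ := by
          rw [← inv_pow, ← inv_pow, ← mul_pow]
          congr 1
          field_simp
          norm_num
        rw [e]
    _ ≤ ∫⁻ y in ball z (R z / 4), ENNReal.ofReal ((R y ^ n)⁻¹) *
        (closedEBall (Gav D w R y) (Aosc D w R y)).indicator 1 (Gav D w R z) := by
        apply setLIntegral_mono' measurableSet_ball
        intro y hy
        obtain ⟨hyD, h2, h3⟩ := osc_bound hD hw hLip hz hRz hzD hy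
        rw [indicator_of_mem (by rwa [mem_closedEBall, edist_eq_enorm_sub])]
        simp only [Pi.one_apply, mul_one]
        apply ENNReal.ofReal_le_ofReal
        have hl := abs_le.1 (hLip y hyD z hz)
        rw [mem_ball] at hy
        have hRy : 0 < R y := by linarith
        gcongr
    _ ≤ _ := lintegral_mono_set hsub

lemma upper_bound (hD : IsOpen D) (hR : Continuous R)
    (hLip : ∀ y ∈ D, ∀ z ∈ D, |R y - R z| ≤ dist y z / 16) :
    ∫⁻ y in D, ENNReal.ofReal ((R y ^ n)⁻¹) * (2 * Aosc D w R y) ≤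
      ENNReal.ofReal (4 * 32 ^ n) * volume (ball (0 : Eu n) 1) *
      ∫⁻ η in D, ‖fderiv ℝ w η‖ₑ * ENNReal.ofReal (R η * (R η ^ n)⁻¹) := by
  have hRm := hR.measurable
  have hfm : Measurable fun η => ‖fderiv ℝ w η‖ₑ := (measurable_fderiv ℝ w).enorm
  set c : Eu n → ℝ≥0∞ := fun y => ENNReal.ofReal ((R y ^ n)⁻¹) *
    (2 * ENNReal.ofReal (R y * ((R y / 2) ^ n)⁻¹)) with hc
  have hcm : Measurable c := by
    rw [hc]
    fun_prop
  calc ∫⁻ y in D, ENNReal.ofReal ((R y ^ n)⁻¹) * (2 * Aosc D w R y)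
      = ∫⁻ y in D, ∫⁻ η in D, c y * (‖fderiv ℝ w η‖ₑ * (ball y (2 * R y)).indicator 1 η) := by
        apply lintegral_congr
        intro y
        rw [lintegral_const_mul' _ _ (by
          simp only [hc]
          exact ENNReal.mul_ne_top ENNReal.ofReal_ne_top
            (ENNReal.mul_ne_top (by simp) ENNReal.ofReal_ne_top))]
        simp only [Aosc, hc]
        ring
    _ = ∫⁻ η in D, ∫⁻ y in D, c y * (‖fderiv ℝ w η‖ₑ * (ball y (2 * R y)).indicator 1 η) := by
        apply lintegral_lintegral_swap
        apply Measurable.aemeasurable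
        exact (hcm.comp measurable_fst).mul ((hfm.comp measurable_snd).mul (ind_meas hR))
    _ ≤ ∫⁻ η in D, ENNReal.ofReal (4 * 32 ^ n) * volume (ball (0 : Eu n) 1) *
          (‖fderiv ℝ w η‖ₑ * ENNReal.ofReal (R η * (R η ^ n)⁻¹)) := by
        apply setLIntegral_mono' hD.measurableSet
        intro η hη
        have hbound : ∀ y ∈ D, c y * (‖fderiv ℝ w η‖ₑ * (ball y (2 * R y)).indicator 1 η) ≤
            (ball η (4 * R η)).indicator (fun _ => ‖fderiv ℝ w η‖ₑ *
              ENNReal.ofReal (4 * 8 ^ n * R η * (R η ^ n)⁻¹ * (R η ^ n)⁻¹)) y := by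
          intro y hy
          by_cases h : η ∈ ball y (2 * R y)
          · rw [mem_ball] at h
            have hl := abs_le.1 (hLip y hy η hη)
            rw [dist_comm] at hl
            have hRy : 0 < R y := by
              have := dist_nonneg (x := η) (y := y)
              linarith
            have hRη : 0 < R η := by linarith
            have hym : y ∈ ball η (4 * R η) := by
              rw [mem_ball, dist_comm]; linarith
            rw [indicator_of_mem hym, indicator_of_mem (by rwa [mem_ball])]
            simp only [Pi.one_apply, mul_one]
            rw [mul_comm]
            gcongr
            simp only [hc]
            rw [show (2 : ℝ≥0∞) = ENNReal.ofReal 2 by simp, ← ENNReal.ofReal_mul (by norm_num),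
              ← ENNReal.ofReal_mul (by positivity)]
            apply ENNReal.ofReal_le_ofReal
            calc (R y ^ n)⁻¹ * (2 * (R y * ((R y / 2) ^ n)⁻¹))
                ≤ ((R η / 2) ^ n)⁻¹ * (2 * ((2 * R η) * ((R η / 4) ^ n)⁻¹)) := by
                  have e1 : (R y ^ n)⁻¹ ≤ ((R η / 2) ^ n)⁻¹ :=
                    inv_anti₀ (by positivity) (pow_le_pow_left₀ (by positivity) (by linarith) n)
                  have e2 : ((R y / 2) ^ n)⁻¹ ≤ ((R η / 4) ^ n)⁻¹ :=
                    inv_anti₀ (by positivity) (pow_le_pow_left₀ (by positivity) (by linarith) n)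
                  have e3 : R y ≤ 2 * R η := by linarith
                  gcongr ?_ * (2 * (?_ * ?_))
              _ = 4 * 8 ^ n * R η * (R η ^ n)⁻¹ * (R η ^ n)⁻¹ := by
                  rw [show (8 : ℝ) = 2 * 4 by norm_num, div_pow, div_pow, mul_pow]
                  field_simp
                  ring
          · simp [h]
        refine (setLIntegral_mono' hD.measurableSet hbound).trans ?_
        refine (setLIntegral_le_lintegral _ _).trans ?_
        rw [lintegral_indicator measurableSet_ball, setLIntegral_const]
        by_cases hRη : 0 < R η
        · rw [Measure.addHaar_ball_of_pos _ _ (by linarith)]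
          simp only [finrank_euclideanSpace, Fintype.card_fin]
          have : ENNReal.ofReal (4 * 8 ^ n * R η * (R η ^ n)⁻¹ * (R η ^ n)⁻¹) *
              ENNReal.ofReal ((4 * R η) ^ n) =
              ENNReal.ofReal (4 * 32 ^ n) * ENNReal.ofReal (R η * (R η ^ n)⁻¹) := by
            rw [← ENNReal.ofReal_mul (by positivity), ← ENNReal.ofReal_mul (by positivity)]
            congr 1
            rw [show (32 : ℝ) = 8 * 4 by norm_num, mul_pow, mul_pow]
            field_simp
          calc _ = ‖fderiv ℝ w η‖ₑ * volume (ball (0 : Eu n) 1) *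
              (ENNReal.ofReal (4 * 8 ^ n * R η * (R η ^ n)⁻¹ * (R η ^ n)⁻¹) *
              ENNReal.ofReal ((4 * R η) ^ n)) := by ring
            _ ≤ _ := by rw [this]; apply le_of_eq; ring
        · rw [ball_eq_empty.2 (by linarith)]
          simp
    _ = _ := by
        rw [lintegral_const_mul]
        apply hfm.mul
        apply ENNReal.measurable_ofReal.comp
        fun_prop

lemma P0 (hD : IsOpen D) (hw : DifferentiableOn ℝ w D) (hR : Continuous R)
    (hR0 : ∀ z, 0 ≤ R z)
    (hLip : ∀ y ∈ D, ∀ z ∈ D, |R y - R z| ≤ dist y z / 16)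
    {x x1 : Eu n} (hRx : ∀ z, R z = 0 ↔ z = x)
    {Γ : Set (Eu n)} (hΓ : IsCompact Γ) (hΓc : IsPreconnected Γ) (hΓD : Γ ⊆ D)
    (hx : x ∈ Γ) (hx1 : x1 ∈ Γ) (hΓb : ∀ z ∈ Γ, ball z (4 * R z) ⊆ D) :
    ‖Gav D w R x - Gav D w R x1‖ₑ ≤ ENNReal.ofReal (4 * 256 ^ n) *
      ∫⁻ η in D, ‖fderiv ℝ w η‖ₑ * ENNReal.ofReal (R η * (R η ^ n)⁻¹) := by
  have hcb : ∀ z ∈ Γ, closedBall z (R z) ⊆ D := by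
    intro z hz
    rcases (hR0 z).eq_or_lt with h | h
    · rw [← h, closedBall_zero]; exact singleton_subset_iff.2 (hΓD hz)
    · exact (closedBall_subset_ball (by linarith)).trans (hΓb z hz)
  have hGc := Gav_cont hD hw.continuousOn hR hR0 hΓ hcb
  have hGm : Measurable (Gav D w R) := Gav_meas hD hw.continuousOn hR
  have hAm : Measurable (Aosc D w R) := Aosc_meas hR
  have himg : uIcc (Gav D w R x) (Gav D w R x1) ⊆ Gav D w R '' Γ :=
    (hΓc.image _ hGc).ordConnected.uIcc_subset (mem_image_of_mem _ hx) (mem_image_of_mem _ hx1)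
  set I := uIcc (Gav D w R x) (Gav D w R x1)
  set Φ : ℝ → Eu n → ℝ≥0∞ := fun v y => ENNReal.ofReal ((R y ^ n)⁻¹) *
        (closedEBall (Gav D w R y) (Aosc D w R y)).indicator 1 v with hΦ
  have hvol : volume I = ‖Gav D w R x - Gav D w R x1‖ₑ := by
    simp only [I]
    rw [Real.volume_interval, ← Real.enorm_eq_ofReal_abs, ← enorm_neg]
    congr 1; ring
  have h1 : (ENNReal.ofReal ((8 ^ n)⁻¹) * volume (ball (0 : Eu n) 1)) * volume I ≤
      ∫⁻ v, ∫⁻ y in D, Φ v y := by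
    rw [← setLIntegral_const]
    refine le_trans ?_ (setLIntegral_le_lintegral I _)
    apply lintegral_mono_ae
    have hne : ∀ᵐ v ∂(volume.restrict I), v ≠ Gav D w R x :=
      ae_restrict_of_ae (Measure.ae_ne volume _)
    filter_upwards [ae_restrict_mem measurableSet_uIcc, hne] with v hv hv'
    obtain ⟨z, hz, rfl⟩ := himg hv
    have hzx : z ≠ x := fun h => hv' (by rw [h])
    have hRz : 0 < R z := lt_of_le_of_ne (hR0 z) (fun h => hzx ((hRx z).1 h.symm))
    exact lower_bound hD hw hLip (hΓD hz) hRz (hΓb z hz)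
  have h2 : ∫⁻ v, ∫⁻ y in D, Φ v y = ∫⁻ y in D, ENNReal.ofReal ((R y ^ n)⁻¹) *
      (2 * Aosc D w R y) := by
    rw [lintegral_lintegral_swap]
    · apply lintegral_congr
      intro y
      simp only [hΦ]
      rw [lintegral_const_mul' _ _ ENNReal.ofReal_ne_top,
        lintegral_indicator_one isClosed_closedEBall.measurableSet, Real.volume_closedEBall]
    · apply Measurable.aemeasurable
      have : Function.uncurry Φ = fun p : ℝ × Eu n => ENNReal.ofReal ((R p.2 ^ n)⁻¹) *
          {p : ℝ × Eu n | edist p.1 (Gav D w R p.2) ≤ Aosc D w R p.2}.indicator 1 p := by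
        funext p
        rfl
      rw [this]
      have hRm := hR.measurable
      apply Measurable.mul
      · apply ENNReal.measurable_ofReal.comp; fun_prop
      · apply Measurable.indicator measurable_const
        exact measurableSet_le (measurable_fst.edist (hGm.comp measurable_snd))
          (hAm.comp measurable_snd)
  have h3 := h1.trans (h2.le.trans (upper_bound (w := w) hD hR hLip))
  have hV0 : volume (ball (0 : Eu n) 1) ≠ 0 := (measure_ball_pos _ _ one_pos).ne'
  have hVt : volume (ball (0 : Eu n) 1) ≠ ∞ := measure_ball_lt_top.ne
  set J := ∫⁻ η in D, ‖fderiv ℝ w η‖ₑ * ENNReal.ofReal (R η * (R η ^ n)⁻¹)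
  rw [← hvol]
  have h4 : volume (ball (0 : Eu n) 1) * (ENNReal.ofReal ((8 ^ n)⁻¹) * volume I) ≤
      volume (ball (0 : Eu n) 1) * (ENNReal.ofReal (4 * 32 ^ n) * J) := by
    calc _ = _ := by ring
      _ ≤ _ := h3
      _ = _ := by ring
  have h5 := (ENNReal.mul_le_mul_iff_right hV0 hVt).1 h4
  calc volume I = ENNReal.ofReal (8 ^ n) * (ENNReal.ofReal ((8 ^ n)⁻¹) * volume I) := by
        rw [← mul_assoc, ← ENNReal.ofReal_mul (by positivity), mul_inv_cancel₀ (by positivity)]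
        simp
    _ ≤ ENNReal.ofReal (8 ^ n) * (ENNReal.ofReal (4 * 32 ^ n) * J) := by gcongr
    _ = _ := by
        rw [← mul_assoc, ← ENNReal.ofReal_mul (by positivity)]
        congr 2
        rw [show (256 : ℝ) = 8 * 32 by norm_num, mul_pow]; ring

end P0

lemma ball_infDist_frontier {n : ℕ} {D : Set (Eu n)} (hD : IsOpen D) {z : Eu n} (hz : z ∈ D) :
    ball z (infDist z (frontier D)) ⊆ D := by
  rcases (infDist_nonneg (x := z) (s := frontier D)).eq_or_lt with h | h
  · rw [← h]; simp
  apply (convex_ball z (infDist z (frontier D))).isPreconnected.subset_left_of_subset_union hD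
    (isClosed_closure (s := D)).isOpen_compl
  · exact disjoint_compl_right.mono_left subset_closure |>.mono_right (le_refl _)
  · intro y hy
    by_contra hcon
    rw [mem_union, not_or] at hcon
    have hfr : y ∈ frontier D := by
      rw [hD.frontier_eq]
      exact ⟨not_not.1 hcon.2, hcon.1⟩
    have := infDist_le_dist_of_mem (x := z) hfr
    rw [mem_ball, dist_comm] at hy
    linarith
  · exact ⟨z, mem_ball_self h, hz⟩

lemma infDist_frontier_pos {n : ℕ} (hn : 2 ≤ n) {D : Set (Eu n)} (hD : IsOpen D)
    (hb : Bornology.IsBounded D) {z : Eu n} (hz : z ∈ D) : 0 < infDist z (frontier D) := by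
  have : Nontrivial (Eu n) := by
    have : Nonempty (Fin n) := ⟨⟨0, by omega⟩⟩
    infer_instance
  have hne : (frontier D).Nonempty := by
    rw [nonempty_frontier_iff]
    refine ⟨⟨z, hz⟩, ?_⟩
    rintro rfl
    exact NormedSpace.unbounded_univ ℝ (Eu n) hb
  rw [← isClosed_frontier.notMem_iff_infDist_pos hne, hD.frontier_eq]
  exact fun h => h.2 hz

lemma rpow_lip {Δ s : ℝ} (hΔ : 1 ≤ Δ) (hs : 1 ≤ s) (hs2 : s ≤ 2) {α β : ℝ} (hα : 0 ≤ α)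
    (hαβ : α ≤ β) (hβ : β ≤ Δ) : β ^ s - α ^ s ≤ 2 * Δ * (β - α) := by
  rcases (hα.trans hαβ).eq_or_lt with h | h
  · have : α = 0 := by linarith
    rw [← h, this]; simp
  have h1 := one_add_mul_self_le_rpow_one_add (s := α / β - 1) (p := s)
    (by have : 0 ≤ α / β := by positivity
        linarith) hs
  rw [show 1 + (α / β - 1) = α / β by ring, Real.div_rpow hα h.le] at h1
  have hbs : 0 < β ^ s := by positivity
  have h2 : β ^ s * (1 + s * (α / β - 1)) ≤ α ^ s := by
    rw [le_div_iff₀ hbs] at h1; linarith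
  have h3 : β ^ s = β ^ (s - 1) * β := by
    rw [← Real.rpow_add_one h.ne']; congr 1; ring
  have h4 : β ^ (s - 1) ≤ Δ := by
    calc β ^ (s - 1) ≤ Δ ^ (s - 1) := Real.rpow_le_rpow h.le hβ (by linarith)
      _ ≤ Δ ^ (1 : ℝ) := Real.rpow_le_rpow_of_exponent_le hΔ (by linarith)
      _ = Δ := Real.rpow_one Δ
  have h5 : β ^ s * (s * (1 - α / β)) = β ^ (s - 1) * s * (β - α) := by
    rw [h3]; field_simp
  have h6 : β ^ s - α ^ s ≤ β ^ (s - 1) * s * (β - α) := by rw [← h5]; linarith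
  refine h6.trans ?_
  have h7 : 0 ≤ β ^ (s - 1) := by positivity
  have : β ^ (s - 1) * s ≤ 2 * Δ := by nlinarith
  exact mul_le_mul_of_nonneg_right this (by linarith)

lemma R_lip {n : ℕ} {Δ s κ : ℝ} (hΔ : 1 ≤ Δ) (hs : 1 ≤ s) (hs2 : s ≤ 2) (hκ : 0 < κ)
    (hκΔ : 32 * κ * Δ ≤ 1) {x y z : Eu n} (hy : dist x y ≤ Δ) (hz : dist x z ≤ Δ) :
    |κ * dist x y ^ s - κ * dist x z ^ s| ≤ dist y z / 16 := by
  have main : ∀ y z : Eu n, dist x y ≤ Δ → dist x z ≤ Δ → dist x z ≤ dist x y →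
      |κ * dist x y ^ s - κ * dist x z ^ s| ≤ dist y z / 16 := by
    intro y z hy hz h
    have h1 := rpow_lip hΔ hs hs2 dist_nonneg h hy
    have h2 : dist x z ^ s ≤ dist x y ^ s := Real.rpow_le_rpow dist_nonneg h (by linarith)
    have h3 : dist x y - dist x z ≤ dist y z := by
      have := dist_triangle_right x y z
      have := dist_triangle x z y
      rw [dist_comm z y] at this
      linarith
    rw [← mul_sub, abs_of_nonneg (by nlinarith)]
    have h4 : 0 ≤ dist y z := dist_nonneg
    have h5 : κ * (dist x y ^ s - dist x z ^ s) ≤ κ * (2 * Δ * dist y z) := by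
      gcongr
      refine h1.trans ?_
      gcongr
    nlinarith
  rcases le_total (dist x z) (dist x y) with h | h
  · exact main y z hy hz h
  · rw [abs_sub_comm, dist_comm y z]; exact main z y hz hy h

/-- Existence of good compact connected sets. -/
lemma exists_path {n : ℕ} (hn : 2 ≤ n) {D : Set (Eu n)} {s : Eu n → ℝ} {a b : ℝ} {x₀ : Eu n}
    (hD : IsJohnDomain D s a b x₀) (hs : ∀ x ∈ D, 1 ≤ s x ∧ s x ≤ 2)
    {Δ κ δ d0 : ℝ} (hΔ : 1 ≤ Δ) (hΔD : ∀ x ∈ D, ∀ y ∈ D, dist x y ≤ Δ) (hκ : 0 < κ)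
    (hκΔ : 32 * κ * Δ ≤ 1) (hκab : κ * (b / a) ≤ 1 / 4) (hd0 : d0 = infDist x₀ (frontier D))
    (hδ : 0 < δ) (hδ0 : 8 * δ ≤ d0) {x : Eu n} (hx : x ∈ D) :
    ∃ (Γ : Set (Eu n)) (x1 : Eu n), IsCompact Γ ∧ IsPreconnected Γ ∧ Γ ⊆ D ∧ x ∈ Γ ∧ x1 ∈ Γ ∧
      δ ≤ dist x x1 ∧ dist x1 x₀ ≤ 2 * δ ∧ 4 * (κ * dist x x1 ^ s x) ≤ d0 ∧
      ∀ z ∈ Γ, ball z (4 * (κ * dist x z ^ s x)) ⊆ D := by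
  obtain ⟨hDo, -, -, ha, hab, hx0, hJ⟩ := hD
  obtain ⟨hs1, hs2⟩ := hs x hx
  rcases le_or_gt δ (dist x x₀) with hcase | hcase
  · obtain ⟨ℓ, hℓ, -, γ, hγ0, hγℓ, hγL, hγD, hγJ⟩ := hJ x hx
    have h0 : (0 : ℝ) ∈ Icc 0 ℓ := ⟨le_rfl, hℓ⟩
    have hl : ℓ ∈ Icc 0 ℓ := ⟨hℓ, le_rfl⟩
    have key : ∀ t ∈ Icc 0 ℓ, 4 * (κ * dist x (γ t) ^ s x) ≤ infDist (γ t) (frontier D) := by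
      intro t ht
      have h1 : dist x (γ t) ≤ t := by
        have := hγL.dist_le_mul 0 h0 t ht
        rw [hγ0, Real.dist_eq] at this
        simpa [abs_of_nonneg ht.1] using this
      have h2 : dist x (γ t) ^ s x ≤ t ^ s x := Real.rpow_le_rpow dist_nonneg h1 (by linarith)
      have h3 := h2.trans (hγJ t ht)
      have h4 : 0 ≤ infDist (γ t) (frontier D) := infDist_nonneg
      calc 4 * (κ * dist x (γ t) ^ s x) ≤ 4 * (κ * (b / a * infDist (γ t) (frontier D))) := by
            gcongr
        _ = 4 * (κ * (b / a)) * infDist (γ t) (frontier D) := by ring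
        _ ≤ 1 * infDist (γ t) (frontier D) := by gcongr; linarith
        _ = _ := one_mul _
    refine ⟨γ '' Icc 0 ℓ, x₀, isCompact_Icc.image_of_continuousOn hγL.continuousOn,
      isPreconnected_Icc.image _ hγL.continuousOn, ?_, ⟨0, h0, hγ0⟩, ⟨ℓ, hl, hγℓ⟩, hcase, ?_, ?_, ?_⟩
    · rintro _ ⟨t, ht, rfl⟩; exact hγD t ht
    · simp [hδ.le]
    · have := key ℓ hl
      rw [hγℓ] at this
      rwa [hd0]
    · rintro _ ⟨t, ht, rfl⟩
      exact (ball_subset_ball (key t ht)).trans (ball_infDist_frontier hDo (hγD t ht))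
  · have : Nontrivial (Eu n) := by
      have : Nonempty (Fin n) := ⟨⟨0, by omega⟩⟩
      infer_instance
    obtain ⟨e, he⟩ := exists_norm_eq (Eu n) (zero_le_one' ℝ)
    have hBD : ball x₀ d0 ⊆ D := by rw [hd0]; exact ball_infDist_frontier hDo hx0
    have hdx : ∀ t : ℝ, 0 ≤ t → dist x (x + t • e) = t := by
      intro t ht
      rw [dist_eq_norm, show x - (x + t • e) = -(t • e) by module, norm_neg, norm_smul, he,
        Real.norm_eq_abs, abs_of_nonneg ht, mul_one]
    have hdx0 : ∀ t ∈ Icc 0 δ, dist (x + t • e) x₀ ≤ 2 * δ := by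
      intro t ht
      have := dist_triangle (x + t • e) x x₀
      rw [dist_comm _ x, hdx t ht.1] at this
      linarith [ht.2]
    have hmD : ∀ t ∈ Icc 0 δ, x + t • e ∈ D := by
      intro t ht
      apply hBD
      rw [mem_ball]; linarith [hdx0 t ht]
    have hR : ∀ t ∈ Icc 0 δ, 4 * (κ * dist x (x + t • e) ^ s x) ≤ δ := by
      intro t ht
      have htΔ := hΔD x hx _ (hmD t ht)
      rw [hdx t ht.1] at htΔ ⊢
      have h1 := rpow_lip hΔ hs1 hs2 le_rfl ht.1 htΔ
      rw [Real.zero_rpow (by linarith)] at h1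
      calc 4 * (κ * t ^ s x) ≤ 4 * (κ * (2 * Δ * t)) := by gcongr; linarith
        _ = (32 * κ * Δ) * (t / 4) := by ring
        _ ≤ 1 * (t / 4) := by
          have := ht.1
          gcongr
        _ ≤ δ := by linarith [ht.1, ht.2]
    refine ⟨(fun t : ℝ => x + t • e) '' Icc 0 δ, x + δ • e,
      isCompact_Icc.image (by fun_prop), isPreconnected_Icc.image _ (by fun_prop), ?_,
      ⟨0, ⟨le_rfl, hδ.le⟩, by simp⟩, ⟨δ, ⟨hδ.le, le_rfl⟩, rfl⟩, (hdx δ hδ.le).ge,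
      hdx0 δ ⟨hδ.le, le_rfl⟩, ?_, ?_⟩
    · rintro _ ⟨t, ht, rfl⟩; exact hmD t ht
    · linarith [hR δ ⟨hδ.le, le_rfl⟩]
    · rintro _ ⟨t, ht, rfl⟩
      refine (ball_subset_ball' ?_).trans hBD
      have := hR t ht
      have := hdx0 t ht
      linarith

lemma pointwise {n : ℕ} (hn : 2 ≤ n) {D : Set (Eu n)} {s : Eu n → ℝ} {a b : ℝ} {x₀ : Eu n}
    (hD : IsJohnDomain D s a b x₀) (hs : ∀ x ∈ D, 1 ≤ s x ∧ s x ≤ 2) :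
    ∃ C : ℝ, 0 < C ∧ ∀ w : Eu n → ℝ, DifferentiableOn ℝ w D →
      ∫⁻ η in D, ‖fderiv ℝ w η‖ₑ ≠ ∞ → ∀ x ∈ D,
      ‖w x - ⨍ y in ball x₀ (infDist x₀ (frontier D)), w y‖ₑ ≤ ENNReal.ofReal C *
        ((∫⁻ η in D, ‖fderiv ℝ w η‖ₑ * ENNReal.ofReal (dist x η ^ (-(s x * ((n : ℝ) - 1))))) +
          ∫⁻ η in D, ‖fderiv ℝ w η‖ₑ) := by
  have hD' := hD
  obtain ⟨hDo, -, hDb, ha, hab, hx0, -⟩ := hD'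
  obtain ⟨Δ₀, hΔ₀⟩ := isBounded_iff.1 hDb
  set Δ := max 1 Δ₀ with hΔdef
  have hΔ : 1 ≤ Δ := le_max_left _ _
  have hΔD : ∀ x ∈ D, ∀ y ∈ D, dist x y ≤ Δ := fun x hx y hy =>
    (hΔ₀ hx hy).trans (le_max_right _ _)
  have hb : 0 < b := ha.trans_le hab
  set d0 := infDist x₀ (frontier D) with hd0
  have hd0p : 0 < d0 := infDist_frontier_pos hn hDo hDb hx0
  set δ := min 1 (d0 / 8) with hδdef
  have hδ : 0 < δ := by positivity
  have hδ1 : δ ≤ 1 := min_le_left _ _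
  have hδ8 : 8 * δ ≤ d0 := by have := min_le_right 1 (d0 / 8); linarith
  set κ := min (1 / (32 * Δ)) (a / (4 * b)) with hκdef
  have hκ : 0 < κ := by positivity
  have hκΔ : 32 * κ * Δ ≤ 1 := by
    have h : κ ≤ 1 / (32 * Δ) := min_le_left _ _
    rw [le_div_iff₀ (by positivity)] at h; linarith
  have hκab : κ * (b / a) ≤ 1 / 4 := by
    have h : κ ≤ a / (4 * b) := min_le_right _ _
    calc κ * (b / a) ≤ a / (4 * b) * (b / a) := by gcongr
      _ = 1 / 4 := by field_simp
  set V := volume.real (ball (0 : Eu n) 1) with hV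
  have hVp : 0 < V := ENNReal.toReal_pos (measure_ball_pos _ _ one_pos).ne' measure_ball_lt_top.ne
  set m0 := κ * δ ^ 2 with hm0
  have hm0p : 0 < m0 := by positivity
  set C1 := 4 * 256 ^ n * (κ * (κ ^ n)⁻¹) with hC1
  set C2 := 2 * d0 * (m0 ^ n)⁻¹ with hC2
  have hC1p : 0 < C1 := by positivity
  have hC2p : 0 < C2 := by positivity
  refine ⟨V⁻¹ * (C1 + C2), by positivity, ?_⟩
  intro w hw hfin x hx
  obtain ⟨hs1, hs2⟩ := hs x hx
  obtain ⟨Γ, x1, hΓ, hΓc, hΓD, hxΓ, hx1Γ, hx1a, hx1b, hx1c, hΓb⟩ :=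
    exists_path hn hD hs hΔ hΔD hκ hκΔ hκab hd0 hδ hδ8 hx
  set R : Eu n → ℝ := fun z => κ * dist x z ^ s x with hRdef
  have hRc : Continuous R := by
    apply Continuous.mul continuous_const
    exact (continuous_const.dist continuous_id).rpow_const (fun _ => Or.inr (by linarith))
  have hR0 : ∀ z, 0 ≤ R z := fun z => by positivity
  have hLip : ∀ y ∈ D, ∀ z ∈ D, |R y - R z| ≤ dist y z / 16 := fun y hy z hz =>
    R_lip hΔ hs1 hs2 hκ hκΔ (hΔD x hx y hy) (hΔD x hx z hz)
  have hRx : ∀ z, R z = 0 ↔ z = x := by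
    intro z
    simp only [hRdef, mul_eq_zero, hκ.ne', false_or]
    rw [Real.rpow_eq_zero dist_nonneg (by linarith), dist_eq_zero, eq_comm]
  have hP0 := P0 hDo hw hRc hR0 hLip hRx hΓ hΓc hΓD hxΓ hx1Γ hΓb
  have hGx : Gav D w R x = V * w x := by
    have : R x = 0 := (hRx x).2 rfl
    simp only [Gav, this, zero_smul, add_zero, indicator_of_mem hx]
    simp [hV]
  have hx1D := hΓD hx1Γ
  have hm0R : m0 ≤ R x1 := by
    simp only [hm0, hRdef]
    gcongr
    calc δ ^ 2 = δ ^ (2 : ℝ) := by norm_cast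
      _ ≤ δ ^ s x := Real.rpow_le_rpow_of_exponent_ge hδ hδ1 hs2
      _ ≤ dist x x1 ^ s x := Real.rpow_le_rpow hδ.le hx1a (by linarith)
  have hR1 : 0 < R x1 := hm0p.trans_le hm0R
  have hR1d : R x1 ≤ d0 / 4 := by
    have : 4 * R x1 ≤ d0 := hx1c
    linarith
  have hcb1 : closedBall x1 (R x1) ⊆ D :=
    (closedBall_subset_ball (by linarith)).trans (hΓb x1 hx1Γ)
  have hBD : ball x₀ d0 ⊆ D := ball_infDist_frontier hDo hx0
  have hcoup := coupling hDo (convex_ball x₀ d0) hBD hw x1 x₀ (P := R x1) (Q := d0) (m := m0)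
    (L := 2 * d0) hm0p hm0R (by linarith) (ball_subset_ball' (by linarith)) subset_rfl (by
      have : |R x1 - d0| ≤ d0 := by rw [abs_le]; constructor <;> linarith
      linarith)
  have hcoup2 : ∫⁻ ξ in ball (0 : Eu n) 1, ‖w (x1 + R x1 • ξ) - w (x₀ + d0 • ξ)‖ₑ ≤
      ENNReal.ofReal C2 * ∫⁻ η in D, ‖fderiv ℝ w η‖ₑ :=
    hcoup.trans (by gcongr)
  have hi1 := integrable_affine hw.continuousOn hR1.le hcb1
  have hcont2 : ContinuousOn (fun ξ => w (x₀ + d0 • ξ)) (ball (0 : Eu n) 1) := by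
    apply hw.continuousOn.comp (by fun_prop)
    intro ξ hξ
    exact hBD ((mem_ball_affine x₀ hd0p ξ).2 hξ)
  have hid : IntegrableOn (fun ξ => w (x1 + R x1 • ξ) - w (x₀ + d0 • ξ)) (ball (0 : Eu n) 1) :=
    ⟨hi1.aestronglyMeasurable.sub (hcont2.aestronglyMeasurable measurableSet_ball),
      hcoup2.trans_lt (ENNReal.mul_lt_top ENNReal.ofReal_lt_top (lt_top_iff_ne_top.2 hfin))⟩
  have hi2 : IntegrableOn (fun ξ => w (x₀ + d0 • ξ)) (ball (0 : Eu n) 1) := by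
    have := hi1.sub hid
    refine this.congr ?_
    filter_upwards with ξ
    simp
  have hG1 : ‖Gav D w R x1 - V * ⨍ y in ball x₀ d0, w y‖ₑ ≤
      ENNReal.ofReal C2 * ∫⁻ η in D, ‖fderiv ℝ w η‖ₑ := by
    rw [Gav_eq hR1.le hcb1, ← int_affine w x₀ hd0p, ← integral_sub hi1 hi2]
    exact (enorm_integral_le_lintegral_enorm _).trans hcoup2
  have hker : ∀ η, ENNReal.ofReal (R η * (R η ^ n)⁻¹) = ENNReal.ofReal (κ * (κ ^ n)⁻¹) *
      ENNReal.ofReal (dist x η ^ (-(s x * ((n : ℝ) - 1)))) := by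
    intro η
    rw [← ENNReal.ofReal_mul (by positivity)]
    congr 1
    simp only [hRdef]
    have hn' : (2 : ℝ) ≤ n := by exact_mod_cast hn
    rcases (dist_nonneg (x := x) (y := η)).eq_or_lt with h | h
    · rw [← h, Real.zero_rpow (by linarith), Real.zero_rpow]
      · simp
      · have : 0 < s x * ((n : ℝ) - 1) := mul_pos (by linarith) (by linarith)
        linarith
    · rw [mul_pow, ← Real.rpow_natCast (dist x η ^ s x), ← Real.rpow_mul h.le,
        show -(s x * ((n : ℝ) - 1)) = s x + -(s x * n) by ring, Real.rpow_add h, Real.rpow_neg h.le]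
      field_simp
  simp_rw [hker] at hP0
  have hrw : ∫⁻ η in D, ‖fderiv ℝ w η‖ₑ * (ENNReal.ofReal (κ * (κ ^ n)⁻¹) *
      ENNReal.ofReal (dist x η ^ (-(s x * ((n : ℝ) - 1))))) = ENNReal.ofReal (κ * (κ ^ n)⁻¹) *
      ∫⁻ η in D, ‖fderiv ℝ w η‖ₑ * ENNReal.ofReal (dist x η ^ (-(s x * ((n : ℝ) - 1)))) := by
    rw [← lintegral_const_mul' _ _ ENNReal.ofReal_ne_top]
    apply lintegral_congr
    intro η; ring
  rw [hrw, ← mul_assoc, ← ENNReal.ofReal_mul (by positivity)] at hP0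
  set J := ∫⁻ η in D, ‖fderiv ℝ w η‖ₑ * ENNReal.ofReal (dist x η ^ (-(s x * ((n : ℝ) - 1))))
  set F := ∫⁻ η in D, ‖fderiv ℝ w η‖ₑ
  have hsum : ‖V * (w x - ⨍ y in ball x₀ d0, w y)‖ₑ ≤
      ENNReal.ofReal C1 * J + ENNReal.ofReal C2 * F := by
    have : V * (w x - ⨍ y in ball x₀ d0, w y) = (Gav D w R x - Gav D w R x1) +
        (Gav D w R x1 - V * ⨍ y in ball x₀ d0, w y) := by rw [hGx]; ring
    rw [this]
    exact (enorm_add_le _ _).trans (add_le_add hP0 hG1)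
  have hwx : w x - ⨍ y in ball x₀ d0, w y = V⁻¹ * (V * (w x - ⨍ y in ball x₀ d0, w y)) := by
    field_simp
  rw [hwx, enorm_mul, Real.enorm_of_nonneg (by positivity), ENNReal.ofReal_mul (by positivity),
    mul_assoc]
  gcongr
  refine hsum.trans ?_
  rw [mul_add]
  gcongr <;> linarith

/-- Core pointwise inequality in logarithmic form. -/
lemma core_log {n βx βy βp qx qy T ℓ c : ℝ} (hn : 2 ≤ n) (hx1 : 1 ≤ βx) (hy1 : 1 ≤ βy)
    (hyp : βy ≤ βp) (hp : βp < n) (hqx : qx = n / βx) (hqy : qy = n / βy)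
    (hqx1 : 1 ≤ qx) (hqx2 : qx ≤ 2) (hqy1 : 1 ≤ qy) (hqy2 : qy ≤ 2) (hT : 0 ≤ T)
    (hc : |βx - βy| * |ℓ| ≤ c) (hu : qx * T + n * ℓ < 2) :
    n * ℓ + qy * T ≤ 2 + (2 + n * (n * c)) ∧
    (qx - 1) * T - βx * ℓ ≤ qy * T - βp * (ℓ + qy * T / n) +
      ((2 + n * (n * c)) + c + (2 + (2 + n * (n * c)))) := by
  have hn0 : 0 < n := by linarith
  have hx0 : 0 < βx := by linarith
  have hy0 : 0 < βy := by linarith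
  have hq : |qx - qy| ≤ n * |βx - βy| := by
    rw [hqx, hqy, div_sub_div _ _ hx0.ne' hy0.ne', show n * βy - βx * n = n * (βy - βx) by ring,
      abs_div, abs_mul, abs_of_pos hn0, abs_of_pos (mul_pos hx0 hy0), abs_sub_comm βy βx]
    apply div_le_self (by positivity)
    nlinarith
  have hqT : |qx - qy| * T ≤ 2 + n * (n * c) := by
    have h1 : T ≤ 2 + n * |ℓ| := by
      have : -|ℓ| ≤ ℓ := neg_abs_le ℓ
      nlinarith
    have h2 : |qx - qy| ≤ 1 := by rw [abs_le]; constructor <;> linarith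
    have h3 : |qx - qy| * |ℓ| ≤ n * c := by
      calc |qx - qy| * |ℓ| ≤ n * |βx - βy| * |ℓ| := by gcongr
        _ = n * (|βx - βy| * |ℓ|) := by ring
        _ ≤ n * c := by gcongr
    calc |qx - qy| * T ≤ |qx - qy| * (2 + n * |ℓ|) := by gcongr
      _ = |qx - qy| * 2 + n * (|qx - qy| * |ℓ|) := by ring
      _ ≤ 1 * 2 + n * (n * c) := by gcongr
      _ = _ := by ring
  have hqT1 : (qx - qy) * T ≤ 2 + n * (n * c) :=
    (mul_le_mul_of_nonneg_right (le_abs_self _) hT).trans hqT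
  have hqT2 : (qy - qx) * T ≤ 2 + n * (n * c) := by
    rw [abs_sub_comm] at hqT
    exact (mul_le_mul_of_nonneg_right (le_abs_self _) hT).trans hqT
  have hβ : (βy - βx) * ℓ ≤ c := by
    refine le_trans ?_ hc
    rw [abs_sub_comm, ← abs_mul]; exact le_abs_self _
  have hA : n * ℓ + qy * T ≤ 2 + (2 + n * (n * c)) := by linarith
  refine ⟨hA, ?_⟩
  have hlogσ : ℓ + qy * T / n ≤ (2 + (2 + n * (n * c))) / n := by
    rw [le_div_iff₀ hn0]
    have : (ℓ + qy * T / n) * n = n * ℓ + qy * T := by field_simp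
    linarith
  have hc0 : 0 ≤ c := le_trans (by positivity) hc
  have hB : (βp - βy) * (ℓ + qy * T / n) ≤ 2 + (2 + n * (n * c)) := by
    calc (βp - βy) * (ℓ + qy * T / n) ≤ (βp - βy) * ((2 + (2 + n * (n * c))) / n) := by
          gcongr
      _ ≤ n * ((2 + (2 + n * (n * c))) / n) := by
          gcongr; linarith
      _ = _ := by field_simp
  have hC : βy * (qy * T / n) = T := by rw [hqy]; field_simp
  nlinarith

section weak
variable {n : ℕ} {D : Set (Eu n)} {s : Eu n → ℝ}

lemma core_real {t r βx βy βp qx qy c : ℝ} (hn : 2 ≤ n) (hx1 : 1 ≤ βx) (hy1 : 1 ≤ βy)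
    (hyp : βy ≤ βp) (hp : βp < n) (hqx : qx = n / βx) (hqy : qy = n / βy)
    (hqx1 : 1 ≤ qx) (hqx2 : qx ≤ 2) (hqy1 : 1 ≤ qy) (hqy2 : qy ≤ 2) (ht : 1 ≤ t) (hr : 0 < r)
    (hc : |βx - βy| * |Real.log r| ≤ c) :
    t ^ (qx - 1) * r ^ (-βx) ≤ t ^ qx / 2 ∨
    (r < t ^ (-qy / n) * Real.exp (5 + n * (n * c)) ∧
      t ^ (qx - 1) * r ^ (-βx) ≤ ((t ^ (-qy / n)) ^ n)⁻¹ *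
        (Real.exp ((2 + n * (n * c)) + c + (2 + (2 + n * (n * c)))) *
          (r / t ^ (-qy / n)) ^ (-βp))) := by
  have hn' : (2 : ℝ) ≤ n := by exact_mod_cast hn
  have hn0 : (0 : ℝ) < n := by linarith
  have hx0 : 0 < βx := by linarith
  have hy0 : 0 < βy := by linarith
  have ht0 : 0 < t := by linarith
  have hc0 : 0 ≤ c := le_trans (by positivity) hc
  set T := Real.log t with hTdef
  set ℓ := Real.log r with hℓ
  have hT : 0 ≤ T := Real.log_nonneg ht
  have etp : ∀ z : ℝ, t ^ z = Real.exp (z * T) := fun z => by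
    rw [Real.rpow_def_of_pos ht0, mul_comm]
  have erp : ∀ z : ℝ, r ^ z = Real.exp (z * ℓ) := fun z => by
    rw [Real.rpow_def_of_pos hr, mul_comm]
  have er : r = Real.exp ℓ := (Real.exp_log hr).symm
  rcases le_or_gt 2 (qx * T + n * ℓ) with hu | hu
  · left
    rw [etp, etp, erp, ← Real.exp_add]
    have h1 : βx * qx = n := by rw [hqx]; field_simp
    have h2 : 1 ≤ T + βx * ℓ := by
      by_contra hcon
      push Not at hcon
      have : qx * T + n * ℓ = qx * (T + βx * ℓ) := by rw [← h1]; ring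
      nlinarith
    have h3 : Real.exp ((qx - 1) * T + -βx * ℓ) ≤ Real.exp (qx * T + -1) :=
      Real.exp_le_exp.2 (by linarith)
    rw [Real.exp_add (qx * T)] at h3
    have h4 : Real.exp (-1) ≤ 1 / 2 := by
      have := Real.exp_one_gt_d9
      rw [Real.exp_neg, inv_eq_one_div]
      apply one_div_le_one_div_of_le <;> linarith
    have h5 := Real.exp_pos (qx * T)
    nlinarith
  · right
    obtain ⟨hA, hB⟩ := core_log hn' hx1 hy1 hyp hp hqx hqy hqx1 hqx2 hqy1 hqy2 hT hc hu
    constructor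
    · rw [etp, ← Real.exp_add]
      nth_rewrite 1 [er]
      apply Real.exp_lt_exp.2
      have h1 : ℓ + qy * T / n ≤ (4 + n * (n * c)) / n := by
        rw [le_div_iff₀ hn0]
        have : (ℓ + qy * T / n) * n = n * ℓ + qy * T := by field_simp
        linarith
      have h2 : (4 + n * (n * c)) / n ≤ 4 + n * (n * c) :=
        div_le_self (by positivity) (by linarith)
      have h3 : -qy / n * T = -(qy * T / n) := by ring
      linarith
    · rw [etp, etp, erp]
      have hre : r / Real.exp (-qy / n * T) = Real.exp (ℓ - (-qy / n * T)) := by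
        rw [Real.exp_sub, ← er]
      rw [hre, ← Real.exp_mul, ← Real.exp_nat_mul, ← Real.exp_neg, ← Real.exp_add,
        ← Real.exp_add, ← Real.exp_add]
      apply Real.exp_le_exp.2
      have h1 : (n : ℝ) * (-qy / n * T) = - (qy * T) := by field_simp
      have h2 : -qy / n * T = -(qy * T / n) := by ring
      rw [h1, h2]
      linarith

/-- scaled radial integral -/
lemma radial_bound (hn : 2 ≤ n) {βp K K' : ℝ} (hp : βp < n) (hK : 0 ≤ K) (hK' : 0 < K') :
    ∃ H : ℝ, 0 < H ∧ ∀ (y : Eu n) (ρ : ℝ), 0 < ρ →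
      ∫⁻ x in ball y (ρ * K'), ENNReal.ofReal ((ρ ^ n)⁻¹ * (K * (dist x y / ρ) ^ (-βp))) ≤
        ENNReal.ofReal H := by
  set I := ∫⁻ ξ in ball (0 : Eu n) 1, ENNReal.ofReal (‖ξ‖ ^ (-βp)) with hI
  have hIfin : I ≠ ∞ := by
    have hInteg : IntegrableOn (fun ξ : Eu n => ‖ξ‖ ^ (-βp)) (ball 0 1) := by
      refine integrableOn_ball_of_norm_le_rpow (C := 1) (α := βp) ?_ ?_ ?_ ?_
      · simp; omega
      · simpa using hp
      · filter_upwards with ξ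
        rw [Real.norm_of_nonneg (by positivity), one_mul]
      · apply Measurable.aestronglyMeasurable
        fun_prop
    have := hInteg.2
    rw [hasFiniteIntegral_iff_ofReal (by filter_upwards with ξ; positivity)] at this
    exact this.ne
  refine ⟨K' ^ n * (K * K' ^ (-βp)) * I.toReal + 1, by positivity, ?_⟩
  intro y ρ hρ
  have hρK : 0 < ρ * K' := by positivity
  have h1 := lint_affine (fun x => ENNReal.ofReal ((ρ ^ n)⁻¹ * (K * (dist x y / ρ) ^ (-βp)))) y hρK
  have h2 : ∀ ξ : Eu n, ENNReal.ofReal ((ρ ^ n)⁻¹ * (K * (dist (y + (ρ * K') • ξ) y / ρ) ^ (-βp))) =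
      ENNReal.ofReal ((ρ ^ n)⁻¹ * (K * K' ^ (-βp))) * ENNReal.ofReal (‖ξ‖ ^ (-βp)) := by
    intro ξ
    rw [← ENNReal.ofReal_mul (by positivity)]
    congr 1
    rw [dist_eq_norm, add_sub_cancel_left, norm_smul, Real.norm_of_nonneg hρK.le,
      show ρ * K' * ‖ξ‖ / ρ = K' * ‖ξ‖ by field_simp, Real.mul_rpow hK'.le (norm_nonneg _)]
    ring
  simp_rw [h2] at h1
  rw [lintegral_const_mul' _ _ ENNReal.ofReal_ne_top, ← hI] at h1
  set X := ∫⁻ x in ball y (ρ * K'), ENNReal.ofReal ((ρ ^ n)⁻¹ * (K * (dist x y / ρ) ^ (-βp)))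
  have h3 : X = ENNReal.ofReal ((ρ * K') ^ n) * (ENNReal.ofReal (((ρ * K') ^ n)⁻¹) * X) := by
    rw [← mul_assoc, ← ENNReal.ofReal_mul (by positivity), mul_inv_cancel₀ (by positivity)]
    simp
  rw [h3, ← h1, ← mul_assoc, ← ENNReal.ofReal_mul (by positivity), ← ENNReal.ofReal_toReal hIfin,
    ← ENNReal.ofReal_mul (by positivity)]
  apply ENNReal.ofReal_le_ofReal
  have : (ρ * K') ^ n * ((ρ ^ n)⁻¹ * (K * K' ^ (-βp))) = K' ^ n * (K * K' ^ (-βp)) := by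
    rw [mul_pow]; field_simp
  rw [this, ENNReal.toReal_ofReal ENNReal.toReal_nonneg]
  linarith

lemma weak_type (hn : 2 ≤ n) (hD : IsOpen D) (hDb : Bornology.IsBounded D) (hsm : Measurable s)
    {sp c : ℝ} (hs : ∀ x ∈ D, 1 ≤ s x ∧ s x ≤ sp) (hsp : sp * ((n : ℝ) - 1) < n)
    (hc : ∀ x ∈ D, ∀ y ∈ D, |s x - s y| * |Real.log (dist x y)| ≤ c) :
    ∃ C : ℝ, 0 < C ∧ ∀ f : Eu n → ℝ≥0∞, Measurable f → ∫⁻ η in D, f η ≤ 1 → ∀ t : ℝ, 1 ≤ t →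
      ∫⁻ x in {x | x ∈ D ∧ ENNReal.ofReal t < ∫⁻ η in D, f η *
          ENNReal.ofReal (dist x η ^ (-(s x * ((n : ℝ) - 1))))},
        ENNReal.ofReal (t ^ ((n : ℝ) / (s x * ((n : ℝ) - 1)))) ≤
      ENNReal.ofReal C * ∫⁻ η in D, f η := by
  have hn' : (2 : ℝ) ≤ n := by exact_mod_cast hn
  have : Nonempty (Fin n) := ⟨⟨0, by omega⟩⟩
  have : Nontrivial (Eu n) := inferInstance
  have : NullSingletonClass (volume : Measure (Eu n)) := inferInstance
  set c1 := ((n : ℝ) - 1) * c with hc1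
  set K := Real.exp ((2 + n * (n * c1)) + c1 + (2 + (2 + n * (n * c1))))
  set K' := Real.exp (5 + n * (n * c1))
  set βp := sp * ((n : ℝ) - 1)
  obtain ⟨H, hH, hrad⟩ := radial_bound (n := n) hn (βp := βp) (K := K) (K' := K') hsp
    (Real.exp_pos _).le (Real.exp_pos _)
  refine ⟨2 * H, by positivity, ?_⟩
  intro f hf hf1 t ht
  set β : Eu n → ℝ := fun x => s x * ((n : ℝ) - 1) with hβ
  set q : Eu n → ℝ := fun x => (n : ℝ) / β x with hq
  have hβm : Measurable β := hsm.mul_const _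
  have hqm : Measurable q := by rw [hq]; fun_prop
  have hβ1 : ∀ x ∈ D, 1 ≤ β x := by
    intro x hx; have := (hs x hx).1; simp only [hβ]; nlinarith
  have hβp : ∀ x ∈ D, β x ≤ βp := by
    intro x hx
    have := (hs x hx).2
    exact mul_le_mul_of_nonneg_right this (by linarith)
  have hq1 : ∀ x ∈ D, 1 ≤ q x := by
    intro x hx
    simp only [hq]
    rw [le_div_iff₀ (by linarith [hβ1 x hx])]
    linarith [hβp x hx]
  have hq2 : ∀ x ∈ D, q x ≤ 2 := by
    intro x hx
    simp only [hq]
    rw [div_le_iff₀ (by linarith [hβ1 x hx])]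
    have := (hs x hx).1
    simp only [hβ]; nlinarith
  have hkm : Measurable fun p : Eu n × Eu n => ENNReal.ofReal (dist p.1 p.2 ^ (-β p.1)) := by
    apply ENNReal.measurable_ofReal.comp
    exact (measurable_fst.dist measurable_snd).pow (hβm.comp measurable_fst).neg
  set If : Eu n → ℝ≥0∞ := fun x => ∫⁻ η in D, f η * ENNReal.ofReal (dist x η ^ (-β x)) with hIf
  have hIfm : Measurable If := by
    apply Measurable.lintegral_prod_right' (f := fun p : Eu n × Eu n => f p.2 *
      ENNReal.ofReal (dist p.1 p.2 ^ (-β p.1)))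
    exact (hf.comp measurable_snd).mul hkm
  change ∫⁻ x in {x | x ∈ D ∧ ENNReal.ofReal t < If x}, ENNReal.ofReal (t ^ q x) ≤ _
  set S := {x | x ∈ D ∧ ENNReal.ofReal t < If x} with hS
  have hSm : MeasurableSet S := hD.measurableSet.inter (measurableSet_lt measurable_const hIfm)
  have hSD : S ⊆ D := fun x hx => hx.1
  set M := ∫⁻ x in S, ENNReal.ofReal (t ^ q x) with hM
  have ht0 : 0 < t := by linarith
  have hMfin : M ≠ ∞ := by
    have : M ≤ ∫⁻ x in S, ENNReal.ofReal (t ^ (2 : ℝ)) := by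
      apply setLIntegral_mono' hSm
      intro x hx
      apply ENNReal.ofReal_le_ofReal
      exact Real.rpow_le_rpow_of_exponent_le ht (hq2 x hx.1)
    rw [setLIntegral_const] at this
    refine ne_top_of_le_ne_top ?_ this
    exact ENNReal.mul_ne_top ENNReal.ofReal_ne_top
      (ne_top_of_le_ne_top hDb.measure_lt_top.ne (measure_mono hSD))
  have htqm : Measurable fun x => ENNReal.ofReal (t ^ (q x - 1)) := by
    apply ENNReal.measurable_ofReal.comp
    exact measurable_const.pow (hqm.sub_const 1)
  have htqm2 : Measurable fun x => ENNReal.ofReal (t ^ (q x)) := by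
    apply ENNReal.measurable_ofReal.comp
    exact measurable_const.pow hqm
  have step1 : M ≤ ∫⁻ x in S, ∫⁻ η in D, ENNReal.ofReal (t ^ (q x - 1)) * (f η *
      ENNReal.ofReal (dist x η ^ (-β x))) := by
    apply setLIntegral_mono' hSm
    intro x hx
    rw [lintegral_const_mul' _ _ ENNReal.ofReal_ne_top]
    calc ENNReal.ofReal (t ^ q x) = ENNReal.ofReal (t ^ (q x - 1)) * ENNReal.ofReal t := by
          rw [← ENNReal.ofReal_mul (by positivity)]
          congr 1
          rw [← Real.rpow_add_one ht0.ne']; congr 1; ring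
      _ ≤ _ := by gcongr; exact hx.2.le
  have step2 : ∫⁻ x in S, ∫⁻ η in D, ENNReal.ofReal (t ^ (q x - 1)) * (f η *
      ENNReal.ofReal (dist x η ^ (-β x))) = ∫⁻ η in D, ∫⁻ x in S,
      ENNReal.ofReal (t ^ (q x - 1)) * (f η * ENNReal.ofReal (dist x η ^ (-β x))) := by
    apply lintegral_lintegral_swap
    apply Measurable.aemeasurable
    exact (htqm.comp measurable_fst).mul ((hf.comp measurable_snd).mul hkm)
  have step3 : ∀ η ∈ D, ∫⁻ x in S,
      ENNReal.ofReal (t ^ (q x - 1)) * (f η * ENNReal.ofReal (dist x η ^ (-β x))) ≤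
      f η * (M / 2 + ENNReal.ofReal H) := by
    intro η hη
    have e : ∀ x, ENNReal.ofReal (t ^ (q x - 1)) * (f η * ENNReal.ofReal (dist x η ^ (-β x))) =
        f η * ENNReal.ofReal (t ^ (q x - 1) * dist x η ^ (-β x)) := by
      intro x
      rw [ENNReal.ofReal_mul (by positivity)]; ring
    simp_rw [e]
    have hkm' : Measurable fun x => dist x η ^ (-β x) :=
      (measurable_id.dist measurable_const).pow hβm.neg
    have htm' : Measurable fun x => t ^ (q x - 1) := measurable_const.pow (hqm.sub_const 1)
    have hprodm : Measurable fun x => ENNReal.ofReal (t ^ (q x - 1) * dist x η ^ (-β x)) :=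
      ENNReal.measurable_ofReal.comp (htm'.mul hkm')
    rw [lintegral_const_mul _ hprodm]
    gcongr
    set ρ := t ^ (-q η / n) with hρ
    have hρ0 : 0 < ρ := by positivity
    set g : Eu n → ℝ≥0∞ := fun x => ENNReal.ofReal ((ρ ^ n)⁻¹ * (K * (dist x η / ρ) ^ (-βp)))
    calc ∫⁻ x in S, ENNReal.ofReal (t ^ (q x - 1) * dist x η ^ (-β x))
        ≤ ∫⁻ x in S, (ENNReal.ofReal (t ^ q x) / 2 + (ball η (ρ * K')).indicator g x) := by
          apply lintegral_mono_ae
          filter_upwards [ae_restrict_mem hSm, ae_restrict_of_ae (Measure.ae_ne volume η)]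
            with x hx hne
          have hr : 0 < dist x η := dist_pos.2 hne
          have hcx : |β x - β η| * |Real.log (dist x η)| ≤ c1 := by
            have := hc x hx.1 η hη
            simp only [hβ]
            rw [← sub_mul, abs_mul, abs_of_nonneg (by linarith : (0 : ℝ) ≤ (n : ℝ) - 1)]
            calc |s x - s η| * ((n : ℝ) - 1) * |Real.log (dist x η)| =
                ((n : ℝ) - 1) * (|s x - s η| * |Real.log (dist x η)|) := by ring
              _ ≤ c1 := by
                rw [hc1]
                exact mul_le_mul_of_nonneg_left this (by linarith)
          rcases core_real hn (hβ1 x hx.1) (hβ1 η hη) (hβp η hη) hsp rfl rfl (hq1 x hx.1)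
            (hq2 x hx.1) (hq1 η hη) (hq2 η hη) ht hr hcx with h | ⟨h1, h2⟩
          · refine le_trans ?_ le_self_add
            calc ENNReal.ofReal (t ^ (q x - 1) * dist x η ^ (-β x)) ≤
                ENNReal.ofReal (t ^ q x / 2) := ENNReal.ofReal_le_ofReal h
              _ = _ := by rw [ENNReal.ofReal_div_of_pos (by norm_num)]; simp
          · refine le_trans ?_ le_add_self
            rw [indicator_of_mem (by rw [mem_ball]; exact h1)]
            exact ENNReal.ofReal_le_ofReal h2
      _ = M / 2 + ∫⁻ x in S, (ball η (ρ * K')).indicator g x := by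
          rw [lintegral_add_left (htqm2.div_const 2)]
          congr 1
          simp_rw [div_eq_mul_inv]
          rw [lintegral_mul_const _ htqm2]
      _ ≤ M / 2 + ∫⁻ x, (ball η (ρ * K')).indicator g x := by
          gcongr
          exact Measure.restrict_le_self
      _ ≤ M / 2 + ENNReal.ofReal H := by
          rw [lintegral_indicator measurableSet_ball]
          gcongr
          exact hrad η ρ hρ0
  have step4 : M ≤ M / 2 + ENNReal.ofReal H * ∫⁻ η in D, f η := by
    calc M ≤ ∫⁻ η in D, f η * (M / 2 + ENNReal.ofReal H) :=
          step1.trans (step2.le.trans (setLIntegral_mono' hD.measurableSet step3))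
      _ = (∫⁻ η in D, f η) * (M / 2) + ENNReal.ofReal H * ∫⁻ η in D, f η := by
          rw [lintegral_mul_const _ hf]; ring
      _ ≤ 1 * (M / 2) + ENNReal.ofReal H * ∫⁻ η in D, f η := by gcongr
      _ = _ := by rw [one_mul]
  have hM2 : M / 2 ≠ ∞ := ENNReal.div_ne_top hMfin (by norm_num)
  have step5 : M / 2 ≤ ENNReal.ofReal H * ∫⁻ η in D, f η := by
    nth_rewrite 1 [← ENNReal.add_halves M] at step4
    exact (ENNReal.add_le_add_iff_left hM2).1 step4
  calc M = 2 * (M / 2) := by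
        rw [two_mul, ENNReal.add_halves]
    _ ≤ 2 * (ENNReal.ofReal H * ∫⁻ η in D, f η) := by gcongr
    _ = _ := by
        rw [ENNReal.ofReal_mul (by norm_num), mul_assoc]; simp

end weak

lemma logHolder_cont {n : ℕ} {D : Set (Eu n)} {s : Eu n → ℝ} {cs : ℝ} (h : LogHolderWith cs s D) :
    ContinuousOn s D := by
  rw [Metric.continuousOn_iff]
  intro y hy ε hε
  refine ⟨Real.exp (-((|cs| + 1) / ε)), Real.exp_pos _, ?_⟩
  intro x hx hxy
  by_cases hne : x = y
  · subst hne; simpa using hε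
  have hr : 0 < dist x y := dist_pos.2 hne
  have h1 : Real.log (dist x y) < -((|cs| + 1) / ε) := by
    rw [← Real.log_exp (-((|cs| + 1) / ε))]
    exact Real.log_lt_log hr hxy
  have h2 : -Real.log (dist x y) ≤ Real.log (Real.exp 1 + 1 / dist x y) := by
    rw [← Real.log_inv]
    apply Real.log_le_log (by positivity)
    rw [one_div]; linarith [Real.exp_pos 1]
  have h3 := h hx hy hne
  have h4 : (|cs| + 1) / ε < Real.log (Real.exp 1 + 1 / dist x y) := by linarith
  have h5 : 0 < (|cs| + 1) / ε := by positivity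
  rw [Real.dist_eq]
  refine h3.trans_lt ?_
  rw [div_lt_iff₀ (by linarith)]
  rw [div_lt_iff₀ hε] at h4
  linarith [le_abs_self cs]

lemma logHolder_bound {n : ℕ} {D : Set (Eu n)} {s : Eu n → ℝ} {cs Δ : ℝ} (h : LogHolderWith cs s D)
    (hΔ : 1 ≤ Δ) (hd : ∀ x ∈ D, ∀ y ∈ D, dist x y ≤ Δ) :
    ∀ x ∈ D, ∀ y ∈ D, |s x - s y| * |Real.log (dist x y)| ≤ |cs| * Δ := by
  intro x hx y hy
  by_cases hne : x = y
  · subst hne; simp; positivity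
  have hr : 0 < dist x y := dist_pos.2 hne
  have h3 := h hx hy hne
  set L := Real.log (Real.exp 1 + 1 / dist x y) with hL
  have hL1 : 1 ≤ L := by
    rw [hL, Real.le_log_iff_exp_le (by positivity)]
    have : 0 < 1 / dist x y := by positivity
    linarith
  have h4 : |s x - s y| ≤ |cs| / L := h3.trans (by gcongr; exact le_abs_self cs)
  have h5 : |Real.log (dist x y)| ≤ L * Δ := by
    rw [abs_le]
    constructor
    · have : -Real.log (dist x y) ≤ L := by
        rw [← Real.log_inv]
        apply Real.log_le_log (by positivity)
        rw [one_div]; linarith [Real.exp_pos 1]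
      nlinarith
    · have := Real.log_le_self hr.le
      have := hd x hx y hy
      nlinarith
  calc |s x - s y| * |Real.log (dist x y)| ≤ |cs| / L * (L * Δ) := by gcongr
    _ = |cs| * Δ := by field_simp

lemma exists_cutoff : ∃ (ψ : ℝ → ℝ) (K : ℝ), 1 ≤ K ∧ Differentiable ℝ ψ ∧
    (∀ τ ≤ 1, ψ τ = 0) ∧ (∀ τ, 4 ≤ τ → ψ τ = 1) ∧ (∀ τ, |deriv ψ τ| ≤ K) ∧
    (∀ τ ≤ 1, deriv ψ τ = 0) ∧ (∀ τ, 4 ≤ τ → deriv ψ τ = 0) := by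
  set ψ : ℝ → ℝ := fun τ => Real.smoothTransition ((τ - 1) / 3) with hψ
  have hsm : ContDiff ℝ 1 ψ := by
    apply Real.smoothTransition.contDiff.comp
    fun_prop
  have h0 : ∀ τ ≤ 1, ψ τ = 0 := fun τ hτ => Real.smoothTransition.zero_of_nonpos (by linarith)
  have h1 : ∀ τ, 4 ≤ τ → ψ τ = 1 := fun τ hτ => Real.smoothTransition.one_of_one_le (by linarith)
  have d0 : ∀ τ ≤ 1, deriv ψ τ = 0 := by
    intro τ hτ
    apply IsLocalMin.deriv_eq_zero
    apply Filter.Eventually.of_forall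
    intro z
    simp only [h0 τ hτ]
    exact Real.smoothTransition.nonneg _
  have d1 : ∀ τ, 4 ≤ τ → deriv ψ τ = 0 := by
    intro τ hτ
    apply IsLocalMax.deriv_eq_zero
    apply Filter.Eventually.of_forall
    intro z
    simp only [h1 τ hτ]
    exact Real.smoothTransition.le_one _
  have hc : Continuous (deriv ψ) := hsm.continuous_deriv le_rfl
  obtain ⟨M, hM⟩ := (isCompact_Icc (a := (1 : ℝ)) (b := 4)).exists_bound_of_continuousOn
    hc.continuousOn
  refine ⟨ψ, max 1 M, le_max_left _ _, hsm.differentiable (by norm_num), h0, h1, ?_, d0, d1⟩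
  intro τ
  rcases le_total τ 1 with h | h
  · rw [d0 τ h]; simp
  rcases le_total 4 τ with h' | h'
  · rw [d1 τ h']; simp
  · exact (hM τ ⟨h, h'⟩).trans (le_max_right _ _)

lemma trunc_deriv {n : ℕ} {D : Set (Eu n)} (hD : IsOpen D) {w : Eu n → ℝ}
    (hw : DifferentiableOn ℝ w D) {ψ : ℝ → ℝ} {K : ℝ} (hψ : Differentiable ℝ ψ)
    (hK : ∀ τ, |deriv ψ τ| ≤ K) (d0 : ∀ τ ≤ 1, deriv ψ τ = 0) (d1 : ∀ τ, 4 ≤ τ → deriv ψ τ = 0)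
    (m : ℝ) {h : ℝ} (hh : 0 < h) :
    DifferentiableOn ℝ (fun y => h * ψ ((w y - m) ^ 2 / h ^ 2)) D ∧
    ∀ y ∈ D, ‖fderiv ℝ (fun y => h * ψ ((w y - m) ^ 2 / h ^ 2)) y‖ₑ ≤ ENNReal.ofReal (4 * K) *
      (D ∩ w ⁻¹' {z | h < |z - m| ∧ |z - m| < 2 * h}).indicator (fun η => ‖fderiv ℝ w η‖ₑ) y := by
  have key : ∀ y ∈ D, HasFDerivAt (fun y => h * ψ ((w y - m) ^ 2 / h ^ 2))
      ((h * (deriv ψ ((w y - m) ^ 2 / h ^ 2) * (2 * (w y - m) / h ^ 2))) • fderiv ℝ w y) y := by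
    intro y hy
    have hwy : HasFDerivAt w (fderiv ℝ w y) y :=
      ((hw y hy).differentiableAt (hD.mem_nhds hy)).hasFDerivAt
    have h1 : HasDerivAt (fun z : ℝ => h * ψ ((z - m) ^ 2 / h ^ 2))
        (h * (deriv ψ ((w y - m) ^ 2 / h ^ 2) * (2 * (w y - m) / h ^ 2))) (w y) := by
      apply HasDerivAt.const_mul
      have h2 : HasDerivAt (fun z : ℝ => (z - m) ^ 2 / h ^ 2) (2 * (w y - m) / h ^ 2) (w y) := by
        have := (((hasDerivAt_id (w y)).sub_const m).pow 2).div_const (h ^ 2)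
        simpa using this
      exact (hψ _).hasDerivAt.comp (w y) h2
    exact h1.comp_hasFDerivAt y hwy
  refine ⟨fun y hy => (key y hy).differentiableAt.differentiableWithinAt, ?_⟩
  intro y hy
  rw [(key y hy).fderiv]
  by_cases hA : h < |w y - m| ∧ |w y - m| < 2 * h
  · have hyA : y ∈ D ∩ w ⁻¹' {z | h < |z - m| ∧ |z - m| < 2 * h} := ⟨hy, hA⟩
    rw [indicator_of_mem hyA, enorm_smul]
    gcongr
    rw [Real.enorm_eq_ofReal_abs]
    apply ENNReal.ofReal_le_ofReal
    rw [abs_mul, abs_mul, abs_div, abs_mul, abs_of_pos hh, abs_of_pos (by positivity : 0 < h ^ 2),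
      abs_two]
    have hK0 : 0 ≤ K := (abs_nonneg _).trans (hK 0)
    calc h * (|deriv ψ ((w y - m) ^ 2 / h ^ 2)| * (2 * |w y - m| / h ^ 2)) ≤
        h * (K * (2 * (2 * h) / h ^ 2)) := by
          gcongr
          · exact hK _
          · exact hA.2.le
      _ = 4 * K := by field_simp; ring
  · have : deriv ψ ((w y - m) ^ 2 / h ^ 2) = 0 := by
      rw [not_and_or, not_lt, not_lt] at hA
      rw [← sq_abs (w y - m)]
      rcases hA with hA | hA
      · apply d0
        rw [div_le_one (by positivity)]
        gcongr
      · apply d1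
        rw [le_div_iff₀ (by positivity)]
        nlinarith
    rw [this, enorm_smul, zero_mul, mul_zero, enorm_zero, zero_mul]
    exact zero_le

set_option maxHeartbeats 1000000 in
lemma modular_bound {n : ℕ} (hn : 2 ≤ n) {D : Set (Eu n)} {s : Eu n → ℝ} {a b : ℝ} {x₀ : Eu n}
    (hD : IsJohnDomain D s a b x₀) (hsm : Measurable s) {sp c : ℝ}
    (hs : ∀ x, 1 ≤ s x ∧ s x ≤ sp) (hsp : sp * ((n : ℝ) - 1) < n)
    (hc : ∀ x ∈ D, ∀ y ∈ D, |s x - s y| * |Real.log (dist x y)| ≤ c) :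
    ∃ K : ℝ, 1 ≤ K ∧ ∀ w : Eu n → ℝ, DifferentiableOn ℝ w D →
      ∫⁻ η in D, ‖fderiv ℝ w η‖ₑ ≤ 1 →
      ∫⁻ x in D, ENNReal.ofReal (|w x - ⨍ y in ball x₀ (infDist x₀ (frontier D)), w y| ^
        ((n : ℝ) / (s x * ((n : ℝ) - 1)))) ≤ ENNReal.ofReal K := by
  have hn' : (2 : ℝ) ≤ n := by exact_mod_cast hn
  have hs2 : ∀ x, s x ≤ 2 := by
    intro x
    have := (hs x).2
    by_contra hcon
    push Not at hcon
    nlinarith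
  have hβ : ∀ x, 1 ≤ s x * ((n : ℝ) - 1) := fun x => by nlinarith [(hs x).1]
  set q : Eu n → ℝ := fun x => (n : ℝ) / (s x * ((n : ℝ) - 1)) with hq
  have hq1 : ∀ x, 1 ≤ q x := by
    intro x
    simp only [hq]
    rw [le_div_iff₀ (by linarith [hβ x])]
    nlinarith [(hs x).2]
  have hq2 : ∀ x, q x ≤ 2 := by
    intro x
    simp only [hq]
    rw [div_le_iff₀ (by linarith [hβ x])]
    nlinarith [(hs x).1]
  obtain ⟨C1, hC1, hpw⟩ := pointwise hn hD (fun x _ => ⟨(hs x).1, hs2 x⟩)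
  obtain ⟨Cw, hCw, hwt⟩ := weak_type hn hD.1 hD.2.2.1 hsm (fun x _ => hs x) hsp hc
  obtain ⟨ψ, K0, hK0, hψ, ψ0, ψ1, hψK, d0, d1⟩ := exists_cutoff
  have hDo : IsOpen D := hD.1
  have hDb : Bornology.IsBounded D := hD.2.2.1
  have hx₀ : x₀ ∈ D := hD.2.2.2.2.2.1
  set B := ball x₀ (infDist x₀ (frontier D)) with hB
  have hBD : B ⊆ D := ball_infDist_frontier hDo hx₀
  have hBpos : 0 < (volume B).toReal := by
    apply ENNReal.toReal_pos
    · exact (measure_ball_pos volume x₀ (infDist_frontier_pos hn hDo hDb hx₀)).ne'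
    · exact measure_ball_lt_top.ne
  set C2 := 4 * K0 * C1 + C1 + 1 with hC2
  have hKC : 0 < 4 * K0 * C1 := by positivity
  have hC2a : C1 ≤ C2 := by linarith
  have hC2b : C1 * (4 * K0) ≤ C2 := by linarith
  have hC2c : 1 ≤ C2 := by linarith
  set T := Cw / (volume B).toReal + 1 with hT
  have hT1 : 1 ≤ T := by
    have : 0 < Cw / (volume B).toReal := by positivity
    linarith
  set T' := C2 * (T + 1) with hT'
  have hT'C : 2 * C2 ≤ T' := by nlinarith
  set H := 4 * T' with hH
  have hH1 : 8 * C2 ≤ H := by linarith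
  have hH0 : 0 < H := by linarith
  refine ⟨1 + ((2 * H) ^ 2 * (volume D).toReal + (16 * C2) ^ 2 * Cw),
    le_add_of_nonneg_right (by positivity), ?_⟩
  intro w hw hw1
  set m := ⨍ y in B, w y with hm
  set f : Eu n → ℝ≥0∞ := fun η => ‖fderiv ℝ w η‖ₑ with hf
  have hfm : Measurable f := (measurable_fderiv ℝ w).enorm
  set I : (Eu n → ℝ≥0∞) → Eu n → ℝ≥0∞ := fun f x =>
    ∫⁻ η in D, f η * ENNReal.ofReal (dist x η ^ (-(s x * ((n : ℝ) - 1)))) with hI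
  set A : ℝ → Set (Eu n) := fun h => D ∩ w ⁻¹' {z | h < |z - m| ∧ |z - m| < 2 * h} with hA
  have hAm : ∀ h, MeasurableSet (A h) := by
    intro h
    apply IsOpen.measurableSet
    apply hw.continuousOn.isOpen_inter_preimage hDo
    have hcz : Continuous fun z : ℝ => |z - m| := by fun_prop
    exact (isOpen_lt continuous_const hcz).inter (isOpen_lt hcz continuous_const)
  have hAD : ∀ h, A h ⊆ D := fun h => inter_subset_left
  set g : ℝ → Eu n → ℝ≥0∞ := fun h => (A h).indicator f with hg
  have hgm : ∀ h, Measurable (g h) := fun h => hfm.indicator (hAm h)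
  have hgf : ∀ h η, g h η ≤ f η := fun h η => indicator_le_self _ _ _
  have hg1 : ∀ h, ∫⁻ η in D, g h η ≤ 1 := fun h => (lintegral_mono (hgf h)).trans hw1
  have hgI : ∀ h, ∫⁻ η in D, g h η = ∫⁻ η in A h, f η := by
    intro h
    simp only [hg]
    rw [lintegral_indicator (hAm h), Measure.restrict_restrict (hAm h),
      inter_eq_self_of_subset_left (hAD h)]
  have hIgf : ∀ h x, I (g h) x ≤ I f x := by
    intro h x
    apply lintegral_mono
    intro η
    dsimp only
    gcongr
    exact hgf h η
  -- a good point
  obtain ⟨z, hzB, hz⟩ : ∃ z ∈ B, I f z ≤ ENNReal.ofReal T := by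
    by_contra hcon
    push Not at hcon
    have h1 := hwt f hfm hw1 T hT1
    have h2 : ENNReal.ofReal T * volume B ≤ ENNReal.ofReal Cw := by
      calc ENNReal.ofReal T * volume B = ∫⁻ x in B, ENNReal.ofReal T := by
            rw [setLIntegral_const]
        _ ≤ ∫⁻ x in B, ENNReal.ofReal (T ^ q x) := by
            apply lintegral_mono
            intro x
            apply ENNReal.ofReal_le_ofReal
            calc T = T ^ (1 : ℝ) := (Real.rpow_one T).symm
              _ ≤ T ^ q x := Real.rpow_le_rpow_of_exponent_le hT1 (hq1 x)
        _ ≤ ENNReal.ofReal Cw * ∫⁻ η in D, f η :=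
          by
            refine le_trans (lintegral_mono_set ?_) h1
            exact fun x hx => ⟨hBD hx, hcon x hx⟩
        _ ≤ ENNReal.ofReal Cw * 1 := by gcongr
        _ = _ := mul_one _
    rw [← ENNReal.ofReal_toReal (measure_ball_lt_top.ne : volume B ≠ ∞),
      ← ENNReal.ofReal_mul (by linarith), ENNReal.ofReal_le_ofReal_iff hCw.le, hT, add_mul,
      div_mul_cancel₀ _ hBpos.ne'] at h2
    linarith
  have hzm : |w z - m| ≤ T' := by
    have h1 := hpw w hw (ne_top_of_le_ne_top ENNReal.one_ne_top hw1) z (hBD hzB)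
    have h2 : ‖w z - m‖ₑ ≤ ENNReal.ofReal T' := by
      calc ‖w z - m‖ₑ ≤ ENNReal.ofReal C1 * (I f z + ∫⁻ η in D, f η) := h1
        _ ≤ ENNReal.ofReal C2 * (ENNReal.ofReal T + 1) := by gcongr
        _ = _ := by
          rw [hT', ENNReal.ofReal_mul (p := C2) (by linarith),
            ENNReal.ofReal_add (p := T) (by linarith) (by norm_num), ENNReal.ofReal_one]
    rwa [Real.enorm_eq_ofReal_abs, ENNReal.ofReal_le_ofReal_iff (by linarith)] at h2
  -- truncation estimate
  have htr : ∀ h, H ≤ h → ∀ x ∈ D, 2 * h ≤ |w x - m| → ENNReal.ofReal (h / (4 * C2)) < I (g h) x := by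
    intro h hh x hx hxm
    have hh0 : 0 < h := by linarith
    obtain ⟨hvd, hvb⟩ := trunc_deriv hDo hw hψ hψK d0 d1 m hh0
    set v : Eu n → ℝ := fun y => h * ψ ((w y - m) ^ 2 / h ^ 2) with hv
    have hInteg : ∫⁻ η in D, ‖fderiv ℝ v η‖ₑ ≤ ENNReal.ofReal (4 * K0) * ∫⁻ η in D, g h η := by
      rw [← lintegral_const_mul _ (hgm h)]
      exact setLIntegral_mono' hDo.measurableSet hvb
    have hIntegI : ∀ y, I (fun η => ‖fderiv ℝ v η‖ₑ) y ≤ ENNReal.ofReal (4 * K0) * I (g h) y := by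
      intro y
      simp only [hI]
      rw [← lintegral_const_mul' _ _ ENNReal.ofReal_ne_top]
      apply setLIntegral_mono' hDo.measurableSet
      intro η hη
      rw [← mul_assoc]
      gcongr
      exact hvb η hη
    have hvfin : ∫⁻ η in D, ‖fderiv ℝ v η‖ₑ ≠ ∞ := by
      refine ne_top_of_le_ne_top ?_ hInteg
      exact ENNReal.mul_ne_top ENNReal.ofReal_ne_top
        (ne_top_of_le_ne_top ENNReal.one_ne_top (hg1 h))
    have hvp : ∀ y ∈ D, ‖v y - ⨍ y in B, v y‖ₑ ≤ ENNReal.ofReal C2 * (I (g h) y + 1) := by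
      intro y hy
      calc ‖v y - ⨍ y in B, v y‖ₑ ≤ ENNReal.ofReal C1 * (I (fun η => ‖fderiv ℝ v η‖ₑ) y +
            ∫⁻ η in D, ‖fderiv ℝ v η‖ₑ) := hpw v hvd hvfin y hy
        _ ≤ ENNReal.ofReal C1 * (ENNReal.ofReal (4 * K0) * I (g h) y +
            ENNReal.ofReal (4 * K0) * 1) := by
            gcongr
            · exact hIntegI y
            · refine hInteg.trans ?_
              gcongr
              exact hg1 h
        _ = ENNReal.ofReal (C1 * (4 * K0)) * (I (g h) y + 1) := by
            rw [ENNReal.ofReal_mul hC1.le]; ring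
        _ ≤ _ := by gcongr
    have hvr : ∀ y ∈ D, ∀ τ : ℝ, 0 ≤ τ → I (g h) y ≤ ENNReal.ofReal τ →
        |v y - ⨍ y in B, v y| ≤ C2 * (τ + 1) := by
      intro y hy τ hτ hIy
      have h1 : ‖v y - ⨍ y in B, v y‖ₑ ≤ ENNReal.ofReal (C2 * (τ + 1)) := by
        refine (hvp y hy).trans ?_
        rw [ENNReal.ofReal_mul (by linarith), ENNReal.ofReal_add hτ (by norm_num),
            ENNReal.ofReal_one]
        gcongr
      rwa [Real.enorm_eq_ofReal_abs, ENNReal.ofReal_le_ofReal_iff (by positivity)] at h1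
    have hvz : v z = 0 := by
      simp only [hv]
      rw [ψ0, mul_zero]
      rw [div_le_one (by positivity), ← sq_abs]
      have : |w z - m| ≤ h := by linarith
      gcongr
    have hvx : v x = h := by
      simp only [hv]
      rw [ψ1, mul_one]
      rw [le_div_iff₀ (by positivity), ← sq_abs (w x - m)]
      nlinarith
    have hav := hvr z (hBD hzB) T (by linarith) ((hIgf h z).trans hz)
    by_contra hcon
    push Not at hcon
    have hav2 := hvr x hx (h / (4 * C2)) (by positivity) hcon
    rw [hvz] at hav
    rw [hvx] at hav2
    have e1 := (abs_le.1 hav).1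
    have e2 := (abs_le.1 hav2).2
    have e3 := (abs_le.1 hav).2
    have e4 : C2 * (h / (4 * C2) + 1) = h / 4 + C2 := by field_simp
    rw [e4] at e2
    linarith
  -- decomposition
  set hi : ℕ → ℝ := fun i => H * 2 ^ i with hhi
  have hiH : ∀ i, H ≤ hi i := by
    intro i
    have : (1 : ℝ) ≤ 2 ^ i := one_le_pow₀ (by norm_num)
    simp only [hhi]; nlinarith
  set w' := D.indicator w with hw'
  have hw'm : Measurable w' := meas_D_indicator hDo hw.continuousOn
  set P : ℕ → Set (Eu n) := fun i =>
    D ∩ w' ⁻¹' {y | 2 * hi i ≤ |y - m| ∧ |y - m| < 4 * hi i} with hP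
  have hPm : ∀ i, MeasurableSet (P i) := by
    intro i
    apply hDo.measurableSet.inter
    apply hw'm
    have hcz : Measurable fun z : ℝ => |z - m| := by fun_prop
    exact (measurableSet_le measurable_const hcz).inter (measurableSet_lt hcz measurable_const)
  set L : Set (Eu n) := D ∩ w' ⁻¹' {y | |y - m| < 2 * H} with hL
  have hLm : MeasurableSet L := by
    apply hDo.measurableSet.inter
    apply hw'm
    have hcz : Measurable fun z : ℝ => |z - m| := by fun_prop
    exact measurableSet_lt hcz measurable_const
  have hw'x : ∀ x ∈ D, w' x = w x := fun x hx => indicator_of_mem hx _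
  have hcov : D ⊆ L ∪ ⋃ i, P i := by
    intro x hx
    by_cases hlt : |w x - m| < 2 * H
    · left
      exact ⟨hx, by simpa [hw'x x hx] using hlt⟩
    · right
      push Not at hlt
      obtain ⟨i, hi1, hi2⟩ := exists_nat_pow_near (x := |w x - m| / (2 * H)) (y := 2)
        (by rw [le_div_iff₀ (by positivity)]; linarith) (by norm_num)
      rw [le_div_iff₀ (by positivity)] at hi1
      rw [div_lt_iff₀ (by positivity), pow_succ] at hi2
      refine mem_iUnion.2 ⟨i, hx, ?_⟩
      simp only [mem_preimage, mem_ofPred_eq, hw'x x hx, hhi]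
      constructor <;> linarith
  set F : Eu n → ℝ≥0∞ := fun x => ENNReal.ofReal (|w x - m| ^ q x) with hF
  have hlow : ∫⁻ x in L, F x ≤ ENNReal.ofReal ((2 * H) ^ 2 * (volume D).toReal) := by
    calc ∫⁻ x in L, F x ≤ ∫⁻ x in L, ENNReal.ofReal ((2 * H) ^ 2) := by
          apply setLIntegral_mono' hLm
          intro x hx
          apply ENNReal.ofReal_le_ofReal
          have h1 : |w x - m| ≤ 2 * H := by
            have := hx.2
            simp only [mem_preimage, mem_ofPred_eq, hw'x x hx.1] at this
            exact this.le
          calc |w x - m| ^ q x ≤ (2 * H) ^ q x :=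
                Real.rpow_le_rpow (abs_nonneg _) h1 (by linarith [hq1 x])
            _ ≤ (2 * H) ^ (2 : ℝ) := Real.rpow_le_rpow_of_exponent_le (by linarith) (hq2 x)
            _ = _ := by norm_cast
      _ = ENNReal.ofReal ((2 * H) ^ 2) * volume L := by rw [setLIntegral_const]
      _ ≤ ENNReal.ofReal ((2 * H) ^ 2) * volume D := by
          gcongr
          exact inter_subset_left
      _ = _ := by
          rw [ENNReal.ofReal_mul (by positivity), ENNReal.ofReal_toReal hDb.measure_lt_top.ne]
  have hhigh : ∀ i, ∫⁻ x in P i, F x ≤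
      ENNReal.ofReal ((16 * C2) ^ 2 * Cw) * ∫⁻ η in A (hi i), f η := by
    intro i
    have hh := hiH i
    set h := hi i
    set t := h / (4 * C2) with ht
    have ht1 : 1 ≤ t := by
      rw [ht, le_div_iff₀ (by positivity)]; linarith
    have hh4 : 4 * h = 16 * C2 * t := by rw [ht]; field_simp; ring
    calc ∫⁻ x in P i, F x ≤ ∫⁻ x in P i, ENNReal.ofReal ((16 * C2) ^ 2) * ENNReal.ofReal (t ^ q x) := by
          apply setLIntegral_mono' (hPm i)
          intro x hx
          rw [← ENNReal.ofReal_mul (by positivity)]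
          apply ENNReal.ofReal_le_ofReal
          have h1 : |w x - m| ≤ 16 * C2 * t := by
            have := hx.2
            simp only [mem_preimage, mem_ofPred_eq, hw'x x hx.1] at this
            rw [← hh4]
            exact this.2.le
          calc |w x - m| ^ q x ≤ (16 * C2 * t) ^ q x :=
                Real.rpow_le_rpow (abs_nonneg _) h1 (by linarith [hq1 x])
            _ = (16 * C2) ^ q x * t ^ q x := Real.mul_rpow (by positivity) (by positivity)
            _ ≤ (16 * C2) ^ (2 : ℝ) * t ^ q x := by
                gcongr
                · linarith
                · exact hq2 x
            _ = _ := by norm_cast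
      _ = ENNReal.ofReal ((16 * C2) ^ 2) * ∫⁻ x in P i, ENNReal.ofReal (t ^ q x) := by
          rw [lintegral_const_mul' _ _ ENNReal.ofReal_ne_top]
      _ ≤ ENNReal.ofReal ((16 * C2) ^ 2) * (ENNReal.ofReal Cw * ∫⁻ η in D, g h η) := by
          gcongr
          refine le_trans (lintegral_mono_set ?_) (hwt (g h) (hgm h) (hg1 h) t ht1)
          intro x hx
          refine ⟨hx.1, htr h hh x hx.1 ?_⟩
          have := hx.2
          simp only [mem_preimage, mem_ofPred_eq, hw'x x hx.1] at this
          exact this.1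
      _ = _ := by
          rw [hgI, ENNReal.ofReal_mul (by positivity), mul_assoc]
  have hdisj : Pairwise (Function.onFun Disjoint fun i => A (hi i)) := by
    have key : ∀ i j, i < j → Disjoint (A (hi i)) (A (hi j)) := by
      intro i j hij
      rw [Set.disjoint_left]
      rintro x ⟨_, hx1⟩ ⟨_, hx2⟩
      simp only [mem_preimage, mem_ofPred_eq] at hx1 hx2
      have h1 : 2 * hi i ≤ hi j := by
        simp only [hhi]
        have : (2 : ℝ) ^ (i + 1) ≤ 2 ^ j := pow_le_pow_right₀ (by norm_num) hij
        rw [pow_succ] at this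
        nlinarith
      linarith
    intro i j hij
    rcases lt_or_gt_of_ne hij with h | h
    · exact key i j h
    · exact (key j i h).symm
  calc ∫⁻ x in D, F x ≤ ∫⁻ x in L ∪ ⋃ i, P i, F x := lintegral_mono_set hcov
    _ ≤ (∫⁻ x in L, F x) + ∫⁻ x in ⋃ i, P i, F x := lintegral_union_le _ _ _
    _ ≤ (∫⁻ x in L, F x) + ∑' i, ∫⁻ x in P i, F x := by
        exact add_le_add le_rfl (lintegral_iUnion_le _ _)
    _ ≤ ENNReal.ofReal ((2 * H) ^ 2 * (volume D).toReal) +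
        ∑' i, ENNReal.ofReal ((16 * C2) ^ 2 * Cw) * ∫⁻ η in A (hi i), f η := by
        exact add_le_add hlow (ENNReal.tsum_le_tsum hhigh)
    _ = ENNReal.ofReal ((2 * H) ^ 2 * (volume D).toReal) +
        ENNReal.ofReal ((16 * C2) ^ 2 * Cw) * ∫⁻ η in ⋃ i, A (hi i), f η := by
        rw [ENNReal.tsum_mul_left, lintegral_iUnion (fun i => hAm _) hdisj]
    _ ≤ ENNReal.ofReal ((2 * H) ^ 2 * (volume D).toReal) +
        ENNReal.ofReal ((16 * C2) ^ 2 * Cw) * 1 := by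
        have hU : ∫⁻ η in ⋃ i, A (hi i), f η ≤ 1 :=
          (lintegral_mono_set (iUnion_subset fun i => hAD _)).trans hw1
        gcongr
    _ ≤ _ := by
        have hx1 : 0 ≤ (2 * H) ^ 2 * (volume D).toReal := by positivity
        have hx2 : 0 ≤ (16 * C2) ^ 2 * Cw := by positivity
        rw [mul_one, ← ENNReal.ofReal_add hx1 hx2]
        exact ENNReal.ofReal_le_ofReal (le_add_of_nonneg_left zero_le_one)

/-- Sobolev–Poincaré inequality in `s(·)`-John domains, case `p = 1`
(Theorem 5.7). -/
theorem john_sobolev_poincare_p_eq_one {n : ℕ} (hn : 2 ≤ n)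
    (D : Set (EuclideanSpace ℝ (Fin n)))
    (s : EuclideanSpace ℝ (Fin n) → ℝ) (a b : ℝ)
    (x₀ : EuclideanSpace ℝ (Fin n))
    (hD : IsJohnDomain D s a b x₀)
    (cs : ℝ) (hls : LogHolderWith cs s D)
    (sm sp : ℝ) (hsm : 1 ≤ sm) (hsp : sp < (n : ℝ) / ((n : ℝ) - 1))
    (hsb : ∀ x ∈ D, sm ≤ s x ∧ s x ≤ sp) :
    ∃ c : ℝ, 0 < c ∧
      ∀ u : EuclideanSpace ℝ (Fin n) → ℝ, DifferentiableOn ℝ u D →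
        LocallyIntegrableOn u D →
        IntegrableOn (fun y => ‖fderiv ℝ u y‖) D →
        luxNorm (fun x => (n : ℝ) / (s x * ((n : ℝ) - 1))) D
            (fun x =>
              u x - ⨍ y in Metric.ball x₀ (Metric.infDist x₀ (frontier D)), u y)
          ≤ c * ∫ y in D, ‖fderiv ℝ u y‖ := by
  classical
  have hn' : (2 : ℝ) ≤ n := by exact_mod_cast hn
  have hn1 : (0 : ℝ) < (n : ℝ) - 1 := by linarith
  have hx₀ : x₀ ∈ D := hD.2.2.2.2.2.1
  have hDo : IsOpen D := hD.1
  have hsp1 : 1 ≤ sp := hsm.trans ((hsb x₀ hx₀).1.trans (hsb x₀ hx₀).2)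
  have hspn : sp * ((n : ℝ) - 1) < n := by rwa [lt_div_iff₀ hn1] at hsp
  set s' : Eu n → ℝ := D.piecewise s (fun _ => 1) with hs'
  have hs'x : ∀ x ∈ D, s' x = s x := fun x hx => Set.piecewise_eq_of_mem _ _ _ hx
  have hs'm : Measurable s' :=
    (logHolder_cont hls).measurable_piecewise continuousOn_const hDo.measurableSet
  have hs'b : ∀ x, 1 ≤ s' x ∧ s' x ≤ sp := by
    intro x
    by_cases hx : x ∈ D
    · rw [hs'x x hx]
      exact ⟨hsm.trans (hsb x hx).1, (hsb x hx).2⟩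
    · have : s' x = 1 := Set.piecewise_eq_of_notMem _ _ _ hx
      rw [this]
      exact ⟨le_rfl, hsp1⟩
  have hD' : IsJohnDomain D s' a b x₀ := by
    obtain ⟨h1, h2, h3, h4, h5, h6, h7⟩ := hD
    refine ⟨h1, h2, h3, h4, h5, h6, ?_⟩
    intro x hx
    rw [hs'x x hx]
    exact h7 x hx
  obtain ⟨Δ0, hΔ0⟩ := Metric.isBounded_iff.1 hD.2.2.1
  have hbd := logHolder_bound hls (le_max_left 1 Δ0)
    (fun x hx y hy => (hΔ0 hx hy).trans (le_max_right _ _))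
  have hbd' : ∀ x ∈ D, ∀ y ∈ D, |s' x - s' y| * |Real.log (dist x y)| ≤ |cs| * max 1 Δ0 := by
    intro x hx y hy
    rw [hs'x x hx, hs'x y hy]
    exact hbd x hx y hy
  obtain ⟨K, hK1, hK⟩ := modular_bound hn hD' hs'm hs'b hspn hbd'
  have hK0 : 0 < K := by linarith
  refine ⟨K, hK0, ?_⟩
  intro u hu _ hgu
  set G := ∫ y in D, ‖fderiv ℝ u y‖ with hG
  have hG0 : 0 ≤ G := integral_nonneg fun _ => norm_nonneg _
  have hGl : ∫⁻ y in D, ‖fderiv ℝ u y‖ₑ = ENNReal.ofReal G := by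
    have := ofReal_integral_norm_eq_lintegral_enorm hgu
    simp only [norm_norm, enorm_norm] at this
    exact this.symm
  set m := ⨍ y in Metric.ball x₀ (Metric.infDist x₀ (frontier D)), u y with hm
  have main : ∀ l : ℝ, G < l → luxNorm (fun x => (n : ℝ) / (s x * ((n : ℝ) - 1))) D
      (fun x => u x - m) ≤ K * l := by
    intro l hl
    have hl0 : 0 < l := hG0.trans_lt hl
    apply csInf_le ⟨0, fun z hz => hz.1.le⟩
    refine ⟨by positivity, ?_⟩
    have hwd : DifferentiableOn ℝ (fun x => l⁻¹ * u x) D := hu.const_mul _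
    have hwg : ∫⁻ η in D, ‖fderiv ℝ (fun x => l⁻¹ * u x) η‖ₑ ≤ 1 := by
      have e : ∫⁻ η in D, ‖fderiv ℝ (fun x => l⁻¹ * u x) η‖ₑ =
          ∫⁻ η in D, ENNReal.ofReal l⁻¹ * ‖fderiv ℝ u η‖ₑ := by
        apply setLIntegral_congr_fun hDo.measurableSet
        intro η hη
        dsimp only
        rw [fderiv_const_mul ((hu η hη).differentiableAt (hDo.mem_nhds hη)), enorm_smul,
          Real.enorm_of_nonneg (by positivity)]
      rw [e, lintegral_const_mul' _ _ ENNReal.ofReal_ne_top, hGl,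
        ← ENNReal.ofReal_mul (by positivity), ← ENNReal.ofReal_one]
      apply ENNReal.ofReal_le_ofReal
      rw [inv_mul_le_iff₀ hl0]
      linarith
    have hwm : ⨍ y in Metric.ball x₀ (Metric.infDist x₀ (frontier D)), l⁻¹ * u y = l⁻¹ * m := by
      rw [hm, setAverage_eq, setAverage_eq, integral_const_mul, smul_eq_mul, smul_eq_mul]
      ring
    have h1 := hK _ hwd hwg
    rw [hwm] at h1
    calc ∫⁻ x in D, ENNReal.ofReal ((|u x - m| / (K * l)) ^ ((n : ℝ) / (s x * ((n : ℝ) - 1))))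
        ≤ ∫⁻ x in D, ENNReal.ofReal K⁻¹ * ENNReal.ofReal (|l⁻¹ * u x - l⁻¹ * m| ^
          ((n : ℝ) / (s' x * ((n : ℝ) - 1)))) := by
          apply setLIntegral_mono' hDo.measurableSet
          intro x hx
          rw [hs'x x hx, ← ENNReal.ofReal_mul (by positivity)]
          apply ENNReal.ofReal_le_ofReal
          have hsx := hsb x hx
          have hβ : 0 < s x * ((n : ℝ) - 1) := mul_pos (by linarith) hn1
          have hq1 : 1 ≤ (n : ℝ) / (s x * ((n : ℝ) - 1)) := by
            rw [le_div_iff₀ hβ]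
            nlinarith
          have e : |u x - m| / (K * l) = K⁻¹ * |l⁻¹ * u x - l⁻¹ * m| := by
            rw [← mul_sub, abs_mul, abs_of_pos (by positivity : 0 < l⁻¹)]
            field_simp
          rw [e, Real.mul_rpow (by positivity) (abs_nonneg _)]
          gcongr
          calc K⁻¹ ^ ((n : ℝ) / (s x * ((n : ℝ) - 1))) ≤ K⁻¹ ^ (1 : ℝ) :=
                Real.rpow_le_rpow_of_exponent_ge (by positivity) (inv_le_one_of_one_le₀ hK1) hq1
            _ = K⁻¹ := Real.rpow_one _
      _ ≤ ENNReal.ofReal K⁻¹ * ENNReal.ofReal K := by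
          rw [lintegral_const_mul' _ _ ENNReal.ofReal_ne_top]
          gcongr
      _ = 1 := by
          rw [← ENNReal.ofReal_mul (by positivity), inv_mul_cancel₀ hK0.ne', ENNReal.ofReal_one]
  apply le_of_forall_pos_le_add
  intro ε hε
  have h2 := main (G + ε / K) (lt_add_of_pos_right _ (by positivity))
  have h3 : K * (G + ε / K) = K * G + ε := by field_simp
  linarith
end

section
/- (Exponential integrability in s-John domains) Let D be an s-John domain in ℝ^n, n ≥ 2, with constant 1 ≤ s < n/(n−1). Then there exist positive constants a and b such that ∫_D exp(a |u − u_B|^{n/(s(n−1))}) dH_∞^{s(n−1)} ≤ b for all u ∈ L^1_{n/(n−s(n−1))}(D) with ‖∇u‖_{L^{n/(n−s(n−1))}(D)} ≤ 1, where B = B(x₀, dist(x₀, ∂D)) and the integral is the Choquet integral with respect to the Hausdorff content H_∞^{s(n−1)}. -/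
open MeasureTheory Metric

/-- Variable dimensional Hausdorff content. -/
noncomputable def hContent {n : ℕ} (β : EuclideanSpace ℝ (Fin n) → ℝ)
    (A : Set (EuclideanSpace ℝ (Fin n))) : ENNReal :=
  ⨅ (c : ℕ → EuclideanSpace ℝ (Fin n) × ℝ)
    (_ : A ⊆ ⋃ i, Metric.ball (c i).1 (c i).2),
    ∑' i, ENNReal.ofReal ((c i).2 ^ β (c i).1)

section helpers
open Set Filter Topology
open scoped ENNReal NNReal

/-- Extended norm of the gradient, cut off outside `D`. -/
noncomputable def gradE {n : ℕ} (D : Set (EuclideanSpace ℝ (Fin n)))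
    (u : EuclideanSpace ℝ (Fin n) → ℝ) : EuclideanSpace ℝ (Fin n) → ℝ≥0∞ :=
  D.indicator (fun y => ‖fderiv ℝ u y‖ₑ)

/-- Average of `u` over the ball `B(p, ρ)`, normalised to the unit ball. -/
noncomputable def mAvg {n : ℕ} (u : EuclideanSpace ℝ (Fin n) → ℝ)
    (p : EuclideanSpace ℝ (Fin n)) (ρ : ℝ) : ℝ :=
  ⨍ z in ball (0 : EuclideanSpace ℝ (Fin n)) 1, u (p + ρ • z)

lemma measurable_gradE {n : ℕ} {D : Set (EuclideanSpace ℝ (Fin n))} (hD : IsOpen D)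
    (u : EuclideanSpace ℝ (Fin n) → ℝ) : Measurable (gradE D u) :=
  (measurable_fderiv ℝ u).enorm.indicator hD.measurableSet

lemma edist_le_segment {n : ℕ} {D : Set (EuclideanSpace ℝ (Fin n))} (hD : IsOpen D)
    {u : EuclideanSpace ℝ (Fin n) → ℝ} (hu : DifferentiableOn ℝ u D)
    (a b : EuclideanSpace ℝ (Fin n))
    (hab : ∀ τ ∈ Icc (0 : ℝ) 1, a + τ • (b - a) ∈ D) :
    edist (u a) (u b) ≤ ‖b - a‖ₑ * ∫⁻ τ in Icc (0 : ℝ) 1, gradE D u (a + τ • (b - a)) := by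
  set φd : ℝ → ℝ := fun τ => fderiv ℝ u (a + τ • (b - a)) (b - a) with hφd
  have hmeasφ : Measurable φd := by
    have h1 : Measurable fun τ : ℝ => fderiv ℝ u (a + τ • (b - a)) :=
      (measurable_fderiv ℝ u).comp (by fun_prop)
    exact h1.apply_continuousLinearMap (b - a)
  have hder : ∀ τ ∈ Icc (0 : ℝ) 1,
      HasDerivAt (fun τ : ℝ => u (a + τ • (b - a))) (φd τ) τ := by
    intro τ hτ
    have h1 : HasFDerivAt u (fderiv ℝ u (a + τ • (b - a))) (a + τ • (b - a)) :=
      ((hu _ (hab τ hτ)).differentiableAt (hD.mem_nhds (hab τ hτ))).hasFDerivAt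
    have h2 : HasDerivAt (fun τ : ℝ => a + τ • (b - a)) (b - a) τ := by
      simpa using ((hasDerivAt_id τ).smul_const (b - a)).const_add a
    exact h1.comp_hasDerivAt τ h2
  have hle : ∫⁻ τ in Icc (0 : ℝ) 1, ‖φd τ‖ₑ ≤
      ‖b - a‖ₑ * ∫⁻ τ in Icc (0 : ℝ) 1, gradE D u (a + τ • (b - a)) := by
    have hm : Measurable fun τ : ℝ => gradE D u (a + τ • (b - a)) :=
      (measurable_gradE hD u).comp (by fun_prop)
    rw [← lintegral_const_mul _ hm]
    refine setLIntegral_mono' measurableSet_Icc fun τ hτ => ?_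
    rw [gradE, indicator_of_mem (hab τ hτ), mul_comm]
    exact ContinuousLinearMap.le_opENorm _ _
  refine le_trans ?_ hle
  by_cases hfin : ∫⁻ τ in Icc (0 : ℝ) 1, ‖φd τ‖ₑ = ∞
  · rw [hfin]; exact le_top
  have hintg : IntegrableOn φd (Icc 0 1) := ⟨hmeasφ.aestronglyMeasurable, lt_top_iff_ne_top.2 hfin⟩
  have hftc := intervalIntegral.integral_eq_sub_of_hasDerivAt (a := (0:ℝ)) (b := 1)
    (f := fun τ : ℝ => u (a + τ • (b - a))) (f' := φd)
    (by rw [uIcc_of_le zero_le_one]; exact hder)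
    ((intervalIntegrable_iff_integrableOn_Icc_of_le zero_le_one).2 hintg)
  simp only [one_smul, zero_smul, add_zero, add_sub_cancel] at hftc
  rw [edist_comm, edist_eq_enorm_sub, ← hftc, intervalIntegral.integral_of_le zero_le_one,
    ← integral_Icc_eq_integral_Ioc]
  exact enorm_integral_le_lintegral_enorm _

lemma lintegral_ball_scale {n : ℕ} {g : EuclideanSpace ℝ (Fin n) → ℝ≥0∞} (hg : Measurable g)
    (p : EuclideanSpace ℝ (Fin n)) {ρ : ℝ} (hρ : 0 < ρ) :
    ∫⁻ z in ball (0 : EuclideanSpace ℝ (Fin n)) 1, g (p + ρ • z) =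
      ENNReal.ofReal ((ρ ^ n)⁻¹) * ∫⁻ y in ball p ρ, g y := by
  rw [← lintegral_indicator measurableSet_ball, ← lintegral_indicator measurableSet_ball]
  have h1 : ∀ z : EuclideanSpace ℝ (Fin n),
      (ball (0 : EuclideanSpace ℝ (Fin n)) 1).indicator (fun z => g (p + ρ • z)) z =
      (ball p ρ).indicator g (p + ρ • z) := by
    intro z
    have : z ∈ ball (0 : EuclideanSpace ℝ (Fin n)) 1 ↔ p + ρ • z ∈ ball p ρ := by
      simp only [mem_ball, dist_zero_right, dist_self_add_left, norm_smul, Real.norm_eq_abs,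
        abs_of_pos hρ]
      constructor
      · intro h; nlinarith
      · intro h; by_contra h'; push Not at h'; nlinarith
    by_cases hz : z ∈ ball (0 : EuclideanSpace ℝ (Fin n)) 1
    · rw [indicator_of_mem hz, indicator_of_mem (this.1 hz)]
    · rw [indicator_of_notMem hz, indicator_of_notMem (fun h => hz (this.2 h))]
  simp_rw [h1]
  set G := (ball p ρ).indicator g
  have hG : Measurable G := hg.indicator measurableSet_ball
  have h2 : ∫⁻ z, G (p + ρ • z) = ∫⁻ y, G (p + y) ∂(Measure.map (ρ • ·) volume) := by
    rw [lintegral_map (by fun_prop) (by fun_prop)]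
  rw [h2, Measure.map_addHaar_smul _ hρ.ne', lintegral_smul_measure, lintegral_add_left_eq_self,
    finrank_euclideanSpace_fin, abs_of_pos (by positivity), smul_eq_mul]

lemma setIntegral_ball_scale {n : ℕ} (u : EuclideanSpace ℝ (Fin n) → ℝ)
    (p : EuclideanSpace ℝ (Fin n)) {ρ : ℝ} (hρ : 0 < ρ) :
    ⨍ y in ball p ρ, u y = mAvg u p ρ := by
  have h1 : ∀ z : EuclideanSpace ℝ (Fin n),
      (ball (0 : EuclideanSpace ℝ (Fin n)) 1).indicator (fun z => u (p + ρ • z)) z =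
      (ball p ρ).indicator u (p + ρ • z) := by
    intro z
    have : z ∈ ball (0 : EuclideanSpace ℝ (Fin n)) 1 ↔ p + ρ • z ∈ ball p ρ := by
      simp only [mem_ball, dist_zero_right, dist_self_add_left, norm_smul, Real.norm_eq_abs,
        abs_of_pos hρ]
      constructor
      · intro h; nlinarith
      · intro h; by_contra h'; push Not at h'; nlinarith
    by_cases hz : z ∈ ball (0 : EuclideanSpace ℝ (Fin n)) 1
    · rw [indicator_of_mem hz, indicator_of_mem (this.1 hz)]
    · rw [indicator_of_notMem hz, indicator_of_notMem (fun h => hz (this.2 h))]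
  rw [mAvg, setAverage_eq, setAverage_eq, ← integral_indicator measurableSet_ball,
    ← integral_indicator measurableSet_ball]
  simp_rw [h1]
  rw [Measure.integral_comp_smul volume (fun y => (ball p ρ).indicator u (p + y)) ρ,
    integral_add_left_eq_self, measureReal_def, measureReal_def,
    Measure.addHaar_ball_of_pos _ _ hρ, finrank_euclideanSpace_fin, ENNReal.toReal_mul,
    ENNReal.toReal_ofReal (by positivity), abs_of_pos (by positivity)]
  simp only [smul_eq_mul, mul_inv]
  ring

/-- Moving-ball estimate along a segment. -/
lemma lintegral_edist_le {n : ℕ} {D : Set (EuclideanSpace ℝ (Fin n))} (hD : IsOpen D)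
    {u : EuclideanSpace ℝ (Fin n) → ℝ} (hu : DifferentiableOn ℝ u D)
    (p q : EuclideanSpace ℝ (Fin n)) {ρ₁ ρ₂ c : ℝ} (hc : 0 < c) (h1 : c ≤ ρ₁) (h2 : c ≤ ρ₂)
    (A : Set (EuclideanSpace ℝ (Fin n))) (hAD : A ⊆ D)
    (hA : ∀ τ ∈ Icc (0 : ℝ) 1, ball (p + τ • (q - p)) (ρ₁ + τ * (ρ₂ - ρ₁)) ⊆ A) :
    ∫⁻ z in ball (0 : EuclideanSpace ℝ (Fin n)) 1, edist (u (p + ρ₁ • z)) (u (q + ρ₂ • z)) ≤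
      ENNReal.ofReal ((‖q - p‖ + |ρ₂ - ρ₁|) * (c ^ n)⁻¹) * ∫⁻ y in A, gradE D u y := by
  have hρ : ∀ τ ∈ Icc (0 : ℝ) 1, c ≤ ρ₁ + τ * (ρ₂ - ρ₁) := by
    intro τ hτ
    nlinarith [hτ.1, hτ.2, mul_nonneg hτ.1 (sub_nonneg.2 h2),
      mul_nonneg (sub_nonneg.2 hτ.2) (sub_nonneg.2 h1)]
  set w : ℝ := ‖q - p‖ + |ρ₂ - ρ₁| with hw
  have hw0 : 0 ≤ w := by positivity
  have hgm := measurable_gradE hD u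
  have key : ∀ (z : EuclideanSpace ℝ (Fin n)) (τ : ℝ),
      p + ρ₁ • z + τ • (q + ρ₂ • z - (p + ρ₁ • z)) =
        p + τ • (q - p) + (ρ₁ + τ * (ρ₂ - ρ₁)) • z := by
    intro z τ; module
  have hstep : ∀ z ∈ ball (0 : EuclideanSpace ℝ (Fin n)) 1,
      edist (u (p + ρ₁ • z)) (u (q + ρ₂ • z)) ≤ ENNReal.ofReal w *
        ∫⁻ τ in Icc (0 : ℝ) 1, gradE D u (p + τ • (q - p) + (ρ₁ + τ * (ρ₂ - ρ₁)) • z) := by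
    intro z hz
    have hz1 : ‖z‖ < 1 := by simpa using hz
    have := edist_le_segment hD hu (p + ρ₁ • z) (q + ρ₂ • z) (by
      intro τ hτ
      rw [key]
      refine hAD (hA τ hτ ?_)
      have hpos := hc.trans_le (hρ τ hτ)
      rw [mem_ball, dist_self_add_left, norm_smul, Real.norm_eq_abs, abs_of_pos hpos]
      nlinarith)
    simp only [key] at this
    refine this.trans ?_
    gcongr
    rw [← ofReal_norm]
    refine ENNReal.ofReal_le_ofReal ?_
    have : q + ρ₂ • z - (p + ρ₁ • z) = (q - p) + (ρ₂ - ρ₁) • z := by module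
    rw [this]
    refine (norm_add_le _ _).trans ?_
    rw [norm_smul, Real.norm_eq_abs, hw]
    nlinarith [abs_nonneg (ρ₂ - ρ₁)]
  have hm2 : Measurable fun zt : EuclideanSpace ℝ (Fin n) × ℝ =>
      gradE D u (p + zt.2 • (q - p) + (ρ₁ + zt.2 * (ρ₂ - ρ₁)) • zt.1) :=
    hgm.comp (by fun_prop)
  calc ∫⁻ z in ball (0 : EuclideanSpace ℝ (Fin n)) 1, edist (u (p + ρ₁ • z)) (u (q + ρ₂ • z))
      ≤ ∫⁻ z in ball (0 : EuclideanSpace ℝ (Fin n)) 1, ENNReal.ofReal w *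
        ∫⁻ τ in Icc (0 : ℝ) 1, gradE D u (p + τ • (q - p) + (ρ₁ + τ * (ρ₂ - ρ₁)) • z) :=
        setLIntegral_mono' measurableSet_ball hstep
    _ = ENNReal.ofReal w * ∫⁻ z in ball (0 : EuclideanSpace ℝ (Fin n)) 1,
        ∫⁻ τ in Icc (0 : ℝ) 1, gradE D u (p + τ • (q - p) + (ρ₁ + τ * (ρ₂ - ρ₁)) • z) := by
        rw [lintegral_const_mul' _ _ ENNReal.ofReal_ne_top]
    _ = ENNReal.ofReal w * ∫⁻ τ in Icc (0 : ℝ) 1,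
        ∫⁻ z in ball (0 : EuclideanSpace ℝ (Fin n)) 1,
          gradE D u (p + τ • (q - p) + (ρ₁ + τ * (ρ₂ - ρ₁)) • z) := by
        rw [lintegral_lintegral_swap]
        exact hm2.aemeasurable
    _ ≤ ENNReal.ofReal w * ∫⁻ τ in Icc (0 : ℝ) 1,
          ENNReal.ofReal ((c ^ n)⁻¹) * ∫⁻ y in A, gradE D u y := by
        gcongr ENNReal.ofReal w * ?_
        refine setLIntegral_mono' measurableSet_Icc fun τ hτ => ?_
        rw [lintegral_ball_scale hgm _ (hc.trans_le (hρ τ hτ))]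
        have h3 := hρ τ hτ
        have h4 : ∫⁻ y in ball (p + τ • (q - p)) (ρ₁ + τ * (ρ₂ - ρ₁)), gradE D u y ≤
          ∫⁻ y in A, gradE D u y := lintegral_mono_set (hA τ hτ)
        gcongr
    _ = _ := by
        rw [setLIntegral_const, Real.volume_Icc, sub_zero, ENNReal.ofReal_one, mul_one,
          ENNReal.ofReal_mul hw0, mul_assoc]

lemma integrableOn_of_closedBall {n : ℕ} {D : Set (EuclideanSpace ℝ (Fin n))}
    {u : EuclideanSpace ℝ (Fin n) → ℝ} (hu : DifferentiableOn ℝ u D)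
    (p : EuclideanSpace ℝ (Fin n)) {ρ : ℝ} (hρ : 0 < ρ) (h : closedBall p ρ ⊆ D) :
    IntegrableOn (fun z => u (p + ρ • z)) (ball (0 : EuclideanSpace ℝ (Fin n)) 1) := by
  have h1 : ContinuousOn (fun z => u (p + ρ • z))
      (closedBall (0 : EuclideanSpace ℝ (Fin n)) 1) := by
    refine hu.continuousOn.comp (by fun_prop) fun z hz => h ?_
    have hz1 : ‖z‖ ≤ 1 := by simpa using hz
    rw [mem_closedBall, dist_self_add_left, norm_smul, Real.norm_eq_abs, abs_of_pos hρ]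
    nlinarith
  exact (h1.integrableOn_compact (isCompact_closedBall _ _)).mono_set ball_subset_closedBall

/-- Second integrability fact: the radius may reach the boundary. -/
lemma edist_mAvg_le_aux {n : ℕ} 
    {u : EuclideanSpace ℝ (Fin n) → ℝ} 
    (p q : EuclideanSpace ℝ (Fin n)) {ρ₁ ρ₂ : ℝ}
    (i1 : IntegrableOn (fun z => u (p + ρ₁ • z)) (ball (0 : EuclideanSpace ℝ (Fin n)) 1))
    (i2 : IntegrableOn (fun z => u (q + ρ₂ • z)) (ball (0 : EuclideanSpace ℝ (Fin n)) 1)) :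
    edist (mAvg u p ρ₁) (mAvg u q ρ₂) ≤
      (volume (ball (0 : EuclideanSpace ℝ (Fin n)) 1))⁻¹ *
      ∫⁻ z in ball (0 : EuclideanSpace ℝ (Fin n)) 1,
        edist (u (p + ρ₁ • z)) (u (q + ρ₂ • z)) := by
  have hv0 : volume (ball (0 : EuclideanSpace ℝ (Fin n)) 1) ≠ 0 :=
    (measure_ball_pos _ _ one_pos).ne'
  have hvt : volume (ball (0 : EuclideanSpace ℝ (Fin n)) 1) ≠ ∞ := measure_ball_lt_top.ne
  rw [mAvg, mAvg, setAverage_eq, setAverage_eq, edist_eq_enorm_sub, ← smul_sub,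
    ← integral_sub i1 i2, enorm_smul]
  gcongr
  · rw [Real.enorm_eq_ofReal (by positivity), measureReal_def,
      ENNReal.ofReal_inv_of_pos (ENNReal.toReal_pos hv0 hvt), ENNReal.ofReal_toReal hvt]
  · refine (enorm_integral_le_lintegral_enorm _).trans_eq ?_
    simp only [edist_eq_enorm_sub]

lemma edist_mAvg_le {n : ℕ} {D : Set (EuclideanSpace ℝ (Fin n))} (hD : IsOpen D)
    {u : EuclideanSpace ℝ (Fin n) → ℝ} (hu : DifferentiableOn ℝ u D)
    (p q : EuclideanSpace ℝ (Fin n)) {ρ₁ ρ₂ c : ℝ} (hc : 0 < c) (h1 : c ≤ ρ₁) (h2 : c ≤ ρ₂)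
    (A : Set (EuclideanSpace ℝ (Fin n))) (hAD : A ⊆ D)
    (hp : closedBall p ρ₁ ⊆ D) (hq : closedBall q ρ₂ ⊆ D)
    (hA : ∀ τ ∈ Icc (0 : ℝ) 1, ball (p + τ • (q - p)) (ρ₁ + τ * (ρ₂ - ρ₁)) ⊆ A) :
    edist (mAvg u p ρ₁) (mAvg u q ρ₂) ≤
      (volume (ball (0 : EuclideanSpace ℝ (Fin n)) 1))⁻¹ *
      (ENNReal.ofReal ((‖q - p‖ + |ρ₂ - ρ₁|) * (c ^ n)⁻¹) * ∫⁻ y in A, gradE D u y) := by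
  refine (edist_mAvg_le_aux p q (integrableOn_of_closedBall hu p (hc.trans_le h1) hp)
    (integrableOn_of_closedBall hu q (hc.trans_le h2) hq)).trans ?_
  gcongr
  exact lintegral_edist_le hD hu p q hc h1 h2 A hAD hA

/-- Comparison of the average over a ball touching the boundary with an inner average. -/
lemma edist_mAvg_big_le {n : ℕ} {D : Set (EuclideanSpace ℝ (Fin n))} (hD : IsOpen D)
    {u : EuclideanSpace ℝ (Fin n) → ℝ} (hu : DifferentiableOn ℝ u D)
    (p : EuclideanSpace ℝ (Fin n)) {R ρ : ℝ} (hρ : 0 < ρ) (hρR : ρ < R)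
    (hp : ball p R ⊆ D) (hfin : ∫⁻ y in ball p R, gradE D u y ≠ ∞) :
    edist (mAvg u p ρ) (mAvg u p R) ≤
      (volume (ball (0 : EuclideanSpace ℝ (Fin n)) 1))⁻¹ *
      (ENNReal.ofReal (R * (ρ ^ n)⁻¹) * ∫⁻ y in ball p R, gradE D u y) := by
  have hmain := lintegral_edist_le hD hu p p hρ le_rfl hρR.le (ball p R) hp (by
    intro τ hτ
    simp only [sub_self, smul_zero, add_zero]
    refine ball_subset_ball ?_
    nlinarith [hτ.1, hτ.2])
  have hρc : closedBall p ρ ⊆ D := (closedBall_subset_ball hρR).trans hp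
  have i1 := integrableOn_of_closedBall hu p hρ hρc
  have hcont : ContinuousOn (fun z => u (p + R • z)) (ball (0 : EuclideanSpace ℝ (Fin n)) 1) := by
    refine hu.continuousOn.comp (by fun_prop) fun z hz => hp ?_
    have hz1 : ‖z‖ < 1 := by simpa using hz
    rw [mem_ball, dist_self_add_left, norm_smul, Real.norm_eq_abs, abs_of_pos (hρ.trans hρR)]
    nlinarith
  have hmeas := hcont.aestronglyMeasurable (μ := volume) measurableSet_ball
  have i2 : IntegrableOn (fun z => u (p + R • z)) (ball (0 : EuclideanSpace ℝ (Fin n)) 1) := by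
    have : IntegrableOn (fun z => u (p + ρ • z) - u (p + R • z))
        (ball (0 : EuclideanSpace ℝ (Fin n)) 1) := by
      refine ⟨i1.aestronglyMeasurable.sub hmeas, ?_⟩
      refine lt_of_le_of_lt (le_of_eq ?_) (lt_of_le_of_lt hmain
        (ENNReal.mul_lt_top ENNReal.ofReal_lt_top (lt_top_iff_ne_top.2 hfin)))
      simp only [edist_eq_enorm_sub]
    have h := i1.sub this
    refine h.congr (Eventually.of_forall fun z => ?_)
    simp
  refine (edist_mAvg_le_aux p p i1 i2).trans ?_
  refine mul_le_mul_right (hmain.trans ?_) _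
  gcongr
  rw [sub_self, norm_zero, zero_add, abs_of_pos (by linarith)]
  linarith

lemma tendsto_mAvg {n : ℕ} {u : EuclideanSpace ℝ (Fin n) → ℝ} {x : EuclideanSpace ℝ (Fin n)}
    (hu : ContinuousAt u x) {p : ℕ → EuclideanSpace ℝ (Fin n)} {ρ : ℕ → ℝ}
    (hp : Tendsto p atTop (𝓝 x)) (hρ : Tendsto ρ atTop (𝓝 0))
    (hi : ∀ k, IntegrableOn (fun z => u (p k + ρ k • z))
      (ball (0 : EuclideanSpace ℝ (Fin n)) 1)) :
    Tendsto (fun k => mAvg u (p k) (ρ k)) atTop (𝓝 (u x)) := by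
  have hv0 : volume (ball (0 : EuclideanSpace ℝ (Fin n)) 1) ≠ 0 :=
    (measure_ball_pos _ _ one_pos).ne'
  have hvt : volume (ball (0 : EuclideanSpace ℝ (Fin n)) 1) ≠ ∞ := measure_ball_lt_top.ne
  rw [Metric.tendsto_atTop]
  intro ε hε
  obtain ⟨δ, hδ, hδu⟩ := Metric.continuousAt_iff.1 hu (ε / 2) (half_pos hε)
  obtain ⟨N1, hN1⟩ := Metric.tendsto_atTop.1 hp (δ / 2) (half_pos hδ)
  obtain ⟨N2, hN2⟩ := Metric.tendsto_atTop.1 hρ (δ / 2) (half_pos hδ)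
  refine ⟨max N1 N2, fun k hk => ?_⟩
  have e1 := hN1 k ((le_max_left _ _).trans hk)
  have e2 := hN2 k ((le_max_right _ _).trans hk)
  rw [Real.dist_eq, sub_zero] at e2
  have hmem : mAvg u (p k) (ρ k) ∈ closedBall (u x) (ε / 2) := by
    rw [mAvg]
    refine (convex_closedBall (u x) (ε / 2)).set_average_mem isClosed_closedBall hv0 hvt ?_ (hi k)
    refine (ae_restrict_iff' measurableSet_ball).2 (Eventually.of_forall fun z hz => ?_)
    have hz1 : ‖z‖ < 1 := by simpa using hz
    refine (hδu ?_).le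
    calc dist (p k + ρ k • z) x ≤ dist (p k + ρ k • z) (p k) + dist (p k) x := dist_triangle _ _ _
      _ < δ := by
        rw [dist_self_add_left, norm_smul, Real.norm_eq_abs]
        nlinarith [abs_nonneg (ρ k), norm_nonneg z]
  exact lt_of_le_of_lt hmem (half_lt_self hε)

lemma scale_bound {n : ℕ} {D : Set (EuclideanSpace ℝ (Fin n))} (hD : IsOpen D)
    {u : EuclideanSpace ℝ (Fin n) → ℝ} (hu : DifferentiableOn ℝ u D)
    {γ : ℝ → EuclideanSpace ℝ (Fin n)} {t₁ t₂ ρ ρ' : ℝ} (ht : t₁ ≤ t₂)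
    (hγ : LipschitzOnWith 1 γ (Icc t₁ t₂)) (hρ : 0 < ρ) (hρ1 : ρ ≤ ρ') (hρ2 : ρ' < 4 * ρ)
    (N : ℕ) (hN0 : 0 < N) (hN : t₂ - t₁ ≤ N * ρ) (Q : ℝ≥0∞)
    (hb : ∀ t ∈ Icc t₁ t₂, ball (γ t) (4 * ρ) ⊆ D)
    (hQ : ∀ t ∈ Icc t₁ t₂, ∫⁻ y in ball (γ t) (4 * ρ), gradE D u y ≤ Q) :
    edist (mAvg u (γ t₁) ρ) (mAvg u (γ t₂) ρ') ≤
      (volume (ball (0 : EuclideanSpace ℝ (Fin n)) 1))⁻¹ *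
      (ENNReal.ofReal ((N + 3) * ρ * (ρ ^ n)⁻¹) * Q) := by
  set V := (volume (ball (0 : EuclideanSpace ℝ (Fin n)) 1))⁻¹ with hV
  set h : ℝ := (t₂ - t₁) / N with hh
  have hNr : (0 : ℝ) < N := by exact_mod_cast hN0
  have hh0 : 0 ≤ h := div_nonneg (by linarith) hNr.le
  have hNh : N * h = t₂ - t₁ := by rw [hh]; field_simp
  have hhρ : h ≤ ρ := by rw [hh, div_le_iff₀ hNr]; linarith
  have hmem : ∀ i : ℕ, i ≤ N → t₁ + i * h ∈ Icc t₁ t₂ := by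
    intro i hi
    have hi' : (i : ℝ) ≤ N := by exact_mod_cast hi
    have : (i : ℝ) * h ≤ N * h := by gcongr
    constructor
    · have : 0 ≤ (i : ℝ) * h := by positivity
      linarith
    · linarith
  have hcb : ∀ t ∈ Icc t₁ t₂, ∀ r, r < 4 * ρ → closedBall (γ t) r ⊆ D :=
    fun t ht r hr => (closedBall_subset_ball hr).trans (hb t ht)
  have hstep : ∀ i, i < N →
      edist (mAvg u (γ (t₁ + i * h)) ρ) (mAvg u (γ (t₁ + (i + 1 : ℕ) * h)) ρ) ≤
        V * (ENNReal.ofReal (ρ * (ρ ^ n)⁻¹) * Q) := by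
    intro i hi
    have m1 := hmem i hi.le
    have m2 := hmem (i + 1) hi
    have hd : ‖γ (t₁ + (i + 1 : ℕ) * h) - γ (t₁ + i * h)‖ ≤ h := by
      rw [← dist_eq_norm]
      refine (hγ.dist_le_mul _ m2 _ m1).trans ?_
      rw [Real.dist_eq]
      push_cast
      rw [show t₁ + ((i : ℝ) + 1) * h - (t₁ + i * h) = h by ring, abs_of_nonneg hh0]
      simp
    refine (edist_mAvg_le hD hu _ _ hρ le_rfl le_rfl _ (hb _ m1) (hcb _ m1 _ (by linarith))
      (hcb _ m2 _ (by linarith)) ?_).trans ?_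
    · intro τ hτ
      refine ball_subset_ball' ?_
      rw [dist_self_add_left, norm_smul, Real.norm_eq_abs, abs_of_nonneg hτ.1]
      have := mul_le_mul hτ.2 hd (norm_nonneg _) zero_le_one
      linarith
    · have := hQ _ m1
      gcongr
      rw [sub_self, abs_zero, add_zero]
      linarith
  have hchain : edist (mAvg u (γ t₁) ρ) (mAvg u (γ t₂) ρ) ≤
      N * (V * (ENNReal.ofReal (ρ * (ρ ^ n)⁻¹) * Q)) := by
    have := edist_le_range_sum_of_edist_le (f := fun i : ℕ => mAvg u (γ (t₁ + i * h)) ρ) N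
      (d := fun _ => V * (ENNReal.ofReal (ρ * (ρ ^ n)⁻¹) * Q)) (fun {k} hk => hstep k hk)
    simpa [hNh] using this
  have hlast : edist (mAvg u (γ t₂) ρ) (mAvg u (γ t₂) ρ') ≤
      V * (ENNReal.ofReal (3 * ρ * (ρ ^ n)⁻¹) * Q) := by
    have m2 : t₂ ∈ Icc t₁ t₂ := right_mem_Icc.2 ht
    refine (edist_mAvg_le hD hu _ _ hρ le_rfl hρ1 _ (hb _ m2) (hcb _ m2 _ (by linarith))
      (hcb _ m2 _ hρ2) ?_).trans ?_
    · intro τ hτ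
      simp only [sub_self, smul_zero, add_zero]
      refine ball_subset_ball ?_
      nlinarith [hτ.1, hτ.2]
    · have := hQ _ m2
      gcongr
      rw [sub_self, norm_zero, zero_add, abs_of_nonneg (by linarith)]
      linarith
  refine (edist_triangle _ (mAvg u (γ t₂) ρ) _).trans ((add_le_add hchain hlast).trans_eq ?_)
  rw [show ((N : ℝ) + 3) * ρ * (ρ ^ n)⁻¹ = N * (ρ * (ρ ^ n)⁻¹) + 3 * ρ * (ρ ^ n)⁻¹ by ring,
    ENNReal.ofReal_add (by positivity) (by positivity),
    ENNReal.ofReal_mul (p := (N : ℝ)) (by positivity), ENNReal.ofReal_natCast]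
  ring

lemma ball_infDist_frontier_subset {n : ℕ} {D : Set (EuclideanSpace ℝ (Fin n))}
    (hD : IsOpen D) {x : EuclideanSpace ℝ (Fin n)} (hx : x ∈ D) :
    ball x (infDist x (frontier D)) ⊆ D := by
  intro y hy
  by_contra hyD
  have hpos : 0 < infDist x (frontier D) := dist_nonneg.trans_lt hy
  have hno : ∀ z ∈ ball x (infDist x (frontier D)), z ∉ frontier D := by
    intro z hz1 hz2
    have := infDist_le_dist_of_mem (x := x) hz2
    rw [mem_ball, dist_comm] at hz1
    linarith
  rw [hD.frontier_eq] at hno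
  have hcov : ∀ z ∈ ball x (infDist x (frontier D)), z ∉ D → z ∈ (closure D)ᶜ :=
    fun z hz hzD hzc => by
      rw [hD.frontier_eq] at hz
      exact hno z hz ⟨hzc, hzD⟩
  obtain ⟨z, -, hz1, hz2⟩ := (convex_ball x (infDist x (frontier D))).isPreconnected
    D (closure D)ᶜ hD isClosed_closure.isOpen_compl
    (fun z hz => (em (z ∈ D)).imp id (hcov z hz)) ⟨x, mem_ball_self hpos, hx⟩
    ⟨y, hy, hcov y hy hyD⟩
  exact hz2 (subset_closure hz1)

lemma frontier_nonempty_aux {n : ℕ} (hn : 2 ≤ n) {D : Set (EuclideanSpace ℝ (Fin n))}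
    (hne : D.Nonempty) (hb : Bornology.IsBounded D) : (frontier D).Nonempty := by
  have : Nontrivial (EuclideanSpace ℝ (Fin n)) := by
    have : Nonempty (Fin n) := ⟨⟨0, by omega⟩⟩
    infer_instance
  rw [nonempty_iff_ne_empty]
  intro h
  rw [← isClopen_iff_frontier_eq_empty] at h
  rcases isClopen_iff.1 h with h | h
  · exact hne.ne_empty h
  · rw [h] at hb
    exact NormedSpace.unbounded_univ ℝ (EuclideanSpace ℝ (Fin n)) hb

lemma infDist_pos_aux {n : ℕ} (hn : 2 ≤ n) {D : Set (EuclideanSpace ℝ (Fin n))}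
    (hD : IsOpen D) (hb : Bornology.IsBounded D) {x : EuclideanSpace ℝ (Fin n)} (hx : x ∈ D) :
    0 < infDist x (frontier D) := by
  refine (isClosed_frontier.notMem_iff_infDist_pos (frontier_nonempty_aux hn ⟨x, hx⟩ hb)).1 ?_
  intro h
  rw [hD.frontier_eq] at h
  exact h.2 hx

/-- Uniform version of the John condition with curves of a common parameter interval. -/
lemma john_uniform {n : ℕ} (hn : 2 ≤ n) {D : Set (EuclideanSpace ℝ (Fin n))}
    {s jc jb : ℝ} {x₀ : EuclideanSpace ℝ (Fin n)} (hs : 1 ≤ s)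
    (hD : IsJohnDomain D (fun _ => s) jc jb x₀) :
    ∃ α L : ℝ, 0 < α ∧ α ≤ 1 ∧ 0 < L ∧ ∀ x ∈ D, ∃ γ : ℝ → EuclideanSpace ℝ (Fin n),
      γ 0 = x ∧ γ L = x₀ ∧ LipschitzOnWith 1 γ (Icc 0 L) ∧
      ∀ t ∈ Icc 0 L, γ t ∈ D ∧ α * t ^ s ≤ infDist (γ t) (frontier D) := by
  obtain ⟨hO, -, hB, hjc, hjb, hx₀, hJ⟩ := hD
  have hjb0 : 0 < jb := hjc.trans_le hjb
  have hd₀ := infDist_pos_aux hn hO hB hx₀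
  set d₀ := infDist x₀ (frontier D)
  have hLs : 0 < jb ^ s := Real.rpow_pos_of_pos hjb0 s
  refine ⟨min (jc / jb) (d₀ / jb ^ s), jb, lt_min (by positivity) (by positivity),
    (min_le_left _ _).trans ((div_le_one hjb0).2 hjb), hjb0, fun x hx => ?_⟩
  obtain ⟨ℓ, hℓ0, hℓb, γ, hγ0, hγℓ, hLip, hmem, hdist⟩ := hJ x hx
  refine ⟨fun t => γ (min t ℓ), by simp [hℓ0, hγ0], by simp [hℓb, hγℓ], ?_, ?_⟩
  · refine LipschitzOnWith.of_dist_le_mul fun a ha b hb => ?_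
    refine (hLip.dist_le_mul _ ⟨le_min ha.1 hℓ0, min_le_right _ _⟩ _
      ⟨le_min hb.1 hℓ0, min_le_right _ _⟩).trans ?_
    gcongr
    rw [Real.dist_eq, Real.dist_eq]
    have := abs_min_sub_min_le_max a ℓ b ℓ
    simpa using this
  · intro t ht
    refine ⟨hmem _ ⟨le_min ht.1 hℓ0, min_le_right _ _⟩, ?_⟩
    have hts : 0 ≤ t ^ s := Real.rpow_nonneg ht.1 s
    rcases le_total t ℓ with h | h
    · beta_reduce
      rw [min_eq_left h]
      have h1 := hdist t ⟨ht.1, h⟩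
      calc min (jc / jb) (d₀ / jb ^ s) * t ^ s ≤ jc / jb * t ^ s := by
            gcongr; exact min_le_left _ _
        _ ≤ jc / jb * (jb / jc * infDist (γ t) (frontier D)) := by gcongr
        _ = _ := by field_simp
    · beta_reduce
      rw [min_eq_right h, hγℓ]
      calc min (jc / jb) (d₀ / jb ^ s) * t ^ s ≤ d₀ / jb ^ s * jb ^ s := by
            gcongr
            · exact min_le_right _ _
            · exact ht.1
            · exact ht.2
        _ = d₀ := by field_simp

lemma chain_bound {n : ℕ} {D : Set (EuclideanSpace ℝ (Fin n))} (hD : IsOpen D)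
    {u : EuclideanSpace ℝ (Fin n) → ℝ} (hu : DifferentiableOn ℝ u D)
    {γ : ℝ → EuclideanSpace ℝ (Fin n)} {α L s : ℝ} (hα : 0 < α) (hL : 0 < L)
    (hs1 : 1 ≤ s) (hs2 : s < 2) {x x₀ : EuclideanSpace ℝ (Fin n)} (hx : x ∈ D)
    (h0 : γ 0 = x) (hγL : γ L = x₀) (hLip : LipschitzOnWith 1 γ (Icc 0 L))
    (hγ : ∀ t ∈ Icc 0 L, γ t ∈ D ∧ α * t ^ s ≤ infDist (γ t) (frontier D))
    (T ρ : ℕ → ℝ) (hT : ∀ k, T k = L / 2 ^ k) (hρ : ∀ k, ρ k = α / 8 * T (k + 1) ^ s)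
    (N : ℕ → ℕ) (Q : ℕ → ℝ≥0∞) (hN : ∀ k, T (k + 1) ≤ N k * ρ k)
    (hQ : ∀ k, ∀ t ∈ Icc (T (k + 1)) (T k),
      ∫⁻ y in ball (γ t) (4 * ρ k), gradE D u y ≤ Q k) :
    edist (mAvg u x₀ (α / 8 * L ^ s)) (u x) ≤
      ∑' k, (volume (ball (0 : EuclideanSpace ℝ (Fin n)) 1))⁻¹ *
      (ENNReal.ofReal ((N k + 3) * ρ k * (ρ k ^ n)⁻¹) * Q k) := by
  have hTpos : ∀ k, 0 < T k := fun k => by rw [hT]; positivity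
  have hT2 : ∀ k, T k = 2 * T (k + 1) := fun k => by rw [hT, hT, pow_succ]; field_simp
  have hTL : ∀ k, T k ≤ L := fun k => by
    rw [hT]; exact div_le_self hL.le (one_le_pow₀ (by norm_num))
  have hTlim : Tendsto T atTop (𝓝 0) := by
    have : T = fun k => L * (1 / 2 : ℝ) ^ k := by
      funext k; rw [hT, one_div, inv_pow, div_eq_mul_inv]
    rw [this]
    simpa using (tendsto_pow_atTop_nhds_zero_of_lt_one (r := (1 / 2 : ℝ)) (by norm_num)
      (by norm_num)).const_mul L
  have hρpos : ∀ k, 0 < ρ k := fun k => by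
    rw [hρ]; have := Real.rpow_pos_of_pos (hTpos (k + 1)) s; positivity
  set r : ℕ → ℝ := fun k => α / 8 * T k ^ s with hr
  have hballs : ∀ k, ∀ t ∈ Icc (T (k + 1)) (T k), ball (γ t) (4 * ρ k) ⊆ D := by
    intro k t ht
    have htL : t ∈ Icc 0 L := ⟨(hTpos _).le.trans ht.1, ht.2.trans (hTL k)⟩
    have h1 := hγ t htL
    refine (ball_subset_ball ?_).trans (ball_infDist_frontier_subset hD h1.1)
    refine le_trans ?_ h1.2
    rw [hρ]
    have : T (k + 1) ^ s ≤ t ^ s := Real.rpow_le_rpow (hTpos _).le ht.1 (by linarith)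
    have h3 := Real.rpow_pos_of_pos (hTpos (k + 1)) s
    nlinarith
  have hN0 : ∀ k, 0 < N k := by
    intro k
    rcases Nat.eq_zero_or_pos (N k) with h | h
    · have h1 := hN k
      rw [h, Nat.cast_zero, zero_mul] at h1
      linarith [hTpos (k + 1)]
    · exact h
  have hstep : ∀ k, edist (mAvg u (γ (T k)) (r k)) (mAvg u (γ (T (k + 1))) (r (k + 1))) ≤
      (volume (ball (0 : EuclideanSpace ℝ (Fin n)) 1))⁻¹ *
      (ENNReal.ofReal ((N k + 3) * ρ k * (ρ k ^ n)⁻¹) * Q k) := by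
    intro k
    have e1 : r (k + 1) = ρ k := (hρ k).symm
    have e2 : r k = 2 ^ s * ρ k := by
      simp only [hr]
      rw [hρ, hT2 k, Real.mul_rpow (by norm_num) (hTpos _).le]; ring
    have h2s1 : (1 : ℝ) ≤ 2 ^ s := Real.one_le_rpow (by norm_num) (by linarith)
    have h2s2 : (2 : ℝ) ^ s < 4 := by
      have := Real.rpow_lt_rpow_of_exponent_lt (x := (2 : ℝ)) (by norm_num) hs2
      norm_num at this
      exact this
    rw [e1, e2, edist_comm]
    have hTk := hT2 k
    have hTp := hTpos (k + 1)
    refine scale_bound hD hu (by linarith) (hLip.mono (Icc_subset_Icc hTp.le (hTL k))) (hρpos k)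
      ?_ ?_ (N k) (hN0 k) ?_ (Q k) (hballs k) (hQ k)
    · nlinarith [hρpos k]
    · nlinarith [hρpos k]
    · linarith [hN k]
  have hlim : Tendsto (fun k => mAvg u (γ (T k)) (r k)) atTop (𝓝 (u x)) := by
    refine tendsto_mAvg ((hu.differentiableAt (hD.mem_nhds hx)).continuousAt) ?_ ?_ ?_
    · rw [tendsto_iff_dist_tendsto_zero]
      refine squeeze_zero (fun _ => dist_nonneg) (fun k => ?_) hTlim
      rw [← h0]
      refine (hLip.dist_le_mul _ ⟨(hTpos k).le, hTL k⟩ _ ⟨le_rfl, hL.le⟩).trans ?_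
      rw [Real.dist_eq, sub_zero, abs_of_pos (hTpos k)]
      simp
    · have h1 : Tendsto (fun k => T k ^ s) atTop (𝓝 ((0 : ℝ) ^ s)) :=
        hTlim.rpow_const (Or.inr (by linarith))
      rw [Real.zero_rpow (by linarith)] at h1
      simpa using h1.const_mul (α / 8)
    · intro k
      have htL : T k ∈ Icc 0 L := ⟨(hTpos _).le, hTL k⟩
      have hTs := Real.rpow_pos_of_pos (hTpos k) s
      refine integrableOn_of_closedBall hu _ (by positivity) ?_
      refine (closedBall_subset_ball ?_).trans (ball_infDist_frontier_subset hD (hγ _ htL).1)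
      refine lt_of_lt_of_le ?_ (hγ _ htL).2
      simp only [hr]
      nlinarith [mul_pos hα hTs]
  have := edist_le_tsum_of_edist_le_of_tendsto₀ _ hstep hlim
  have e0 : T 0 = L := by rw [hT]; simp
  simpa only [hr, e0, hγL] using this

lemma holder_set {n : ℕ} {g : EuclideanSpace ℝ (Fin n) → ℝ≥0∞} (hg : Measurable g)
    {p : ℝ} (hp : 1 < p) (A : Set (EuclideanSpace ℝ (Fin n))) :
    ∫⁻ y in A, g y ≤ (∫⁻ y in A, g y ^ p) ^ (1 / p) * volume A ^ (1 - 1 / p) := by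
  have hpq := Real.HolderConjugate.conjExponent hp
  have h := ENNReal.lintegral_mul_le_Lp_mul_Lq (volume.restrict A) hpq
    hg.aemeasurable (g := fun _ => 1) aemeasurable_const
  simp only [Pi.mul_apply, mul_one, ENNReal.one_rpow, lintegral_one, Measure.restrict_apply_univ]
    at h
  refine h.trans_eq ?_
  congr 2
  have := hpq.inv_add_inv_eq_one
  rw [one_div, one_div]
  linarith

lemma volume_ball_rpow {n : ℕ} (hn : 2 ≤ n) (x : EuclideanSpace ℝ (Fin n)) {r e : ℝ}
    (hr : 0 < r) (he : 0 ≤ e) :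
    volume (ball x r) ^ (e / n) = ENNReal.ofReal (r ^ e) *
      volume (ball (0 : EuclideanSpace ℝ (Fin n)) 1) ^ (e / n) := by
  have hn0 : (n : ℝ) ≠ 0 := by positivity
  rw [Measure.addHaar_ball_of_pos _ _ hr, finrank_euclideanSpace_fin,
    ENNReal.mul_rpow_of_nonneg _ _ (by positivity),
    ENNReal.ofReal_rpow_of_nonneg (by positivity) (by positivity), ← Real.rpow_natCast,
    ← Real.rpow_mul hr.le]
  congr 3
  field_simp

/-- For `s > 1` the function is bounded. -/
lemma bounded_gt {n : ℕ} (hn : 2 ≤ n) {s : ℝ} (hs1 : 1 < s)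
    (hs2 : s < (n : ℝ) / ((n : ℝ) - 1)) {α L : ℝ} (hα : 0 < α) (hL : 0 < L) :
    ∃ C : ℝ≥0∞, C ≠ ∞ ∧ ∀ (D : Set (EuclideanSpace ℝ (Fin n))) (_ : IsOpen D)
      (u : EuclideanSpace ℝ (Fin n) → ℝ) (_ : DifferentiableOn ℝ u D)
      (_ : ∫⁻ y, gradE D u y ^ ((n : ℝ) / ((n : ℝ) - s * ((n : ℝ) - 1))) ≤ 1)
      (γ : ℝ → EuclideanSpace ℝ (Fin n)) (x x₀ : EuclideanSpace ℝ (Fin n)) (_ : x ∈ D)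
      (_ : γ 0 = x) (_ : γ L = x₀) (_ : LipschitzOnWith 1 γ (Icc 0 L))
      (_ : ∀ t ∈ Icc 0 L, γ t ∈ D ∧ α * t ^ s ≤ infDist (γ t) (frontier D)),
      edist (mAvg u x₀ (α / 8 * L ^ s)) (u x) ≤ C := by
  have hn2 : (2 : ℝ) ≤ n := by exact_mod_cast hn
  have hn1 : (0 : ℝ) < (n : ℝ) - 1 := by linarith
  have hsn : s * ((n : ℝ) - 1) < n := by rwa [lt_div_iff₀ hn1] at hs2
  have hs2' : s < 2 := by nlinarith
  set d : ℝ := s * ((n : ℝ) - 1) with hd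
  have hd1 : 1 < d := by nlinarith
  set p : ℝ := (n : ℝ) / ((n : ℝ) - d) with hp
  have hp1 : 1 < p := by rw [hp, one_lt_div (by linarith)]; linarith
  have hpinv : 1 - 1 / p = d / n := by rw [hp]; field_simp; ring
  set T : ℕ → ℝ := fun k => L / 2 ^ k with hT
  set ρ : ℕ → ℝ := fun k => α / 8 * T (k + 1) ^ s with hρ
  set N : ℕ → ℕ := fun k => ⌈T (k + 1) / ρ k⌉₊ with hN
  set v := volume (ball (0 : EuclideanSpace ℝ (Fin n)) 1) with hv
  have hv0 : v ≠ 0 := (measure_ball_pos _ _ one_pos).ne'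
  have hvt : v ≠ ∞ := measure_ball_lt_top.ne
  have hTpos : ∀ k, 0 < T k := fun k => by simp only [hT]; positivity
  have hρpos : ∀ k, 0 < ρ k := fun k => by
    have := Real.rpow_pos_of_pos (hTpos (k + 1)) s
    simp only [hρ]; positivity
  set Q : ℕ → ℝ≥0∞ := fun k => ENNReal.ofReal ((4 * ρ k) ^ d) * v ^ (d / n) with hQ
  refine ⟨∑' k, v⁻¹ * (ENNReal.ofReal ((N k + 3) * ρ k * (ρ k ^ n)⁻¹) * Q k), ?_, ?_⟩
  · have hsumm : ∀ e : ℝ, 0 < e → Summable fun k => T (k + 1) ^ e := by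
      intro e he
      have : (fun k => T (k + 1) ^ e) =
          fun k : ℕ => (L / 2) ^ e * (((1 / 2 : ℝ) ^ e) ^ k) := by
        funext k
        have h1 : T (k + 1) = L / 2 * (1 / 2 : ℝ) ^ k := by
          simp only [hT]
          rw [pow_succ, one_div, inv_pow]; field_simp
        rw [h1, Real.mul_rpow (by positivity) (by positivity), ← Real.rpow_natCast,
          ← Real.rpow_natCast, ← Real.rpow_mul (by norm_num), ← Real.rpow_mul (by norm_num),
          mul_comm e]
      rw [this]
      exact (summable_geometric_of_lt_one (by positivity)
        (Real.rpow_lt_one (by norm_num) (by norm_num) he)).mul_left _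
    have hbound : ∀ k, (N k + 3) * ρ k * (ρ k ^ n)⁻¹ * (4 * ρ k) ^ d ≤
        4 ^ d * (α / 8) ^ (d - n) * T (k + 1) ^ ((s - 1) * (d - 1)) +
        4 ^ d * 4 * (α / 8) ^ (1 + d - n) * T (k + 1) ^ (s * ((s - 1) * ((n : ℝ) - 1))) := by
      intro k
      have hNk : (N k : ℝ) ≤ T (k + 1) / ρ k + 1 :=
        (Nat.ceil_lt_add_one (div_nonneg (hTpos _).le (hρpos k).le)).le
      have hr := hρpos k
      have ht := hTpos (k + 1)
      have hρk : ρ k = α / 8 * T (k + 1) ^ s := rfl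
      have e1 : ρ k ^ (d - n) = (α / 8) ^ (d - n) * T (k + 1) ^ (s * (d - n)) := by
        rw [hρk, Real.mul_rpow (by positivity) (by positivity), ← Real.rpow_mul ht.le]
      have e2 : ρ k ^ (1 + d - n) = (α / 8) ^ (1 + d - n) * T (k + 1) ^ (s * (1 + d - n)) := by
        rw [hρk, Real.mul_rpow (by positivity) (by positivity), ← Real.rpow_mul ht.le]
      have e3 : (ρ k ^ n)⁻¹ * ρ k ^ d = ρ k ^ (d - n) := by
        rw [Real.rpow_sub hr, Real.rpow_natCast]; field_simp
      have e4 : ρ k * ρ k ^ (d - n) = ρ k ^ (1 + d - n) := by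
        rw [add_sub_assoc, Real.rpow_add hr, Real.rpow_one]
      have e5 : T (k + 1) * T (k + 1) ^ (s * (d - n)) = T (k + 1) ^ ((s - 1) * (d - 1)) := by
        rw [show (s - 1) * (d - 1) = 1 + s * (d - n) by rw [hd]; ring, Real.rpow_add ht,
          Real.rpow_one]
      have e6 : s * (1 + d - n) = s * ((s - 1) * ((n : ℝ) - 1)) := by rw [hd]; ring
      calc (N k + 3) * ρ k * (ρ k ^ n)⁻¹ * (4 * ρ k) ^ d
          ≤ (T (k + 1) / ρ k + 1 + 3) * ρ k * (ρ k ^ n)⁻¹ * (4 * ρ k) ^ d := by gcongr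
        _ = (T (k + 1) + 4 * ρ k) * ((ρ k ^ n)⁻¹ * (4 ^ d * ρ k ^ d)) := by
            rw [Real.mul_rpow (by norm_num) hr.le]; field_simp; ring
        _ = 4 ^ d * (T (k + 1) * ((ρ k ^ n)⁻¹ * ρ k ^ d)) +
              4 ^ d * 4 * (ρ k * ((ρ k ^ n)⁻¹ * ρ k ^ d)) := by ring
        _ = _ := by rw [e3, e4, e2, e1, e6, ← e5]; ring
    have hsum : Summable fun k => (N k + 3) * ρ k * (ρ k ^ n)⁻¹ * (4 * ρ k) ^ d := by
      refine Summable.of_nonneg_of_le (fun k => ?_) hbound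
        (((hsumm _ (by nlinarith)).mul_left _).add ((hsumm _ (by
          have : 0 < (s - 1) * ((n : ℝ) - 1) := mul_pos (by linarith) hn1
          positivity)).mul_left _))
      have := hρpos k
      positivity
    have heq : ∀ k, v⁻¹ * (ENNReal.ofReal ((N k + 3) * ρ k * (ρ k ^ n)⁻¹) * Q k) =
        v⁻¹ * v ^ (d / n) *
          ENNReal.ofReal ((N k + 3) * ρ k * (ρ k ^ n)⁻¹ * (4 * ρ k) ^ d) := by
      intro k
      have := hρpos k
      rw [ENNReal.ofReal_mul (q := (4 * ρ k) ^ d) (by positivity)]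
      simp only [hQ]
      ring
    simp_rw [heq]
    rw [ENNReal.tsum_mul_left]
    refine ENNReal.mul_ne_top (ENNReal.mul_ne_top (ENNReal.inv_ne_top.2 hv0)
      (ENNReal.rpow_ne_top_of_nonneg (by positivity) hvt)) hsum.tsum_ofReal_ne_top
  · intro D hD u hu hgrad γ x x₀ hx h0 hγL hLip hγ
    refine chain_bound hD hu hα hL hs1.le hs2' hx h0 hγL hLip hγ T ρ (fun _ => rfl)
      (fun _ => rfl) N Q ?_ ?_
    · intro k
      have := Nat.le_ceil (T (k + 1) / ρ k)
      rwa [div_le_iff₀ (hρpos k)] at this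
    · intro k t ht
      refine (holder_set (measurable_gradE hD u) hp1 _).trans ?_
      rw [hpinv, volume_ball_rpow hn _ (by have := hρpos k; positivity) (by linarith)]
      refine mul_le_of_le_one_left zero_le ?_
      refine ENNReal.rpow_le_one ((setLIntegral_le_lintegral _ _).trans hgrad) (by positivity)

/-- A discrete Hardy inequality: balls can be replaced by annuli. -/
lemma hardy_sum {n : ℕ} (hn : 2 ≤ n) (g : EuclideanSpace ℝ (Fin n) → ℝ≥0∞)
    (x : EuclideanSpace ℝ (Fin n)) {L : ℝ} (hL : 0 < L) {m : ℕ} (hm : 1 ≤ m)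
    (T : ℕ → ℝ) (hT : ∀ k, T k = L / 2 ^ k) :
    ∑' k, ENNReal.ofReal ((T k ^ m)⁻¹) * ∫⁻ y in ball x (2 * T k), g y ≤
      2 * ∑' k, ENNReal.ofReal ((T k ^ m)⁻¹) *
        ∫⁻ y in ball x (2 * T k) \ ball x (2 * T (k + 1)), g y := by
  have : Nontrivial (EuclideanSpace ℝ (Fin n)) := by
    have : Nonempty (Fin n) := ⟨⟨0, by omega⟩⟩
    infer_instance
  have hTpos : ∀ k, 0 < T k := fun k => by rw [hT]; positivity
  have hTlim : Tendsto T atTop (𝓝 0) := by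
    have : T = fun k => L * (1 / 2 : ℝ) ^ k := by
      funext k; rw [hT, one_div, inv_pow, div_eq_mul_inv]
    rw [this]
    simpa using (tendsto_pow_atTop_nhds_zero_of_lt_one (r := (1 / 2 : ℝ)) (by norm_num)
      (by norm_num)).const_mul L
  set w : ℕ → ℝ≥0∞ := fun k => ENNReal.ofReal ((T k ^ m)⁻¹) with hw
  set a : ℕ → ℝ≥0∞ := fun k => ∫⁻ y in ball x (2 * T k) \ ball x (2 * T (k + 1)), g y with ha
  have h1 : ∀ k, ∫⁻ y in ball x (2 * T k), g y ≤ ∑' j, a (k + j) := by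
    intro k
    have hsub : ball x (2 * T k) \ {x} ⊆
        ⋃ j, (ball x (2 * T (k + j)) \ ball x (2 * T (k + j + 1))) := by
      rintro y ⟨hy, hyx⟩
      have hpos : 0 < dist y x := dist_pos.2 hyx
      have hex : ∃ j, ¬ (y ∈ ball x (2 * T (k + j + 1))) := by
        have hl : Tendsto (fun j => 2 * T (k + j + 1)) atTop (𝓝 0) := by
          have h2 : Tendsto (fun j => T (k + j + 1)) atTop (𝓝 0) :=
            hTlim.comp (tendsto_atTop_mono (fun j => by simp only [id]; omega) tendsto_id)
          simpa using h2.const_mul 2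
        obtain ⟨j, hj⟩ := (hl.eventually_lt_const hpos).exists
        exact ⟨j, by rw [mem_ball]; exact hj.le.not_gt⟩
      classical
      refine mem_iUnion.2 ⟨Nat.find hex, ?_, Nat.find_spec hex⟩
      rcases Nat.eq_zero_or_pos (Nat.find hex) with h | h
      · rw [h]; exact hy
      · have := Nat.find_min hex (m := Nat.find hex - 1) (by omega)
        rw [not_not] at this
        rwa [show k + (Nat.find hex - 1) + 1 = k + Nat.find hex by omega] at this
    calc ∫⁻ y in ball x (2 * T k), g y = ∫⁻ y in ball x (2 * T k) \ {x}, g y := by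
          refine setLIntegral_congr ?_
          exact (sdiff_null_ae_eq_self (measure_singleton x)).symm
      _ ≤ ∫⁻ y in ⋃ j, (ball x (2 * T (k + j)) \ ball x (2 * T (k + j + 1))), g y :=
          lintegral_mono_set hsub
      _ ≤ _ := lintegral_iUnion_le _ _
  have h2 : ∀ k j, w k ≤ w (k + j) * (2⁻¹ : ℝ≥0∞) ^ j := by
    intro k j
    simp only [hw]
    rw [show (2⁻¹ : ℝ≥0∞) ^ j = ENNReal.ofReal ((2⁻¹ : ℝ) ^ j) by
      rw [ENNReal.ofReal_pow (by norm_num), ENNReal.ofReal_inv_of_pos (by norm_num)]; norm_num,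
      ← ENNReal.ofReal_mul (by have := hTpos (k + j); positivity)]
    refine ENNReal.ofReal_le_ofReal ?_
    have hTT : T k = T (k + j) * 2 ^ j := by
      rw [hT, hT, pow_add]; field_simp
    have hp := hTpos (k + j)
    rw [hTT, mul_pow, mul_inv]
    gcongr
    rw [inv_pow]
    gcongr
    exact le_self_pow₀ (one_le_pow₀ (by norm_num)) (by omega)
  calc ∑' k, w k * ∫⁻ y in ball x (2 * T k), g y
      ≤ ∑' k, ∑' j, (2⁻¹ : ℝ≥0∞) ^ j * (w (k + j) * a (k + j)) := by
        refine ENNReal.tsum_le_tsum fun k => ?_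
        refine (mul_le_mul_right (h1 k) _).trans ?_
        rw [← ENNReal.tsum_mul_left]
        refine ENNReal.tsum_le_tsum fun j => ?_
        calc w k * a (k + j) ≤ w (k + j) * (2⁻¹ : ℝ≥0∞) ^ j * a (k + j) :=
              mul_le_mul_left (h2 k j) _
          _ = _ := by ring
    _ = ∑' j, (2⁻¹ : ℝ≥0∞) ^ j * ∑' k, w (k + j) * a (k + j) := by
        rw [ENNReal.tsum_comm]
        simp_rw [ENNReal.tsum_mul_left]
    _ ≤ ∑' j, (2⁻¹ : ℝ≥0∞) ^ j * ∑' k, w k * a k := by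
        refine ENNReal.tsum_le_tsum fun j => mul_le_mul_right ?_ _
        exact ENNReal.tsum_comp_le_tsum_of_injective (add_left_injective j)
          (fun k => w k * a k)
    _ = _ := by
        rw [ENNReal.tsum_mul_right, ENNReal.tsum_geometric, ENNReal.one_sub_inv_two, inv_inv]

/-- The pointwise estimate for `s = 1`. -/
lemma pointwise_one {n : ℕ} (hn : 2 ≤ n) {α L : ℝ} (hα : 0 < α) (hα1 : α ≤ 1) (hL : 0 < L) :
    ∃ C : ℝ≥0∞, C ≠ ∞ ∧ ∀ (D : Set (EuclideanSpace ℝ (Fin n))) (_ : IsOpen D)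
      (u : EuclideanSpace ℝ (Fin n) → ℝ) (_ : DifferentiableOn ℝ u D)
      (γ : ℝ → EuclideanSpace ℝ (Fin n)) (x x₀ : EuclideanSpace ℝ (Fin n)) (_ : x ∈ D)
      (_ : γ 0 = x) (_ : γ L = x₀) (_ : LipschitzOnWith 1 γ (Icc 0 L))
      (_ : ∀ t ∈ Icc 0 L, γ t ∈ D ∧ α * t ^ (1 : ℝ) ≤ infDist (γ t) (frontier D)),
      edist (mAvg u x₀ (α / 8 * L ^ (1 : ℝ))) (u x) ≤
        C * ∑' k : ℕ, (∫⁻ y in ball x (2 * (L / 2 ^ k)) \ ball x (2 * (L / 2 ^ (k + 1))),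
          gradE D u y ^ (n : ℝ)) ^ (1 / (n : ℝ)) := by
  have hn2 : (2 : ℝ) ≤ n := by exact_mod_cast hn
  set T : ℕ → ℝ := fun k => L / 2 ^ k with hT
  set v := volume (ball (0 : EuclideanSpace ℝ (Fin n)) 1) with hv
  have hv0 : v ≠ 0 := (measure_ball_pos _ _ one_pos).ne'
  have hvt : v ≠ ∞ := measure_ball_lt_top.ne
  have hTpos : ∀ k, 0 < T k := fun k => by simp only [hT]; positivity
  have hT2 : ∀ k, T k = 2 * T (k + 1) := fun k => by simp only [hT]; rw [pow_succ]; field_simp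
  have hTL : ∀ k, T k ≤ L := fun k => by
    simp only [hT]; exact div_le_self hL.le (one_le_pow₀ (by norm_num))
  obtain ⟨m, rfl⟩ : ∃ m, n = m + 1 := ⟨n - 1, by omega⟩
  have hm1 : 1 ≤ m := by omega
  set N : ℕ := ⌈8 / α⌉₊ with hN
  set c₀ : ℝ := (N + 3) * ((α / 16) ^ m)⁻¹ with hc₀
  have hc₀pos : 0 < c₀ := by positivity
  set e : ℝ := (m : ℝ) / ((m + 1 : ℕ) : ℝ) with he
  have he0 : 0 ≤ e := by positivity
  have hee : 1 - 1 / ((m + 1 : ℕ) : ℝ) = e := by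
    rw [he]; push_cast; field_simp; ring
  refine ⟨v⁻¹ * ENNReal.ofReal c₀ * (2 * (ENNReal.ofReal (2 ^ m) * v ^ e)), ?_, ?_⟩
  · refine ENNReal.mul_ne_top (ENNReal.mul_ne_top (ENNReal.inv_ne_top.2 hv0)
      ENNReal.ofReal_ne_top) (ENNReal.mul_ne_top (by norm_num)
        (ENNReal.mul_ne_top ENNReal.ofReal_ne_top (ENNReal.rpow_ne_top_of_nonneg he0 hvt)))
  intro D hD u hu γ x x₀ hx h0 hγL hLip hγ
  have hρ1 : ∀ k, α / 8 * T (k + 1) ^ (1 : ℝ) = α / 16 * T k := by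
    intro k; rw [Real.rpow_one, hT2 k]; ring
  have hchain := chain_bound hD hu hα hL le_rfl (by norm_num) hx h0 hγL hLip hγ T
    (fun k => α / 8 * T (k + 1) ^ (1 : ℝ)) (fun _ => rfl) (fun _ => rfl) (fun _ => N)
    (fun k => ∫⁻ y in ball x (2 * T k), gradE D u y) ?_ ?_
  · refine hchain.trans ?_
    have hterm : ∀ k, v⁻¹ * (ENNReal.ofReal ((N + 3) * (α / 8 * T (k + 1) ^ (1 : ℝ)) *
        ((α / 8 * T (k + 1) ^ (1 : ℝ)) ^ (m + 1))⁻¹) *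
          ∫⁻ y in ball x (2 * T k), gradE D u y) =
        v⁻¹ * ENNReal.ofReal c₀ * (ENNReal.ofReal ((T k ^ m)⁻¹) *
          ∫⁻ y in ball x (2 * T k), gradE D u y) := by
      intro k
      have h1 : (N + 3) * (α / 8 * T (k + 1) ^ (1 : ℝ)) *
        ((α / 8 * T (k + 1) ^ (1 : ℝ)) ^ (m + 1))⁻¹ = c₀ * (T k ^ m)⁻¹ := by
        have := hTpos k
        rw [hρ1, hc₀, pow_succ, mul_pow]; field_simp
      rw [h1, ENNReal.ofReal_mul hc₀pos.le]
      ring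
    refine (le_of_eq (tsum_congr fun k => ?_ : _ = ∑' k, v⁻¹ * ENNReal.ofReal c₀ * (ENNReal.ofReal ((T k ^ m)⁻¹) *
          ∫⁻ y in ball x (2 * T k), gradE D u y))).trans ?_
    · exact hterm k
    rw [ENNReal.tsum_mul_left, mul_assoc (v⁻¹ * ENNReal.ofReal c₀)]
    refine mul_le_mul_right ((hardy_sum hn (gradE D u) x hL hm1 T (fun _ => rfl)).trans ?_) _
    rw [mul_assoc]
    refine mul_le_mul_right ?_ _
    rw [← ENNReal.tsum_mul_left]
    refine ENNReal.tsum_le_tsum fun k => ?_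
    have hTk := hTpos k
    calc ENNReal.ofReal ((T k ^ m)⁻¹) *
          ∫⁻ y in ball x (2 * T k) \ ball x (2 * T (k + 1)), gradE D u y
        ≤ ENNReal.ofReal ((T k ^ m)⁻¹) *
          ((∫⁻ y in ball x (2 * T k) \ ball x (2 * T (k + 1)),
            gradE D u y ^ ((m + 1 : ℕ) : ℝ)) ^ (1 / ((m + 1 : ℕ) : ℝ)) *
            (ENNReal.ofReal ((2 * T k) ^ (m : ℝ)) * v ^ e)) := by
          refine mul_le_mul_right ((holder_set (p := ((m + 1 : ℕ) : ℝ)) (measurable_gradE hD u) (by linarith) _).trans ?_) _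
          refine mul_le_mul_right ?_ _
          rw [hee]
          refine (ENNReal.rpow_le_rpow (measure_mono sdiff_subset) he0).trans_eq ?_
          exact volume_ball_rpow hn x (by positivity) (by positivity)
      _ = (ENNReal.ofReal ((T k ^ m)⁻¹) * ENNReal.ofReal ((2 * T k) ^ (m : ℝ))) * v ^ e *
          (∫⁻ y in ball x (2 * T k) \ ball x (2 * T (k + 1)),
            gradE D u y ^ ((m + 1 : ℕ) : ℝ)) ^ (1 / ((m + 1 : ℕ) : ℝ)) := by ring
      _ = _ := by
          rw [← ENNReal.ofReal_mul (by positivity), Real.rpow_natCast, mul_pow]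
          congr 3
          field_simp
  · intro k
    rw [Real.rpow_one]
    have h1 := Nat.le_ceil (8 / α)
    rw [div_le_iff₀ hα] at h1
    have := hTpos (k + 1)
    change T (k + 1) ≤ (⌈8 / α⌉₊ : ℝ) * _
    nlinarith
  · intro k t ht
    refine lintegral_mono_set (ball_subset_ball' ?_)
    have ht0 : 0 ≤ t := (hTpos _).le.trans ht.1
    have hd : dist (γ t) x ≤ t := by
      rw [← h0]
      refine (hLip.dist_le_mul _ ⟨ht0, ht.2.trans (hTL k)⟩ _ ⟨le_rfl, hL.le⟩).trans ?_
      rw [Real.dist_eq, sub_zero, abs_of_nonneg ht0]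
      simp
    rw [hρ1]
    have := hTpos k
    nlinarith [ht.2]

lemma ennreal_split (f : ℕ → ℝ≥0∞) (K : ℕ) :
    ∑' k : ℕ, f k = ∑ k ∈ Finset.range K, f k + ∑' k : ℕ, f (k + K) := by
  have h : Summable (fun k => f (k + K)) := ENNReal.summable
  exact h.sum_add_tsum_nat_add'.symm

lemma good_bound {n : ℕ} (hn : 2 ≤ n) (L : ℝ) :
    ∃ C : ℝ≥0∞, C ≠ ∞ ∧ ∀ (h : EuclideanSpace ℝ (Fin n) → ℝ≥0∞) (_ : ∫⁻ y, h y ≤ 1)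
      (x : EuclideanSpace ℝ (Fin n)) (_ : 0 < L) (K : ℕ)
      (_ : ∀ i : ℕ, ∫⁻ y in ball x (2 * (L / 2 ^ (K + i))), h y ≤ (2⁻¹ : ℝ≥0∞) ^ ((n - 1) * i)),
      ∑' k : ℕ, (∫⁻ y in ball x (2 * (L / 2 ^ k)) \ ball x (2 * (L / 2 ^ (k + 1))),
          h y) ^ (1 / (n : ℝ)) ≤ C * ENNReal.ofReal ((1 + K : ℝ) ^ (1 - 1 / (n : ℝ))) := by
  have hn2 : (2 : ℝ) ≤ n := by exact_mod_cast hn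
  set θ : ℝ≥0∞ := (2⁻¹ : ℝ≥0∞) ^ (((n - 1 : ℕ) : ℝ) / n) with hθ
  have hθ1 : θ < 1 := by
    refine ENNReal.rpow_lt_one (by simp) ?_
    have : (0 : ℝ) < ((n - 1 : ℕ) : ℝ) := by exact_mod_cast (by omega : 0 < n - 1)
    positivity
  clear_value θ
  refine ⟨1 + (1 - θ)⁻¹, ?_, ?_⟩
  · refine ENNReal.add_ne_top.2 ⟨by norm_num, ENNReal.inv_ne_top.2 ?_⟩
    exact (tsub_pos_of_lt hθ1).ne'
  intro h hh x hL K hK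
  set A : ℕ → Set (EuclideanSpace ℝ (Fin n)) :=
    fun k => ball x (2 * (L / 2 ^ k)) \ ball x (2 * (L / 2 ^ (k + 1))) with hA
  have hanti : ∀ i j : ℕ, i ≤ j → ball x (2 * (L / 2 ^ j)) ⊆ ball x (2 * (L / 2 ^ i)) := by
    intro i j hij
    refine ball_subset_ball ?_
    gcongr
    norm_num
  have hdisj : Pairwise (Function.onFun Disjoint A) := by
    intro i j hij
    wlog hlt : i < j generalizing i j
    · exact (this hij.symm (by omega)).symm
    refine Set.disjoint_left.2 fun y hy1 hy2 => hy1.2 (hanti (i + 1) j hlt hy2.1)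
  have hsum : ∑' k, ∫⁻ y in A k, h y ≤ 1 := by
    rw [← lintegral_iUnion (fun k => measurableSet_ball.diff measurableSet_ball) hdisj]
    exact (setLIntegral_le_lintegral _ _).trans hh
  have hone : (1 : ℝ≥0∞) ≤ ENNReal.ofReal ((1 + K : ℝ) ^ (1 - 1 / (n : ℝ))) := by
    rw [← ENNReal.ofReal_one]
    refine ENNReal.ofReal_le_ofReal (Real.one_le_rpow (by linarith [Nat.cast_nonneg (α := ℝ) K]) ?_)
    rw [sub_nonneg, div_le_one (by linarith)]; linarith
  have hsplit : ∑' k : ℕ, (∫⁻ y in A k, h y) ^ (1 / (n : ℝ)) =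
      ∑ k ∈ Finset.range K, (∫⁻ y in A k, h y) ^ (1 / (n : ℝ)) +
        ∑' k : ℕ, (∫⁻ y in A (k + K), h y) ^ (1 / (n : ℝ)) :=
    ennreal_split (fun k => (∫⁻ y in A k, h y) ^ (1 / (n : ℝ))) K
  change ∑' k : ℕ, (∫⁻ y in A k, h y) ^ (1 / (n : ℝ)) ≤ _
  rw [hsplit, add_mul, one_mul]
  refine add_le_add ?_ ?_
  · have hn0 : (n : ℝ) ≠ 0 := by positivity
    have h1 := ENNReal.rpow_sum_le_const_mul_sum_rpow (Finset.range K)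
      (fun k => (∫⁻ y in A k, h y) ^ (1 / (n : ℝ))) (p := (n : ℝ)) (by linarith)
    simp only [Finset.card_range] at h1
    simp_rw [← ENNReal.rpow_mul, one_div_mul_cancel hn0, ENNReal.rpow_one] at h1
    have h2 : (∑ k ∈ Finset.range K, (∫⁻ y in A k, h y) ^ (1 / (n : ℝ))) ^ (n : ℝ) ≤
        (K : ℝ≥0∞) ^ ((n : ℝ) - 1) := by
      refine h1.trans (mul_le_of_le_one_right zero_le ?_)
      exact (ENNReal.sum_le_tsum _).trans hsum
    have h3 := ENNReal.rpow_le_rpow h2 (z := 1 / (n : ℝ)) (by positivity)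
    rw [← ENNReal.rpow_mul, mul_one_div_cancel hn0, ENNReal.rpow_one, ← ENNReal.rpow_mul] at h3
    refine h3.trans ?_
    rw [← ENNReal.ofReal_rpow_of_nonneg (by positivity)
      (by rw [sub_nonneg, div_le_one (by linarith)]; linarith)]
    rw [show ((n : ℝ) - 1) * (1 / (n : ℝ)) = 1 - 1 / (n : ℝ) by field_simp]
    refine ENNReal.rpow_le_rpow ?_ (by rw [sub_nonneg, div_le_one (by linarith)]; linarith)
    rw [← ENNReal.ofReal_natCast]
    exact ENNReal.ofReal_le_ofReal (by linarith)
  · refine le_trans ?_ (le_mul_of_one_le_right zero_le hone)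
    rw [← ENNReal.tsum_geometric]
    refine ENNReal.tsum_le_tsum fun i => ?_
    have h1 : ∫⁻ y in A (i + K), h y ≤ (2⁻¹ : ℝ≥0∞) ^ ((n - 1) * i) := by
      refine le_trans (lintegral_mono_set ?_) (hK i)
      rw [add_comm]
      exact sdiff_subset
    refine (ENNReal.rpow_le_rpow h1 (by positivity)).trans_eq ?_
    rw [hθ, ← ENNReal.rpow_natCast, ← ENNReal.rpow_natCast, ← ENNReal.rpow_mul,
      ← ENNReal.rpow_mul]
    congr 1
    push_cast
    ring

lemma content_bad {n m : ℕ} (hm : 1 ≤ m) (h : EuclideanSpace ℝ (Fin n) → ℝ≥0∞)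
    (hh : ∫⁻ y, h y ≤ 1) {L : ℝ} (hL : 0 < L) (K : ℕ) :
    hContent (fun _ => (m : ℝ)) {x : EuclideanSpace ℝ (Fin n) | ∃ i : ℕ,
      (2⁻¹ : ℝ≥0∞) ^ (m * i) < ∫⁻ y in ball x (2 * (L / 2 ^ (K + i))), h y} ≤
      ENNReal.ofReal ((12 * L) ^ m * (2⁻¹ : ℝ) ^ (m * K)) := by
  set t : Set (EuclideanSpace ℝ (Fin n) × ℕ) := {b |
      (2⁻¹ : ℝ≥0∞) ^ (m * b.2) < ∫⁻ y in ball b.1 (2 * (L / 2 ^ (K + b.2))), h y} with ht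
  set r : EuclideanSpace ℝ (Fin n) × ℕ → ℝ := fun b => 2 * (L / 2 ^ (K + b.2)) with hr
  have hrpos : ∀ b, 0 < r b := fun b => by simp only [hr]; positivity
  obtain ⟨w, hwt, hdisj, hcov⟩ := Vitali.exists_disjoint_subfamily_covering_enlargement_closedBall
    t (fun b => b.1) r (2 * L) (fun b _ => by
      simp only [hr]
      gcongr
      exact div_le_self hL.le (one_le_pow₀ (by norm_num))) 5 (by norm_num)
  have hcount : w.Countable := hdisj.countable_of_nonempty_interior fun b _ => by
    refine ⟨b.1, ?_⟩
    exact ball_subset_interior_closedBall (mem_ball_self (hrpos b))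
  have : Countable w := hcount.to_subtype
  obtain ⟨e, he⟩ := Countable.exists_injective_nat w
  set f : w → EuclideanSpace ℝ (Fin n) × ℝ := fun b => (b.1.1, 6 * r b.1) with hf
  set c : ℕ → EuclideanSpace ℝ (Fin n) × ℝ := Function.extend e f (fun _ => (0, 0)) with hc
  refine (iInf₂_le c ?_).trans ?_
  · rintro x ⟨i, hi⟩
    obtain ⟨b, hb, hsub⟩ := hcov (x, i) hi
    refine mem_iUnion.2 ⟨e ⟨b, hb⟩, ?_⟩
    rw [hc, he.extend_apply]
    have : x ∈ closedBall b.1 (5 * r b) := hsub (mem_closedBall_self (hrpos (x, i)).le)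
    exact closedBall_subset_ball (by have := hrpos b; linarith) this
  · have hext : (fun i => ENNReal.ofReal ((c i).2 ^ (m : ℝ))) =
        Function.extend e (fun b => ENNReal.ofReal ((f b).2 ^ (m : ℝ))) 0 := by
      funext i
      by_cases hi : ∃ b, e b = i
      · obtain ⟨b, rfl⟩ := hi
        rw [hc, he.extend_apply, he.extend_apply]
      · rw [hc, Function.extend_apply' _ _ _ hi, Function.extend_apply' _ _ _ hi]
        have : (m : ℝ) ≠ 0 := by positivity
        simp [Real.zero_rpow this]
    rw [hext, tsum_extend_zero he]
    calc ∑' b : w, ENNReal.ofReal ((f b).2 ^ (m : ℝ))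
        ≤ ∑' b : w, ENNReal.ofReal ((12 * L) ^ m * (2⁻¹ : ℝ) ^ (m * K)) *
            ∫⁻ y in ball b.1.1 (r b.1), h y := by
          refine ENNReal.tsum_le_tsum fun b => ?_
          have hb : (2⁻¹ : ℝ≥0∞) ^ (m * b.1.2) < ∫⁻ y in ball b.1.1 (r b.1), h y := hwt b.2
          refine le_trans (le_of_eq ?_) (mul_le_mul_right hb.le _)
          rw [show (2⁻¹ : ℝ≥0∞) ^ (m * b.1.2) = ENNReal.ofReal ((2⁻¹ : ℝ) ^ (m * b.1.2)) by
            rw [ENNReal.ofReal_pow (by norm_num), ENNReal.ofReal_inv_of_pos (by norm_num)]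
            norm_num, ← ENNReal.ofReal_mul (by positivity), Real.rpow_natCast]
          congr 1
          simp only [hf, hr]
          rw [pow_mul', pow_mul', ← mul_pow, ← mul_pow, pow_add, inv_pow, inv_pow]
          congr 1
          field_simp
          norm_num
      _ = ENNReal.ofReal ((12 * L) ^ m * (2⁻¹ : ℝ) ^ (m * K)) *
            ∫⁻ y in ⋃ b : w, ball b.1.1 (r b.1), h y := by
          rw [ENNReal.tsum_mul_left, lintegral_iUnion (fun _ => measurableSet_ball)]
          intro a b hab
          exact (hdisj a.2 b.2 (fun h => hab (Subtype.ext h))).mono ball_subset_closedBall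
            ball_subset_closedBall
      _ ≤ _ := mul_le_of_le_one_right zero_le ((setLIntegral_le_lintegral _ _).trans hh)

lemma hContent_mono {n : ℕ} (β : EuclideanSpace ℝ (Fin n) → ℝ)
    {A B : Set (EuclideanSpace ℝ (Fin n))} (h : A ⊆ B) : hContent β A ≤ hContent β B :=
  le_iInf₂ fun c hc => iInf₂_le c (h.trans hc)

lemma hContent_empty {n : ℕ} {d : ℝ} (hd : 0 < d) :
    hContent (fun _ => d) (∅ : Set (EuclideanSpace ℝ (Fin n))) = 0 := by
  refine le_antisymm ((iInf₂_le (fun _ => (0, 0)) (empty_subset _)).trans ?_) zero_le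
  simp [Real.zero_rpow hd.ne']

lemma hContent_bdd {n : ℕ} {d : ℝ} (hd : 0 < d) {D : Set (EuclideanSpace ℝ (Fin n))}
    (hb : Bornology.IsBounded D) : hContent (fun _ => d) D ≠ ∞ := by
  obtain ⟨r, hr⟩ := hb.subset_ball (0 : EuclideanSpace ℝ (Fin n))
  refine ne_top_of_le_ne_top (b := ENNReal.ofReal (r ^ d)) ENNReal.ofReal_ne_top ?_
  refine (iInf₂_le (fun i : ℕ => if i = 0 then (0, r) else (0, 0)) ?_).trans ?_
  · exact hr.trans (subset_iUnion_of_subset 0 (by simp))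
  · rw [tsum_eq_single 0]
    · simp
    · intro i hi
      simp [hi, Real.zero_rpow hd.ne']

lemma grad_norm {n : ℕ} {D : Set (EuclideanSpace ℝ (Fin n))} (hD : IsOpen D)
    (u : EuclideanSpace ℝ (Fin n) → ℝ) {p e : ℝ} (hp : 0 < p) (he : 0 < e)
    (hi : IntegrableOn (fun y => ‖fderiv ℝ u y‖ ^ p) D)
    (h1 : (∫ y in D, ‖fderiv ℝ u y‖ ^ p) ^ e ≤ 1) :
    ∫⁻ y, gradE D u y ^ p ≤ 1 := by
  have h0 : ∀ y, gradE D u y ^ p =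
      D.indicator (fun y => ENNReal.ofReal (‖fderiv ℝ u y‖ ^ p)) y := by
    intro y
    by_cases hy : y ∈ D
    · rw [gradE, indicator_of_mem hy, indicator_of_mem hy,
        ← ENNReal.ofReal_rpow_of_nonneg (norm_nonneg _) hp.le, ofReal_norm]
    · rw [gradE, indicator_of_notMem hy, indicator_of_notMem hy, ENNReal.zero_rpow_of_pos hp]
  have hnn : 0 ≤ ∫ y in D, ‖fderiv ℝ u y‖ ^ p :=
    integral_nonneg fun y => Real.rpow_nonneg (norm_nonneg _) _
  have hle : ∫ y in D, ‖fderiv ℝ u y‖ ^ p ≤ 1 := by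
    by_contra hc
    push Not at hc
    exact absurd h1 (not_le.2 (Real.one_lt_rpow hc he))
  simp_rw [h0]
  rw [lintegral_indicator hD.measurableSet, ← ofReal_integral_eq_lintegral_ofReal hi
    (Eventually.of_forall fun y => Real.rpow_nonneg (norm_nonneg _) _)]
  exact ENNReal.ofReal_le_one.2 hle

lemma center_compare {n : ℕ} {D : Set (EuclideanSpace ℝ (Fin n))} (hD : IsOpen D)
    (x₀ : EuclideanSpace ℝ (Fin n)) {R ρ p : ℝ} (hρ : 0 < ρ) (hρR : ρ < R) (hp : 1 < p)
    (hsub : ball x₀ R ⊆ D) :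
    ∃ C : ℝ≥0∞, C ≠ ∞ ∧ ∀ (u : EuclideanSpace ℝ (Fin n) → ℝ), DifferentiableOn ℝ u D →
      ∫⁻ y, gradE D u y ^ p ≤ 1 →
      edist (mAvg u x₀ ρ) (⨍ y in ball x₀ R, u y) ≤ C := by
  have hp' : 0 ≤ 1 - 1 / p := by
    rw [sub_nonneg, div_le_one (by linarith)]; exact hp.le
  have hV : volume (ball x₀ R) ^ (1 - 1 / p) ≠ ∞ :=
    ENNReal.rpow_ne_top_of_nonneg hp' measure_ball_lt_top.ne
  refine ⟨(volume (ball (0 : EuclideanSpace ℝ (Fin n)) 1))⁻¹ *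
      (ENNReal.ofReal (R * (ρ ^ n)⁻¹) * volume (ball x₀ R) ^ (1 - 1 / p)), ?_, ?_⟩
  · exact ENNReal.mul_ne_top (ENNReal.inv_ne_top.2 (measure_ball_pos _ _ one_pos).ne')
      (ENNReal.mul_ne_top ENNReal.ofReal_ne_top hV)
  intro u hu h1
  have hb : ∫⁻ y in ball x₀ R, gradE D u y ≤ volume (ball x₀ R) ^ (1 - 1 / p) := by
    refine (holder_set (measurable_gradE hD u) hp _).trans ?_
    refine mul_le_of_le_one_left zero_le ?_
    exact ENNReal.rpow_le_one ((setLIntegral_le_lintegral _ _).trans h1) (by positivity)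
  rw [setIntegral_ball_scale u x₀ (hρ.trans hρR)]
  refine (edist_mAvg_big_le hD hu x₀ hρ hρR hsub (ne_top_of_le_ne_top hV hb)).trans ?_
  gcongr

lemma final_int {H C : ℝ≥0∞} (hH : H ≠ ∞) (hC : C ≠ ∞) {M : ℝ} (hM : 1 < M) :
    ∃ b : ℝ, 0 < b ∧ ∀ f : ℝ → ℝ≥0∞, (∀ t, f t ≤ H) →
      (∀ (K : ℕ) (t : ℝ), M ^ (K + 1) ≤ t → f t ≤ C * ENNReal.ofReal (M⁻¹ ^ (2 * K))) →
      ∫⁻ t in Ioi (0 : ℝ), f t ≤ ENNReal.ofReal b := by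
  have hM0 : 0 < M := by linarith
  set B : ℝ≥0∞ := H * ENNReal.ofReal M +
    C * ENNReal.ofReal (M ^ 2) * (1 - ENNReal.ofReal M⁻¹)⁻¹ with hB
  have hBt : B ≠ ∞ := by
    refine ENNReal.add_ne_top.2 ⟨ENNReal.mul_ne_top hH ENNReal.ofReal_ne_top,
      ENNReal.mul_ne_top (ENNReal.mul_ne_top hC ENNReal.ofReal_ne_top) (ENNReal.inv_ne_top.2 ?_)⟩
    refine (tsub_pos_of_lt ?_).ne'
    rw [ENNReal.ofReal_lt_one]
    exact inv_lt_one_of_one_lt₀ hM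
  refine ⟨B.toReal + 1, by positivity, fun f hf1 hf2 => ?_⟩
  have hfin : ∫⁻ t in Ioi (0 : ℝ), f t ≤ B := by
    have hcov : Ioi (0 : ℝ) ⊆ Ioo 0 M ∪ ⋃ K : ℕ, Ico (M ^ (K + 1)) (M ^ (K + 2)) := by
      intro t ht
      by_cases htM : t < M
      · exact Or.inl ⟨ht, htM⟩
      · right
        push Not at htM
        obtain ⟨K, hK1, hK2⟩ := exists_nat_pow_near (x := t / M) ((one_le_div hM0).2 htM) hM
        rw [le_div_iff₀ hM0] at hK1
        rw [div_lt_iff₀ hM0] at hK2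
        exact mem_iUnion.2 ⟨K, by rw [pow_succ]; exact hK1, by rw [pow_succ]; exact hK2⟩
    refine (lintegral_mono_set hcov).trans ((lintegral_union_le _ _ _).trans (add_le_add ?_ ?_))
    · refine (lintegral_mono fun t => hf1 t).trans ?_
      rw [setLIntegral_const, Real.volume_Ioo, sub_zero]
    · refine (lintegral_iUnion_le _ _).trans ?_
      rw [← ENNReal.tsum_geometric, ← ENNReal.tsum_mul_left]
      refine ENNReal.tsum_le_tsum fun K => ?_
      refine (setLIntegral_mono' measurableSet_Ico (fun t ht => hf2 K t ht.1)).trans ?_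
      rw [setLIntegral_const, Real.volume_Ico, mul_assoc, mul_assoc]
      refine mul_le_mul_right ?_ _
      rw [← ENNReal.ofReal_pow (by positivity), ← ENNReal.ofReal_mul (by positivity),
        ← ENNReal.ofReal_mul (by positivity)]
      refine ENNReal.ofReal_le_ofReal ?_
      have h1 : M⁻¹ ^ (2 * K) * M ^ (K + 2) = M ^ 2 * M⁻¹ ^ K := by
        rw [two_mul, pow_add, pow_add]; simp only [inv_pow]; field_simp
      rw [← h1]
      have : 0 < M ^ (K + 1) := by positivity
      exact mul_le_mul_of_nonneg_left (by linarith) (by positivity)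
  exact hfin.trans (ENNReal.le_ofReal_iff_toReal_le hBt (by positivity) |>.2 (by linarith))

end helpers

/-- Exponential integrability in `s`-John domains, `s` constant (Corollary 1.2);
the integral is the Choquet integral with respect to the Hausdorff content
`H^{s(n-1)}_∞`. -/
theorem sJohn_exponential_integrability {n : ℕ} (hn : 2 ≤ n)
    (D : Set (EuclideanSpace ℝ (Fin n)))
    (s : ℝ) (jc jb : ℝ)
    (x₀ : EuclideanSpace ℝ (Fin n))
    (hD : IsJohnDomain D (fun _ => s) jc jb x₀)
    (hs1 : 1 ≤ s) (hs2 : s < (n : ℝ) / ((n : ℝ) - 1)) :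
    ∃ a b : ℝ, 0 < a ∧ 0 < b ∧
      ∀ u : EuclideanSpace ℝ (Fin n) → ℝ, DifferentiableOn ℝ u D →
        LocallyIntegrableOn u D →
        IntegrableOn
          (fun y => ‖fderiv ℝ u y‖ ^ ((n : ℝ) / ((n : ℝ) - s * ((n : ℝ) - 1)))) D →
        (∫ y in D, ‖fderiv ℝ u y‖ ^ ((n : ℝ) / ((n : ℝ) - s * ((n : ℝ) - 1))))
            ^ (((n : ℝ) - s * ((n : ℝ) - 1)) / n) ≤ 1 →
        (∫⁻ t in Set.Ioi (0 : ℝ),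
            hContent (fun _ => s * ((n : ℝ) - 1))
              {x | x ∈ D ∧
                Real.exp (a * |u x -
                    ⨍ y in Metric.ball x₀ (Metric.infDist x₀ (frontier D)), u y|
                      ^ ((n : ℝ) / (s * ((n : ℝ) - 1)))) > t})
          ≤ ENNReal.ofReal b := by
  obtain ⟨hO, -, hB, -, -, hx₀, -⟩ := id hD
  have hn2 : (2 : ℝ) ≤ n := by exact_mod_cast hn
  have hn1 : (0 : ℝ) < (n : ℝ) - 1 := by linarith
  have hsn : s * ((n : ℝ) - 1) < n := by rwa [lt_div_iff₀ hn1] at hs2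
  have hd0 : 0 < s * ((n : ℝ) - 1) := by positivity
  have hp1 : 1 < (n : ℝ) / ((n : ℝ) - s * ((n : ℝ) - 1)) := by
    rw [one_lt_div (by linarith)]; linarith
  have he0 : 0 < ((n : ℝ) - s * ((n : ℝ) - 1)) / n := div_pos (by linarith) (by linarith)
  have hH := hContent_bdd hd0 hB
  obtain ⟨α, L, hα, hα1, hL, hJ⟩ := john_uniform hn hs1 hD
  have hd₀ := infDist_pos_aux hn hO hB hx₀
  have hLs : 0 < L ^ s := Real.rpow_pos_of_pos hL s
  have hρ : 0 < α / 8 * L ^ s := by positivity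
  have hρR : α / 8 * L ^ s < infDist x₀ (frontier D) := by
    obtain ⟨γ, -, hγL, -, hγ⟩ := hJ x₀ hx₀
    have := (hγ L ⟨hL.le, le_rfl⟩).2
    rw [hγL] at this
    nlinarith [mul_pos hα hLs]
  obtain ⟨C₀, hC₀, hcen⟩ := center_compare hO x₀ hρ hρR hp1 (ball_infDist_frontier_subset hO hx₀)
  rcases hs1.eq_or_lt with hs | hlt
  · subst hs
    rw [one_mul] at *
    have hpn : (n : ℝ) / ((n : ℝ) - ((n : ℝ) - 1)) = n := by
      rw [sub_sub_cancel, div_one]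
    simp only [hpn] at hcen ⊢
    obtain ⟨C₁, hC₁, hpt⟩ := pointwise_one hn hα hα1 hL
    obtain ⟨C₂, hC₂, hgood⟩ := good_bound hn L
    set c : ℝ := C₀.toReal + (C₁ * C₂).toReal + 1 with hc
    have hcpos : 0 < c := by positivity
    set q : ℝ := (n : ℝ) / ((n : ℝ) - 1) with hq
    have hq0 : 0 < q := by positivity
    have hcq : 0 < c ^ q := Real.rpow_pos_of_pos hcpos q
    set M : ℝ := Real.exp (Real.log 2 / 2) with hM
    have hM1 : 1 < M := Real.one_lt_exp_iff.2 (by have := Real.log_pos one_lt_two; positivity)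
    have hM2 : M ^ 2 = 2 := by
      rw [hM, ← Real.exp_nat_mul]
      rw [show ((2 : ℕ) : ℝ) * (Real.log 2 / 2) = Real.log 2 by push_cast; ring]
      exact Real.exp_log two_pos
    obtain ⟨b, hb0, hb⟩ := final_int hH
      (ENNReal.ofReal_ne_top (r := (12 * L) ^ (n - 1))) hM1
    refine ⟨Real.log 2 / 2 / c ^ q, b, ?_, hb0, fun u hu _ hi h1 => ?_⟩
    · have := Real.log_pos one_lt_two
      positivity
    have hg := grad_norm hO u (by linarith) he0 hi h1
    have hcu := hcen u hu hg
    refine hb _ (fun t => hContent_mono _ fun x hx => hx.1) fun K t hKt => ?_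
    have hm : ((n : ℝ) - 1) = ((n - 1 : ℕ) : ℝ) := by
      rw [Nat.cast_sub (by omega)]; simp
    have hbad := content_bad (n := n) (m := n - 1) (by omega) (fun y => gradE D u y ^ (n : ℝ)) hg hL K
    rw [← hm] at hbad
    refine (hContent_mono _ ?_).trans (hbad.trans ?_)
    · rintro x ⟨hxD, hxt⟩
      by_contra hx
      simp only [Set.mem_ofPred_eq, not_exists, not_lt] at hx
      obtain ⟨γ, h0, hγL, hLip, hγ⟩ := hJ x hxD
      have hA := hpt D hO u hu γ x x₀ hxD h0 hγL hLip hγ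
      have hG := hgood _ hg x hL K hx
      set k : ℝ := (1 + K : ℝ) ^ (1 - 1 / (n : ℝ)) with hk
      have hk1 : 1 ≤ k := by
        refine Real.one_le_rpow (by linarith [Nat.cast_nonneg (α := ℝ) K]) ?_
        rw [sub_nonneg, div_le_one (by linarith)]; linarith
      have h3 : edist (mAvg u x₀ (α / 8 * L ^ (1 : ℝ))) (u x) ≤ C₁ * C₂ * ENNReal.ofReal k := by
        refine hA.trans ?_
        rw [mul_assoc]
        exact mul_le_mul_right hG _
      have h4 : dist (mAvg u x₀ (α / 8 * L ^ (1 : ℝ))) (u x) ≤ (C₁ * C₂).toReal * k := by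
        have := ENNReal.toReal_mono (ENNReal.mul_ne_top (ENNReal.mul_ne_top hC₁ hC₂)
          ENNReal.ofReal_ne_top) h3
        rwa [← dist_edist, ENNReal.toReal_mul, ENNReal.toReal_ofReal (by linarith)] at this
      have h5 := ENNReal.toReal_mono hC₀ hcu
      rw [← dist_edist] at h5
      have h6 : |u x - ⨍ y in ball x₀ (infDist x₀ (frontier D)), u y| ≤ c * k := by
        rw [← Real.dist_eq]
        refine (dist_triangle_left _ _ (mAvg u x₀ (α / 8 * L ^ (1 : ℝ)))).trans ?_
        have : 0 ≤ C₀.toReal := ENNReal.toReal_nonneg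
        rw [hc]
        nlinarith
      have hkq : k ^ q = 1 + K := by
        rw [hk, ← Real.rpow_mul (by positivity), hq]
        rw [show (1 - 1 / (n : ℝ)) * ((n : ℝ) / ((n : ℝ) - 1)) = 1 by
          field_simp, Real.rpow_one]
      have h7 : |u x - ⨍ y in ball x₀ (infDist x₀ (frontier D)), u y| ^ q ≤ c ^ q * (1 + K) := by
        refine (Real.rpow_le_rpow (abs_nonneg _) h6 hq0.le).trans_eq ?_
        rw [Real.mul_rpow hcpos.le (by linarith), hkq]
      have h8 : Real.exp (Real.log 2 / 2 / c ^ q *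
          |u x - ⨍ y in ball x₀ (infDist x₀ (frontier D)), u y| ^ q) ≤ M ^ (K + 1) := by
        rw [hM, ← Real.exp_nat_mul]
        refine Real.exp_le_exp.2 ?_
        have hl := Real.log_pos one_lt_two
        refine (mul_le_mul_of_nonneg_left h7 (by positivity)).trans_eq ?_
        push_cast
        field_simp
        ring
      exact absurd hxt (not_lt.2 (h8.trans hKt))
    · rw [ENNReal.ofReal_mul (by positivity)]
      refine mul_le_mul_right (ENNReal.ofReal_le_ofReal ?_) _
      rw [inv_pow M, pow_mul M, hM2, ← inv_pow]
      exact pow_le_pow_of_le_one (by norm_num) (by norm_num)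
        (Nat.le_mul_of_pos_left K (by omega))
  · obtain ⟨C₁, hC₁, hpt⟩ := bounded_gt hn hlt hs2 hα hL
    set c : ℝ := C₀.toReal + C₁.toReal with hc
    have hcpos : 0 ≤ c := by positivity
    set q : ℝ := (n : ℝ) / (s * ((n : ℝ) - 1)) with hq
    have hq0 : 0 < q := div_pos (by linarith) hd0
    obtain ⟨b, hb0, hb⟩ := final_int hH ENNReal.zero_ne_top
      (M := Real.exp (c ^ q) + 1) (by linarith [Real.exp_pos (c ^ q)])
    refine ⟨1, b, one_pos, hb0, fun u hu _ hi h1 => ?_⟩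
    have hg := grad_norm hO u (by linarith) he0 hi h1
    have hcu := hcen u hu hg
    refine hb _ (fun t => hContent_mono _ fun x hx => hx.1) fun K t hKt => ?_
    rw [zero_mul, ← hContent_empty (n := n) hd0]
    refine hContent_mono _ ?_
    rintro x ⟨hxD, hxt⟩
    obtain ⟨γ, h0, hγL, hLip, hγ⟩ := hJ x hxD
    have h4 := ENNReal.toReal_mono hC₁ (hpt D hO u hu hg γ x x₀ hxD h0 hγL hLip hγ)
    have h5 := ENNReal.toReal_mono hC₀ hcu
    rw [← dist_edist] at h4 h5
    have h6 : |u x - ⨍ y in ball x₀ (infDist x₀ (frontier D)), u y| ≤ c := by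
      rw [← Real.dist_eq]
      refine (dist_triangle_left _ _ (mAvg u x₀ (α / 8 * L ^ s))).trans ?_
      rw [hc]
      linarith
    have h7 := Real.exp_le_exp.2 (Real.rpow_le_rpow (abs_nonneg _) h6 hq0.le)
    rw [one_mul] at hxt
    have h8 : Real.exp (c ^ q) + 1 ≤ (Real.exp (c ^ q) + 1) ^ (K + 1) :=
      le_self_pow₀ (by linarith [Real.exp_pos (c ^ q)]) (by omega)
    exact absurd hxt (not_lt.2 (by linarith))
end
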